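/- Let (G, C0, φ0) be a minimal counterexample to the extension theorem, with G embedded in the plane so that C0 bounds the outer face. Let [x1 x6 x7 … xm] with 7 ≤ m ≤ 9 be an internal face (so this face has length m − 4, between 3 and 5), and let [x1 x2 x3 x4 x5 x6] be an internal 6-face sharing the edge x1x6 with it. Let x be the third neighbor of xm (besides x(m−1) and x1). If every xi with i ≠ 2 is a 3-vertex and x is an internal vertex, then x2 has degree at least 5. -/

import Mathlib

open SimpleGraph

namespace IFPaper

variable {V : Type}

/-- An `(I,F)`-coloring of a graph, encoded as a Boolean coloring where
`true` means color `I` and `false` means color `F`:  the `I`-colored vertices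
form an independent set and the `F`-colored vertices induce a forest
(no cycle has all of its vertices colored `F`). -/
def IFColoring (G : SimpleGraph V) (c : V → Bool) : Prop :=
  (∀ ⦃u v : V⦄, G.Adj u v → c u = true → c v = false) ∧
  (∀ (v : V) (w : G.Walk v v), w.IsCycle → ¬ (∀ x ∈ w.support, c x = false))

/-- A graph is `(I,F)`-colorable if it admits an `(I,F)`-coloring. -/
def IFColorable (G : SimpleGraph V) : Prop := ∃ c : V → Bool, IFColoring G c

/-- An `(I,F)`-coloring of the subgraph of `G` induced on the set `S`. -/
def IFColoringOn (G : SimpleGraph V) (S : Set V) (c : V → Bool) : Prop :=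
  (∀ ⦃u v : V⦄, u ∈ S → v ∈ S → G.Adj u v → c u = true → c v = false) ∧
  (∀ (v : V) (w : G.Walk v v), w.IsCycle → (∀ x ∈ w.support, x ∈ S) →
    ¬ (∀ x ∈ w.support, c x = false))

/-- A splitting `F`-path of (the vertex set `Q` of) a cycle: a path all of whose
vertices get color `F`, whose two endpoints lie on `Q`, and all of whose other
vertices (at least one) do not lie on `Q`. -/
def IsSplittingFPath (G : SimpleGraph V) (Q : Set V) (c : V → Bool)
    {a b : V} (p : G.Walk a b) : Prop :=
  p.IsPath ∧ (∀ x ∈ p.support, c x = false) ∧ a ∈ Q ∧ b ∈ Q ∧ 2 ≤ p.length ∧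
  ∀ x ∈ p.support, x ≠ a → x ≠ b → x ∉ Q

/-- A super IF-coloring of `(G, Q)`: an `(I,F)`-coloring of `G` with no
splitting `F`-path of `Q`. -/
def SuperIFColoring (G : SimpleGraph V) (Q : Set V) (c : V → Bool) : Prop :=
  IFColoring G c ∧ ∀ (a b : V) (p : G.Walk a b), ¬ IsSplittingFPath G Q c p

/-- `d* ≥ 3`: any two distinct cycles of length at most `5` are at distance at
least `3`. -/
def Cycles5Apart (G : SimpleGraph V) : Prop :=
  ∀ ⦃u v : V⦄ (c1 : G.Walk u u) (c2 : G.Walk v v),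
    c1.IsCycle → c2.IsCycle → c1.length ≤ 5 → c2.length ≤ 5 →
    {e : Sym2 V | e ∈ c1.edges} ≠ {e : Sym2 V | e ∈ c2.edges} →
    ∀ x ∈ c1.support, ∀ y ∈ c2.support, 3 ≤ G.dist x y

/-- A claw of the cycle `C`: a vertex not on `C` with three neighbors on `C`. -/
def HasClaw (G : SimpleGraph V) {v : V} (C : G.Walk v v) : Prop :=
  ∃ x : V, x ∉ C.support ∧ ∃ a b c : V, a ∈ C.support ∧ b ∈ C.support ∧ c ∈ C.support ∧
    a ≠ b ∧ a ≠ c ∧ b ≠ c ∧ G.Adj x a ∧ G.Adj x b ∧ G.Adj x c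

/-- A triclaw of the cycle `C`: a triangle `x y z` disjoint from `C`, joined by
three edges to three distinct vertices of `C`. -/
def HasTriclaw (G : SimpleGraph V) {v : V} (C : G.Walk v v) : Prop :=
  ∃ x y z : V, x ∉ C.support ∧ y ∉ C.support ∧ z ∉ C.support ∧
    G.Adj x y ∧ G.Adj y z ∧ G.Adj x z ∧
    ∃ a b c : V, a ∈ C.support ∧ b ∈ C.support ∧ c ∈ C.support ∧
      a ≠ b ∧ a ≠ c ∧ b ≠ c ∧ G.Adj x a ∧ G.Adj y b ∧ G.Adj z c

/-- A bad cycle is a `9`-cycle having a claw or a triclaw. -/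
def IsBadCycle (G : SimpleGraph V) {v : V} (C : G.Walk v v) : Prop :=
  C.IsCycle ∧ C.length = 9 ∧ (HasClaw G C ∨ HasTriclaw G C)

/-- A good cycle is a cycle that is not bad. -/
def IsGoodCycle (G : SimpleGraph V) {v : V} (C : G.Walk v v) : Prop :=
  C.IsCycle ∧ ¬ IsBadCycle G C

/-- The interior of an arc parametrized by `[0,1]`. -/
def ArcInterior (γ : ℝ → ℝ × ℝ) : Set (ℝ × ℝ) := γ '' Set.Ioo 0 1

/-- The image of an arc parametrized by `[0,1]`. -/
def ArcImage (γ : ℝ → ℝ × ℝ) : Set (ℝ × ℝ) := γ '' Set.Icc 0 1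

/-- A plane embedding of a simple graph: an injective placement of the vertices
in the plane together with, for every edge, a simple arc joining the images of
its endpoints, such that arcs meet only at common endpoints and no arc passes
through a vertex. -/
structure IsPlaneEmbedding (G : SimpleGraph V) (vtx : V → ℝ × ℝ)
    (arc : V → V → ℝ → ℝ × ℝ) : Prop where
  vtx_inj : Function.Injective vtx
  arc_cont : ∀ ⦃u v : V⦄, G.Adj u v → ContinuousOn (arc u v) (Set.Icc 0 1)
  arc_injOn : ∀ ⦃u v : V⦄, G.Adj u v → Set.InjOn (arc u v) (Set.Icc 0 1)
  arc_start : ∀ ⦃u v : V⦄, G.Adj u v → arc u v 0 = vtx u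
  arc_end : ∀ ⦃u v : V⦄, G.Adj u v → arc u v 1 = vtx v
  arc_symm : ∀ ⦃u v : V⦄, G.Adj u v → ∀ t : ℝ, arc v u t = arc u v (1 - t)
  arc_avoids_vtx : ∀ ⦃u v : V⦄, G.Adj u v → ∀ w : V, vtx w ∉ ArcInterior (arc u v)
  arc_disjoint : ∀ ⦃u v u' v' : V⦄, G.Adj u v → G.Adj u' v' → s(u, v) ≠ s(u', v') →
    ArcInterior (arc u v) ∩ ArcInterior (arc u' v') = ∅

/-- A graph is planar if it admits a plane embedding. -/
def IsPlanarGraph (G : SimpleGraph V) : Prop :=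
  ∃ (vtx : V → ℝ × ℝ) (arc : V → V → ℝ → ℝ × ℝ), IsPlaneEmbedding G vtx arc

/-- The subset of the plane covered by a plane drawing of `G`. -/
def Drawing (G : SimpleGraph V) (vtx : V → ℝ × ℝ) (arc : V → V → ℝ → ℝ × ℝ) :
    Set (ℝ × ℝ) :=
  Set.range vtx ∪ ⋃ (u : V) (v : V) (_ : G.Adj u v), ArcImage (arc u v)

/-- The subset of the plane covered by the drawing of a walk `w`. -/
def WalkDrawing (G : SimpleGraph V) (arc : V → V → ℝ → ℝ × ℝ)
    {a b : V} (w : G.Walk a b) : Set (ℝ × ℝ) :=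
  ⋃ (u : V) (v : V) (_ : G.Adj u v) (_ : s(u, v) ∈ w.edges), ArcImage (arc u v)

/-- A face of a plane drawing: a connected component of the complement of the
drawing. -/
def IsFace (G : SimpleGraph V) (vtx : V → ℝ × ℝ) (arc : V → V → ℝ → ℝ × ℝ)
    (f : Set (ℝ × ℝ)) : Prop :=
  ∃ p : ℝ × ℝ, p ∉ Drawing G vtx arc ∧
    f = connectedComponentIn (Drawing G vtx arc)ᶜ p

/-- The outer face: the unbounded face. -/
def IsOuterFace (G : SimpleGraph V) (vtx : V → ℝ × ℝ) (arc : V → V → ℝ → ℝ × ℝ)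
    (f : Set (ℝ × ℝ)) : Prop :=
  IsFace G vtx arc f ∧ ¬ Bornology.IsBounded f

/-- A vertex is on a face if its image lies on the boundary of the face. -/
def VertexOnFace (vtx : V → ℝ × ℝ) (f : Set (ℝ × ℝ)) (v : V) : Prop :=
  vtx v ∈ frontier f

/-- The face `f` is bounded by the (closed) walk `w`. -/
def FaceBoundedBy (G : SimpleGraph V) (vtx : V → ℝ × ℝ) (arc : V → V → ℝ → ℝ × ℝ)
    (f : Set (ℝ × ℝ)) {a : V} (w : G.Walk a a) : Prop :=
  IsFace G vtx arc f ∧ frontier f = WalkDrawing G arc w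

/-- A vertex lies (strictly) inside the cycle `C` of the plane graph. -/
def VertexInsideCycle (G : SimpleGraph V) (vtx : V → ℝ × ℝ)
    (arc : V → V → ℝ → ℝ × ℝ) {a : V} (C : G.Walk a a) (v : V) : Prop :=
  vtx v ∉ WalkDrawing G arc C ∧
  Bornology.IsBounded (connectedComponentIn (WalkDrawing G arc C)ᶜ (vtx v))

/-- A vertex lies (strictly) outside the cycle `C` of the plane graph. -/
def VertexOutsideCycle (G : SimpleGraph V) (vtx : V → ℝ × ℝ)
    (arc : V → V → ℝ → ℝ × ℝ) {a : V} (C : G.Walk a a) (v : V) : Prop :=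
  vtx v ∉ WalkDrawing G arc C ∧
  ¬ Bornology.IsBounded (connectedComponentIn (WalkDrawing G arc C)ᶜ (vtx v))

/-- A cycle of a plane graph is separating if its interior and its exterior
each contain a vertex of the graph. -/
def IsSeparatingCycle (G : SimpleGraph V) (vtx : V → ℝ × ℝ)
    (arc : V → V → ℝ → ℝ × ℝ) {a : V} (C : G.Walk a a) : Prop :=
  (∃ v : V, VertexInsideCycle G vtx arc C v) ∧
  (∃ v : V, VertexOutsideCycle G vtx arc C v)

/-- The cycle `C` has no chord in `G`. -/
def Chordless (G : SimpleGraph V) {a : V} (C : G.Walk a a) : Prop :=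
  ∀ ⦃u v : V⦄, u ∈ C.support → v ∈ C.support → G.Adj u v → s(u, v) ∈ C.edges

/-- The precoloring `c0` of the cycle `C0` extends to a super IF-coloring of
`(G, C0)`. -/
def ExtendsToSuper (G : SimpleGraph V) {v0 : V} (C0 : G.Walk v0 v0)
    (c0 : V → Bool) : Prop :=
  ∃ c : V → Bool, SuperIFColoring G {x | x ∈ C0.support} c ∧
    ∀ x ∈ C0.support, c x = c0 x

/-- A counterexample to the extension theorem: a planar graph with `d* ≥ 3`, a
good cycle `C0` of length at most `9`, and an `(I,F)`-coloring of `G[V(C0)]`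
which does not extend to a super IF-coloring of `(G, C0)`. -/
def IsCounterexample (G : SimpleGraph V) {v0 : V} (C0 : G.Walk v0 v0)
    (c0 : V → Bool) : Prop :=
  IsPlanarGraph G ∧ Cycles5Apart G ∧ IsGoodCycle G C0 ∧ C0.length ≤ 9 ∧
  IFColoringOn G {x | x ∈ C0.support} c0 ∧ ¬ ExtendsToSuper G C0 c0

/-- The quantity `|V(G)| + |E(G)|`. -/
noncomputable def graphSize {V : Type} [Fintype V] (G : SimpleGraph V) : ℕ :=
  Fintype.card V + G.edgeSet.ncard

/-- A minimal counterexample to the extension theorem: one minimizing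
`|V(G)| + |E(G)|` among all counterexamples. -/
def IsMinimalCounterexample [Fintype V] (G : SimpleGraph V) {v0 : V}
    (C0 : G.Walk v0 v0) (c0 : V → Bool) : Prop :=
  IsCounterexample G C0 c0 ∧
  ∀ (n : ℕ) (G' : SimpleGraph (Fin n)) (v0' : Fin n) (C0' : G'.Walk v0' v0')
    (c0' : Fin n → Bool), IsCounterexample G' C0' c0' →
      graphSize G ≤ graphSize G'

/-- A chord of the cycle `C` splitting it into two cycles of lengths `l1` and
`l2`: an edge between two non-consecutive vertices of `C` together with two
cycles of lengths `l1` and `l2` which both use the chord, use otherwise only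
edges of `C`, and together partition the edges of `C`. -/
def HasChordSplit (G : SimpleGraph V) {a : V} (C : G.Walk a a) (l1 l2 : ℕ) : Prop :=
  ∃ u v : V, u ∈ C.support ∧ v ∈ C.support ∧ G.Adj u v ∧ s(u, v) ∉ C.edges ∧
    ∃ (c1 c2 : G.Walk u u), c1.IsCycle ∧ c2.IsCycle ∧
      c1.length = l1 ∧ c2.length = l2 ∧
      s(u, v) ∈ c1.edges ∧ s(u, v) ∈ c2.edges ∧
      (∀ e ∈ c1.edges, e ≠ s(u, v) → e ∈ C.edges) ∧
      (∀ e ∈ c2.edges, e ≠ s(u, v) → e ∈ C.edges) ∧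
      (∀ e ∈ C.edges, (e ∈ c1.edges ↔ e ∉ c2.edges))

/-- A `(l1, l2, l3)`-claw of the cycle `C`: a claw which together with `C`
forms three cycles of lengths `l1`, `l2` and `l3`. -/
def HasClawSplit (G : SimpleGraph V) {a : V} (C : G.Walk a a) (l1 l2 l3 : ℕ) : Prop :=
  ∃ x : V, x ∉ C.support ∧ ∃ v1 v2 v3 : V,
    v1 ∈ C.support ∧ v2 ∈ C.support ∧ v3 ∈ C.support ∧
    v1 ≠ v2 ∧ v1 ≠ v3 ∧ v2 ≠ v3 ∧ G.Adj x v1 ∧ G.Adj x v2 ∧ G.Adj x v3 ∧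
    ∃ (w1 w2 w3 : G.Walk x x), w1.IsCycle ∧ w2.IsCycle ∧ w3.IsCycle ∧
      w1.length = l1 ∧ w2.length = l2 ∧ w3.length = l3 ∧
      (∀ e ∈ w1.edges, e ∈ C.edges ∨ e = s(x, v1) ∨ e = s(x, v2) ∨ e = s(x, v3)) ∧
      (∀ e ∈ w2.edges, e ∈ C.edges ∨ e = s(x, v1) ∨ e = s(x, v2) ∨ e = s(x, v3)) ∧
      (∀ e ∈ w3.edges, e ∈ C.edges ∨ e = s(x, v1) ∨ e = s(x, v2) ∨ e = s(x, v3)) ∧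
      (∀ e ∈ C.edges, (e ∈ w1.edges ∧ e ∉ w2.edges ∧ e ∉ w3.edges) ∨
        (e ∉ w1.edges ∧ e ∈ w2.edges ∧ e ∉ w3.edges) ∨
        (e ∉ w1.edges ∧ e ∉ w2.edges ∧ e ∈ w3.edges))

/-- A special `9`-cycle: a `9`-cycle having a `(3,8)`-chord or a
`(5,5,5)`-claw. -/
def IsSpecial9Cycle (G : SimpleGraph V) {a : V} (C : G.Walk a a) : Prop :=
  C.IsCycle ∧ C.length = 9 ∧ (HasChordSplit G C 3 8 ∨ HasClawSplit G C 5 5 5)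

/-- Two cycles are normally adjacent if they share exactly one edge and
exactly two vertices. -/
def NormallyAdjacent (G : SimpleGraph V) {a b : V}
    (c1 : G.Walk a a) (c2 : G.Walk b b) : Prop :=
  (∃ e : Sym2 V, {e' : Sym2 V | e' ∈ c1.edges} ∩ {e' : Sym2 V | e' ∈ c2.edges} = {e}) ∧
  (∃ x y : V, x ≠ y ∧ {z : V | z ∈ c1.support} ∩ {z : V | z ∈ c2.support} = {x, y})

/-- A `3`-fold cover `(H, L)` of `G`. -/
def IsDPCover (G : SimpleGraph V) {W : Type} (H : SimpleGraph W)
    (L : V → Finset W) : Prop :=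
  (∀ v : V, (L v).card = 3) ∧
  (∀ ⦃u v : V⦄, u ≠ v → Disjoint (L u) (L v)) ∧
  (∀ v : V, ∀ a ∈ L v, ∀ b ∈ L v, ¬ H.Adj a b) ∧
  (∀ ⦃a b : W⦄, H.Adj a b → ∃ u v : V, G.Adj u v ∧ a ∈ L u ∧ b ∈ L v) ∧
  (∀ ⦃u v : V⦄, u ≠ v → ∀ a ∈ L u, ∀ b ∈ L v, ∀ b' ∈ L v,
    H.Adj a b → H.Adj a b' → b = b')

/-- `G` is DP-`3`-colorable: for every `3`-fold cover `(H, L)` of `G` there is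
an independent transversal picking one vertex from each fiber. -/
def DP3Colorable (G : SimpleGraph V) : Prop :=
  ∀ (W : Type) (H : SimpleGraph W) (L : V → Finset W), IsDPCover G H L →
    ∃ f : V → W, (∀ v : V, f v ∈ L v) ∧ ∀ u v : V, ¬ H.Adj (f u) (f v)

/-- A nowhere vanishing continuous function on a simply connected, locally path connected space
has a continuous logarithm. -/
theorem exists_continuous_log {E : Type*} [TopologicalSpace E] [SimplyConnectedSpace E]
    [LocallyPathConnectedSpace E] {g : E → ℂ} (hg : Continuous g) (h0 : ∀ x, g x ≠ 0) :
    ∃ L : E → ℂ, Continuous L ∧ ∀ x, Complex.exp (L x) = g x := by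
  obtain ⟨x₀⟩ : Nonempty E := inferInstance
  obtain ⟨f, ⟨-, hf⟩, -⟩ := Complex.isCoveringMapOn_exp.existsUnique_continuousMap_lifts
    ⟨g, hg⟩ (Complex.exp_log (h0 x₀)) (fun x => h0 x)
  exact ⟨f, f.continuous, fun x => congr_fun hf x⟩

/-- Two continuous logarithms of the same function on the real line differ by a constant. -/
theorem log_sub_const {L M : ℝ → ℂ} (hL : Continuous L) (hM : Continuous M)
    (h : ∀ t, Complex.exp (L t) = Complex.exp (M t)) : L 1 - L 0 = M 1 - M 0 := by
  have hk : ∀ t, ∃ n : ℤ, L t = M t + n * (2 * Real.pi * Complex.I) := fun t =>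
    Complex.exp_eq_exp_iff_exists_int.1 (h t)
  choose n hn using hk
  have hpi : (2 * Real.pi * Complex.I : ℂ) ≠ 0 := Complex.two_pi_I_ne_zero
  have hnc : Continuous fun t => ((n t : ℤ) : ℂ) := by
    have : (fun t => ((n t : ℤ) : ℂ)) = fun t => (L t - M t) / (2 * Real.pi * Complex.I) := by
      funext t
      rw [hn t]; field_simp; ring
    rw [this]
    exact (hL.sub hM).div_const _
  have hnc' : Continuous n := by
    have h1 : Topology.IsClosedEmbedding ((↑) : ℤ → ℝ) := Int.isClosedEmbedding_coe_real
    rw [h1.isEmbedding.continuous_iff]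
    have := Complex.continuous_re.comp hnc
    simpa [Function.comp_def] using this
  have : n 1 = n 0 := PreconnectedSpace.constant inferInstance hnc'
  rw [hn 1, hn 0, this]; ring

/-- The variation of the logarithm along a nowhere vanishing curve. -/
noncomputable def logVariation (γ : ℝ → ℂ) : ℂ :=
  open Classical in
  if h : ∃ L : ℝ → ℂ, Continuous L ∧ ∀ t, Complex.exp (L t) = γ t then
    h.choose 1 - h.choose 0 else 0

theorem logVariation_eq {γ L : ℝ → ℂ} (hL : Continuous L) (h : ∀ t, Complex.exp (L t) = γ t) :
    logVariation γ = L 1 - L 0 := by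
  have hex : ∃ L : ℝ → ℂ, Continuous L ∧ ∀ t, Complex.exp (L t) = γ t := ⟨L, hL, h⟩
  rw [logVariation, dif_pos hex]
  exact log_sub_const hex.choose_spec.1 hL fun t => by rw [hex.choose_spec.2, h]

theorem logVariation_eq_of_neg {γ L : ℝ → ℂ} (hL : Continuous L)
    (h : ∀ t, Complex.exp (L t) = - γ t) : logVariation γ = L 1 - L 0 := by
  rw [logVariation_eq (L := fun t => L t + Real.pi * Complex.I) (hL.add continuous_const)]
  · ring
  · intro t
    rw [Complex.exp_add, Complex.exp_pi_mul_I, h]; ring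

theorem exp_logVariation {γ : ℝ → ℂ} (hγ : Continuous γ) (h0 : ∀ t, γ t ≠ 0) :
    Complex.exp (logVariation γ) = γ 1 / γ 0 := by
  obtain ⟨L, hL, hLe⟩ := exists_continuous_log hγ h0
  rw [logVariation_eq hL hLe, Complex.exp_sub, hLe, hLe]

/-- Two disjoint curves, and the four variations between one curve and the ends of the other. -/
theorem logVariation_square {γ δ : ℝ → ℂ} (hγ : Continuous γ) (hδ : Continuous δ)
    (hd : ∀ s t, γ s ≠ δ t) :
    logVariation (fun s => γ s - δ 0) + logVariation (fun t => δ t - γ 1) =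
      logVariation (fun t => δ t - γ 0) + logVariation (fun s => γ s - δ 1) := by
  obtain ⟨L, hL, hLe⟩ := exists_continuous_log (E := ℝ × ℝ)
    (g := fun p => γ p.1 - δ p.2) (by fun_prop) (fun p => sub_ne_zero.2 (hd _ _))
  rw [logVariation_eq (L := fun s => L (s, 0)) (by fun_prop) fun t => hLe _,
    logVariation_eq (L := fun s => L (s, 1)) (by fun_prop) fun t => hLe _,
    logVariation_eq_of_neg (L := fun t => L (1, t)) (by fun_prop) fun t => by
      rw [hLe]; ring,
    logVariation_eq_of_neg (L := fun t => L (0, t)) (by fun_prop) fun t => by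
      rw [hLe]; ring]
  ring

/-- There is no drawing of `K₃,₃` in the plane in which independent edges are disjoint. -/
theorem no_plane_K33 (a b : Fin 3 → ℂ) (γ : Fin 3 → Fin 3 → ℝ → ℂ)
    (hc : ∀ i j, Continuous (γ i j)) (h0 : ∀ i j, γ i j 0 = a i) (h1 : ∀ i j, γ i j 1 = b j)
    (hd : ∀ i i' j j', i ≠ i' → j ≠ j' → ∀ s t, γ i j s ≠ γ i' j' t) : False := by
  have hnt : ∀ j : Fin 3, ∃ k, j ≠ k := by decide
  have hab : ∀ i j, b j - a i ≠ 0 := by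
    intro i j
    obtain ⟨i', hi⟩ := hnt i
    obtain ⟨j', hj⟩ := hnt j
    have := hd i' i j j' hi.symm hj 1 0
    rwa [h1, h0, ← sub_ne_zero] at this
  have haa : ∀ i i', i ≠ i' → a i - a i' ≠ 0 := by
    intro i i' hi
    have := hd i i' 0 1 hi (by decide) 0 0
    rwa [h0, h0, ← sub_ne_zero] at this
  have hbb : ∀ j j', j ≠ j' → b j - b j' ≠ 0 := by
    intro j j' hj
    have := hd 0 1 j j' (by decide) hj 1 1
    rwa [h1, h1, ← sub_ne_zero] at this
  choose lam hlam using fun i j => (⟨_, Complex.exp_log (hab i j)⟩ : ∃ l, Complex.exp l = b j - a i)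
  let sgn : Fin 3 → Fin 3 → ℂ := fun i j => if i < j then 0 else Real.pi * Complex.I
  let mu : Fin 3 → Fin 3 → ℂ := fun i i' => Complex.log (a (min i i') - a (max i i')) + sgn i i'
  let nu : Fin 3 → Fin 3 → ℂ := fun j j' => Complex.log (b (min j j') - b (max j j')) + sgn j j'
  have key : ∀ (p : Fin 3 → ℂ), (∀ i i', i ≠ i' → p i - p i' ≠ 0) → ∀ i i', i ≠ i' →
      Complex.exp (Complex.log (p (min i i') - p (max i i')) + sgn i i') = p i - p i' := by
    intro p hp i i' hi
    rcases lt_or_gt_of_ne hi with h | h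
    · simp only [sgn, if_pos h, min_eq_left h.le, max_eq_right h.le, add_zero]
      exact Complex.exp_log (hp _ _ hi)
    · simp only [sgn, if_neg (not_lt.2 h.le), min_eq_right h.le, max_eq_left h.le]
      rw [Complex.exp_add, Complex.exp_pi_mul_I, Complex.exp_log (hp _ _ hi.symm)]
      ring
  have hmu : ∀ i i', i ≠ i' → Complex.exp (mu i i') = a i - a i' := key a haa
  have hnu : ∀ j j', j ≠ j' → Complex.exp (nu j j') = b j - b j' := key b hbb
  have hA : ∀ i i' j, ∃ n : ℤ, i ≠ i' → logVariation (fun s => γ i j s - a i') =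
      lam i' j - mu i i' + n * (2 * Real.pi * Complex.I) := by
    intro i i' j
    by_cases hi : i = i'
    · exact ⟨0, fun h => absurd hi h⟩
    obtain ⟨j', hj⟩ := hnt j
    have : Complex.exp (logVariation fun s => γ i j s - a i') =
        Complex.exp (lam i' j - mu i i') := by
      rw [exp_logVariation (γ := fun s => γ i j s - _) ((hc i j).sub continuous_const), h0, h1,
          Complex.exp_sub, hlam,
        hmu _ _ hi]
      intro t
      have := hd i i' j j' hi hj t 0
      rwa [h0, ← sub_ne_zero] at this
    obtain ⟨n, hn⟩ := Complex.exp_eq_exp_iff_exists_int.1 this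
    exact ⟨n, fun _ => hn⟩
  have hB : ∀ i j j', ∃ n : ℤ, j ≠ j' → logVariation (fun s => γ i j s - b j') =
      nu j j' - lam i j' - Real.pi * Complex.I + n * (2 * Real.pi * Complex.I) := by
    intro i j j'
    by_cases hj : j = j'
    · exact ⟨0, fun h => absurd hj h⟩
    obtain ⟨i', hi⟩ := hnt i
    have : Complex.exp (logVariation fun s => γ i j s - b j') =
        Complex.exp (nu j j' - lam i j' - Real.pi * Complex.I) := by
      rw [exp_logVariation (γ := fun s => γ i j s - _) ((hc i j).sub continuous_const), h0, h1,
          Complex.exp_sub,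
        Complex.exp_sub, hlam, hnu _ _ hj, Complex.exp_pi_mul_I, div_div, mul_neg, mul_one,
        neg_sub]
      intro t
      have := hd i i' j j' hi hj t 1
      rwa [h1, ← sub_ne_zero] at this
    obtain ⟨n, hn⟩ := Complex.exp_eq_exp_iff_exists_int.1 this
    exact ⟨n, fun _ => hn⟩
  choose A hA using hA
  choose B hB using hB
  have hpi : (2 * Real.pi * Complex.I : ℂ) ≠ 0 := Complex.two_pi_I_ne_zero
  have hmain : ∀ i i' j j', i < i' → j ≠ j' →
      A i i' j - A i' i j' + B i' j' j - B i j j' + (if j < j' then 1 else 0) = 0 := by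
    intro i i' j j' hi hj
    have hsq := logVariation_square (hc i j) (hc i' j') (hd i i' j j' hi.ne hj)
    simp only [h0, h1] at hsq
    rw [hA _ _ _ hi.ne, hA _ _ _ hi.ne', hB _ _ _ hj, hB _ _ _ hj.symm] at hsq
    have hcast : ((A i i' j - A i' i j' + B i' j' j - B i j j' +
        (if j < j' then 1 else 0) : ℤ) : ℂ) * (2 * Real.pi * Complex.I) = 0 := by
      have h3 : mu i' i - mu i i' = Real.pi * Complex.I := by
        simp only [mu, sgn, if_pos hi, if_neg (not_lt.2 hi.le), min_comm i' i, max_comm i' i]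
        ring
      push_cast
      rcases lt_or_gt_of_ne hj with h | h
      · have h4 : nu j' j - nu j j' = Real.pi * Complex.I := by
          simp only [nu, sgn, if_pos h, if_neg (not_lt.2 h.le), min_comm j' j, max_comm j' j]
          ring
        rw [if_pos h]
        linear_combination hsq - h3 - h4
      · have h4 : nu j j' - nu j' j = Real.pi * Complex.I := by
          simp only [nu, sgn, if_pos h, if_neg (not_lt.2 h.le), min_comm j' j, max_comm j' j]
          ring
        rw [if_neg (not_lt.2 h.le)]
        linear_combination hsq - h3 + h4
    have := (mul_eq_zero.1 hcast).resolve_right hpi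
    exact_mod_cast this
  have e : ∀ i i' : Fin 3, i < i' → _ := fun i i' h =>
    And.intro (And.intro (hmain i i' 0 1 h (by decide)) (hmain i i' 1 0 h (by decide)))
      (And.intro (And.intro (hmain i i' 0 2 h (by decide)) (hmain i i' 2 0 h (by decide)))
        (And.intro (hmain i i' 1 2 h (by decide)) (hmain i i' 2 1 h (by decide))))
  have e1 := e 0 1 (by decide)
  have e2 := e 0 2 (by decide)
  have e3 := e 1 2 (by decide)
  simp at e1 e2 e3
  omega

/-- A drawing of a graph in the plane by connected pieces: disjoint edges are drawn disjointly, and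
edges avoid the vertices they are not incident with. -/
structure IsWeakDrawing {W : Type*} (H : SimpleGraph W) (pos : W → ℝ × ℝ)
    (Ed : W → W → Set (ℝ × ℝ)) : Prop where
  pos_inj : Function.Injective pos
  joined : ∀ ⦃u v⦄, H.Adj u v → JoinedIn (Ed u v) (pos u) (pos v)
  avoid : ∀ ⦃u v w⦄, H.Adj u v → w ≠ u → w ≠ v → pos w ∉ Ed u v
  disj : ∀ ⦃u v u' v'⦄, H.Adj u v → H.Adj u' v' → u ≠ u' → u ≠ v' → v ≠ u' → v ≠ v' →
    Disjoint (Ed u v) (Ed u' v')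

/-- The part of the plane covered by the pieces of a drawing inside a set of vertices. -/
def drawingRegion {W : Type*} (H : SimpleGraph W) (pos : W → ℝ × ℝ)
    (Ed : W → W → Set (ℝ × ℝ)) (S : Set W) : Set (ℝ × ℝ) :=
  {p | (∃ u ∈ S, p = pos u) ∨ ∃ u ∈ S, ∃ v ∈ S, H.Adj u v ∧ p ∈ Ed u v}

theorem IsWeakDrawing.disjoint_region {W : Type*} {H : SimpleGraph W} {pos : W → ℝ × ℝ}
    {Ed : W → W → Set (ℝ × ℝ)} (h : IsWeakDrawing H pos Ed) {S T : Set W} (hST : Disjoint S T) :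
    Disjoint (drawingRegion H pos Ed S) (drawingRegion H pos Ed T) := by
  have hne : ∀ {u v}, u ∈ S → v ∈ T → u ≠ v := fun hu hv => hST.ne_of_mem hu hv
  rw [Set.disjoint_left]
  rintro p (⟨u, hu, rfl⟩ | ⟨u, hu, v, hv, huv, hp⟩) (⟨u', hu', hp'⟩ | ⟨u', hu', v', hv', huv', hp'⟩)
  · exact hne hu hu' (h.pos_inj hp')
  · exact h.avoid huv' (hne hu hu') (hne hu hv') hp'
  · exact h.avoid huv (hne hu hu').symm (hne hv hu').symm (hp' ▸ hp)
  · exact Set.disjoint_left.1 (h.disj huv huv' (hne hu hu') (hne hu hv') (hne hv hu')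
      (hne hv hv')) hp hp'

theorem IsWeakDrawing.joinedIn_region {W : Type*} {H : SimpleGraph W} {pos : W → ℝ × ℝ}
    {Ed : W → W → Set (ℝ × ℝ)} (h : IsWeakDrawing H pos Ed) {S : Set W} {u v : W}
    (p : H.Walk u v) (hp : ∀ x ∈ p.support, x ∈ S) :
    JoinedIn (drawingRegion H pos Ed S) (pos u) (pos v) := by
  induction p with
  | nil => exact JoinedIn.refl (Or.inl ⟨_, hp _ (by simp), rfl⟩)
  | cons huv p ih =>
    refine JoinedIn.trans ((h.joined huv).mono fun q hq => Or.inr ⟨_, hp _ (by simp), _,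
      hp _ (by simp), huv, hq⟩) (ih fun x hx => hp _ (by simp [hx]))

/-- A set of vertices is connected in a graph if any two of its vertices are joined by a walk
inside the set. -/
def WalkConnected {W : Type*} (H : SimpleGraph W) (S : Set W) : Prop :=
  ∀ u ∈ S, ∀ v ∈ S, ∃ p : H.Walk u v, ∀ x ∈ p.support, x ∈ S

/-- A graph drawn in the plane has no `K₃,₃` minor. -/
theorem IsWeakDrawing.no_K33_minor {W : Type*} {H : SimpleGraph W} {pos : W → ℝ × ℝ}
    {Ed : W → W → Set (ℝ × ℝ)} (h : IsWeakDrawing H pos Ed) (A B : Fin 3 → Set W)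
    (hAc : ∀ i, WalkConnected H (A i)) (hBc : ∀ j, WalkConnected H (B j))
    (hA : ∀ i i', i ≠ i' → Disjoint (A i) (A i')) (hB : ∀ j j', j ≠ j' → Disjoint (B j) (B j'))
    (hAB : ∀ i j, Disjoint (A i) (B j))
    (hadj : ∀ i j, ∃ u ∈ A i, ∃ v ∈ B j, H.Adj u v) : False := by
  choose ra hra _ using fun i => hadj i 0
  have hrb : ∀ j, ∃ v, v ∈ B j := fun j => by
    obtain ⟨u, -, v, hv, -⟩ := hadj 0 j
    exact ⟨v, hv⟩
  choose rb hrb using hrb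
  have hj : ∀ i j, JoinedIn (drawingRegion H pos Ed (A i ∪ B j)) (pos (ra i)) (pos (rb j)) := by
    intro i j
    obtain ⟨u, hu, v, hv, huv⟩ := hadj i j
    obtain ⟨p, hp⟩ := hAc i _ (hra i) u hu
    obtain ⟨q, hq⟩ := hBc j v hv _ (hrb j)
    refine h.joinedIn_region (p.append (Walk.cons huv q)) fun x hx => ?_
    rw [Walk.mem_support_append_iff] at hx
    rcases hx with hx | hx
    · exact Or.inl (hp x hx)
    · rw [Walk.support_cons, List.mem_cons] at hx
      rcases hx with rfl | hx
      · exact Or.inl hu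
      · exact Or.inr (hq x hx)
  let e : ℝ × ℝ → ℂ := Complex.equivRealProdCLM.symm
  have he : Continuous e := Complex.equivRealProdCLM.symm.continuous
  have hei : Function.Injective e := Complex.equivRealProdCLM.symm.injective
  refine no_plane_K33 (fun i => e (pos (ra i))) (fun j => e (pos (rb j)))
    (fun i j t => e ((hj i j).somePath.extend t)) (fun i j => he.comp (Path.continuous_extend _))
    (by simp) (by simp) ?_
  intro i i' j j' hi hj' s t hst
  have h1 : ∀ i j s, (hj i j).somePath.extend s ∈ drawingRegion H pos Ed (A i ∪ B j) := by
    intro i j s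
    exact (hj i j).somePath_mem _
  have hd : Disjoint (A i ∪ B j) (A i' ∪ B j') := by
    rw [Set.disjoint_union_left, Set.disjoint_union_right, Set.disjoint_union_right]
    exact ⟨⟨hA _ _ hi, hAB _ _⟩, (hAB _ _).symm, hB _ _ hj'⟩
  refine Set.disjoint_left.1 (h.disjoint_region hd) (h1 i j s) ?_
  rw [hei hst]
  exact h1 i' j' t

/-- The graph obtained by adding a new vertex adjacent to all vertices of `S`. -/
def addApex (G : SimpleGraph V) (S : Set V) : SimpleGraph (Option V) where
  Adj a b := match a, b with
    | some u, some v => G.Adj u v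
    | none, some v => v ∈ S
    | some u, none => u ∈ S
    | none, none => False
  symm := ⟨by rintro (_ | u) (_ | v) h <;> first | exact h | exact SimpleGraph.Adj.symm h⟩
  loopless := ⟨by rintro (_ | u) h; exacts [h, G.loopless.irrefl _ h]⟩

theorem isCompact_arcImage {G : SimpleGraph V} {vtx : V → ℝ × ℝ} {arc : V → V → ℝ → ℝ × ℝ}
    (h : IsPlaneEmbedding G vtx arc) {u v : V} (huv : G.Adj u v) : IsCompact (ArcImage (arc u v)) :=
  isCompact_Icc.image_of_continuousOn (h.arc_cont huv)

theorem isClosed_subdrawing [Finite V] {G : SimpleGraph V} {vtx : V → ℝ × ℝ}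
    {arc : V → V → ℝ → ℝ × ℝ} (h : IsPlaneEmbedding G vtx arc) (P : V → V → Prop) :
    IsClosed (Set.range vtx ∪ ⋃ (u : V) (v : V) (_ : G.Adj u v ∧ P u v), ArcImage (arc u v)) := by
  refine (Set.finite_range vtx).isClosed.union ?_
  refine isClosed_iUnion_of_finite fun u => isClosed_iUnion_of_finite fun v =>
    isClosed_iUnion_of_finite fun huv => (isCompact_arcImage h huv.1).isClosed

theorem isClosed_drawing [Finite V] {G : SimpleGraph V} {vtx : V → ℝ × ℝ}
    {arc : V → V → ℝ → ℝ × ℝ} (h : IsPlaneEmbedding G vtx arc) : IsClosed (Drawing G vtx arc) := by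
  have := isClosed_subdrawing h (fun _ _ => True)
  simpa [Drawing] using this

theorem arcImage_eq {G : SimpleGraph V} {vtx : V → ℝ × ℝ} {arc : V → V → ℝ → ℝ × ℝ}
    (h : IsPlaneEmbedding G vtx arc) {u v : V} (huv : G.Adj u v) {p : ℝ × ℝ}
    (hp : p ∈ ArcImage (arc u v)) : p = vtx u ∨ p = vtx v ∨ p ∈ ArcInterior (arc u v) := by
  obtain ⟨t, ⟨h0, h1⟩, rfl⟩ := hp
  rcases h0.eq_or_lt with rfl | h0
  · exact Or.inl (h.arc_start huv)
  rcases h1.eq_or_lt with rfl | h1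
  · exact Or.inr (Or.inl (h.arc_end huv))
  · exact Or.inr (Or.inr ⟨t, ⟨h0, h1⟩, rfl⟩)

theorem arcInterior_subset (γ : ℝ → ℝ × ℝ) : ArcInterior γ ⊆ ArcImage γ :=
  Set.image_mono Set.Ioo_subset_Icc_self

/-- A point in the interior of one edge is not on a different edge. -/
theorem arcInterior_disjoint_arcImage {G : SimpleGraph V} {vtx : V → ℝ × ℝ}
    {arc : V → V → ℝ → ℝ × ℝ} (h : IsPlaneEmbedding G vtx arc) {u v u' v' : V} (huv : G.Adj u v)
    (huv' : G.Adj u' v') (hne : s(u, v) ≠ s(u', v')) {p : ℝ × ℝ} (hp : p ∈ ArcInterior (arc u v)) :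
    p ∉ ArcImage (arc u' v') := by
  intro hp'
  rcases arcImage_eq h huv' hp' with rfl | rfl | hp'
  · exact h.arc_avoids_vtx huv _ hp
  · exact h.arc_avoids_vtx huv _ hp
  · exact (Set.ext_iff.1 (h.arc_disjoint huv huv' hne) p).1 ⟨hp, hp'⟩

theorem joinedIn_arc {γ : ℝ → ℝ × ℝ} {a b : ℝ} (hab : a ≤ b) (hγ : ContinuousOn γ (Set.Icc a b))
    {S : Set (ℝ × ℝ)} (hS : ∀ t ∈ Set.Icc a b, γ t ∈ S) : JoinedIn S (γ a) (γ b) := by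
  have h1 : IsPathConnected (γ '' Set.Icc a b) :=
    ((convex_Icc a b).isPathConnected ⟨a, le_rfl, hab⟩).image' hγ
  refine (h1.joinedIn _ ⟨a, ⟨le_rfl, hab⟩, rfl⟩ _ ⟨b, ⟨hab, le_rfl⟩, rfl⟩).mono ?_
  rintro _ ⟨t, ht, rfl⟩
  exact hS t ht

/-- A vertex on the frontier edge `c c'` of a face can be joined to any point of the face through
the face and the edge `c c'`. -/
theorem joinedIn_face [Finite V] {G : SimpleGraph V} {vtx : V → ℝ × ℝ}
    {arc : V → V → ℝ → ℝ × ℝ} (h : IsPlaneEmbedding G vtx arc) {D : Set (ℝ × ℝ)} {p : ℝ × ℝ}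
    (hp : p ∉ Drawing G vtx arc) (hD : D = connectedComponentIn (Drawing G vtx arc)ᶜ p)
    {c c' : V} (hcc : G.Adj c c') (hfr : ArcImage (arc c c') ⊆ frontier D) :
    JoinedIn (D ∪ arc c c' '' Set.Ico 0 1) p (vtx c) := by
  have hclosed := isClosed_drawing h
  have hDo : IsOpen D := hD ▸ hclosed.isOpen_compl.connectedComponentIn
  have hpD : p ∈ D := hD ▸ mem_connectedComponentIn hp
  have hDpath : IsPathConnected D := by
    refine hDo.isConnected_iff_isPathConnected.1 ?_
    rw [hD]
    exact isConnected_connectedComponentIn_iff.2 hp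
  set q := arc c c' (1 / 2) with hq
  have hqI : q ∈ ArcInterior (arc c c') := ⟨1 / 2, by norm_num, rfl⟩
  set Z := Set.range vtx ∪ ⋃ (u : V) (v : V) (_ : G.Adj u v ∧ s(u, v) ≠ s(c, c')),
    ArcImage (arc u v) with hZ
  have hZc : IsClosed Z := isClosed_subdrawing h _
  have hqZ : q ∉ Z := by
    rintro (⟨w, hw⟩ | hq')
    · exact h.arc_avoids_vtx hcc w (hw ▸ hqI)
    · simp only [Set.mem_iUnion] at hq'
      obtain ⟨u, v, ⟨huv, hne⟩, hm⟩ := hq'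
      exact arcInterior_disjoint_arcImage h hcc huv hne.symm hqI hm
  obtain ⟨ε, hε, hball⟩ := Metric.isOpen_iff.1 hZc.isOpen_compl q hqZ
  have hqf : q ∈ closure D := frontier_subset_closure (hfr (arcInterior_subset _ hqI))
  obtain ⟨d, hdD, hdq⟩ := Metric.mem_closure_iff.1 hqf ε hε
  let σ : ℝ → ℝ × ℝ := fun t => AffineMap.lineMap d q t
  have hσ : Continuous σ := AffineMap.lineMap_continuous
  have hσball : ∀ t ∈ Set.Icc (0 : ℝ) 1, σ t ∈ Metric.ball q ε := by
    intro t ht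
    have hd : d ∈ Metric.ball q ε := by rwa [Metric.mem_ball, _root_.dist_comm]
    exact (convex_ball q ε).lineMap_mem hd (Metric.mem_ball_self hε) ht
  have hqDr : q ∈ Drawing G vtx arc := by
    refine Or.inr ?_
    simp only [Set.mem_iUnion]
    exact ⟨c, c', hcc, arcInterior_subset _ hqI⟩
  set T := Set.Icc (0 : ℝ) 1 ∩ σ ⁻¹' Drawing G vtx arc with hT
  have hTc : IsCompact T := isCompact_Icc.inter_right (hclosed.preimage hσ)
  have hTn : T.Nonempty := ⟨1, by norm_num, by simpa [σ] using hqDr⟩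
  have hmin := hTc.sInf_mem hTn
  set t0 := sInf T with ht0
  have hlt : ∀ t, 0 ≤ t → t < t0 → σ t ∉ Drawing G vtx arc := by
    intro t h0 h1 hm
    exact absurd (csInf_le hTc.bddBelow (show t ∈ T from ⟨⟨h0, h1.le.trans hmin.1.2⟩, hm⟩))
      (not_le.2 h1)
  have hDlt : ∀ t, 0 ≤ t → t < t0 → σ t ∈ D := by
    intro t h0 h1
    have hconn : IsPreconnected (σ '' Set.Icc 0 t) := isPreconnected_Icc.image _ hσ.continuousOn
    have hsub : σ '' Set.Icc 0 t ⊆ (Drawing G vtx arc)ᶜ := by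
      rintro _ ⟨s, hs, rfl⟩
      exact hlt s hs.1 (hs.2.trans_lt h1)
    have hd' : d ∈ σ '' Set.Icc 0 t := ⟨0, ⟨le_rfl, h0⟩, by simp [σ]⟩
    have h2 := hconn.subset_connectedComponentIn hd' hsub
    have h3 : connectedComponentIn (Drawing G vtx arc)ᶜ p =
        connectedComponentIn (Drawing G vtx arc)ᶜ d :=
      connectedComponentIn_eq (hD ▸ hdD)
    rw [hD, h3]
    exact h2 ⟨t, ⟨h0, le_rfl⟩, rfl⟩
  have hr : σ t0 ∈ ArcInterior (arc c c') := by
    have hnZ := hball (hσball t0 hmin.1)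
    rcases hmin.2 with hv | hv
    · exact absurd (Or.inl hv) hnZ
    · simp only [Set.mem_iUnion] at hv
      obtain ⟨u, v, huv, hm⟩ := hv
      by_cases he : s(u, v) = s(c, c')
      · have hcm : σ t0 ∈ ArcImage (arc c c') := by
          rw [Sym2.eq_iff] at he
          rcases he with ⟨rfl, rfl⟩ | ⟨rfl, rfl⟩
          · exact hm
          · obtain ⟨t, ht, hte⟩ := hm
            exact ⟨1 - t, ⟨by linarith [ht.2], by linarith [ht.1]⟩, by
              rw [← hte, ← h.arc_symm hcc]⟩
        rcases arcImage_eq h hcc hcm with h1 | h1 | h1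
        · exact absurd (Or.inl ⟨c, h1.symm⟩) hnZ
        · exact absurd (Or.inl ⟨c', h1.symm⟩) hnZ
        · exact h1
      · refine absurd (Or.inr ?_) hnZ
        simp only [Set.mem_iUnion]
        exact ⟨u, v, ⟨huv, he⟩, hm⟩
  obtain ⟨s0, hs0, hs0e⟩ := hr
  have j1 : JoinedIn (D ∪ arc c c' '' Set.Ico 0 1) p d :=
    (hDpath.joinedIn p hpD d hdD).mono Set.subset_union_left
  have j2 : JoinedIn (D ∪ arc c c' '' Set.Ico 0 1) d (σ t0) := by
    have := joinedIn_arc (γ := σ) (S := D ∪ arc c c' '' Set.Ico 0 1) hmin.1.1 hσ.continuousOn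
      (fun t ht => ?_)
    · simpa [σ] using this
    · rcases ht.2.eq_or_lt with rfl | hlt'
      · exact Or.inr ⟨s0, ⟨hs0.1.le, hs0.2⟩, hs0e⟩
      · exact Or.inl (hDlt t ht.1 hlt')
  have j3 : JoinedIn (D ∪ arc c c' '' Set.Ico 0 1) (arc c c' 0) (arc c c' s0) :=
    joinedIn_arc hs0.1.le ((h.arc_cont hcc).mono (Set.Icc_subset_Icc le_rfl hs0.2.le))
      fun t ht => Or.inr ⟨t, ⟨ht.1, ht.2.trans_lt hs0.2⟩, rfl⟩
  rw [h.arc_start hcc, hs0e] at j3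
  exact (j1.trans j2).trans j3.symm

/-- Adding an apex inside a face, joined to the vertices on its boundary cycle, keeps the graph
drawable in the plane. -/
theorem exists_weakDrawing_addApex [Finite V] {G : SimpleGraph V} {vtx : V → ℝ × ℝ}
    {arc : V → V → ℝ → ℝ × ℝ} (h : IsPlaneEmbedding G vtx arc) {D : Set (ℝ × ℝ)}
    (hD : IsFace G vtx arc D) {v0 : V} (C : G.Walk v0 v0) (hC : ¬ C.Nil)
    (hfr : frontier D = WalkDrawing G arc C) :
    ∃ pos Ed, IsWeakDrawing (addApex G {x | x ∈ C.support}) pos Ed := by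
  obtain ⟨p, hp, hDp⟩ := hD
  have hDd : ∀ q ∈ D, q ∉ Drawing G vtx arc := fun q hq => by
    rw [hDp] at hq
    exact connectedComponentIn_subset _ _ hq
  have hnb : ∀ c ∈ C.support, ∃ c', G.Adj c c' ∧ s(c, c') ∈ C.edges := by
    intro c hc
    obtain ⟨e, he, hce⟩ := (Walk.mem_support_iff_exists_mem_edges_of_not_nil hC).1 hc
    obtain ⟨c', rfl⟩ := hce
    exact ⟨c', C.adj_of_mem_edges he, he⟩
  choose! nb hnb1 hnb2 using hnb
  let E : V → Set (ℝ × ℝ) := fun c => D ∪ arc c (nb c) '' Set.Ico 0 1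
  have hEv : ∀ c ∈ C.support, ∀ w, w ≠ c → vtx w ∉ E c := by
    rintro c hc w hw (hm | ⟨t, ht, hte⟩)
    · exact hDd _ hm (Or.inl ⟨w, rfl⟩)
    · rcases ht.1.eq_or_lt with rfl | h0
      · rw [h.arc_start (hnb1 c hc)] at hte
        exact hw (h.vtx_inj hte).symm
      · exact h.arc_avoids_vtx (hnb1 c hc) w ⟨t, ⟨h0, ht.2⟩, hte⟩
  have hEe : ∀ c ∈ C.support, ∀ u v, G.Adj u v → c ≠ u → c ≠ v →
      Disjoint (E c) (ArcImage (arc u v)) := by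
    intro c hc u v huv hu hv
    rw [Set.disjoint_left]
    rintro q (hm | ⟨t, ht, rfl⟩) hq
    · refine hDd _ hm (Or.inr ?_)
      simp only [Set.mem_iUnion]
      exact ⟨u, v, huv, hq⟩
    · rcases ht.1.eq_or_lt with rfl | h0
      · rw [h.arc_start (hnb1 c hc)] at hq
        rcases arcImage_eq h huv hq with h1 | h1 | h1
        · exact hu (h.vtx_inj h1)
        · exact hv (h.vtx_inj h1)
        · exact h.arc_avoids_vtx huv _ h1
      · refine arcInterior_disjoint_arcImage h (hnb1 c hc) huv ?_ ⟨t, ⟨h0, ht.2⟩, rfl⟩ hq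
        intro he
        have : c ∈ s(u, v) := he ▸ Sym2.mem_mk_left _ _
        rcases Sym2.mem_iff.1 this with rfl | rfl
        exacts [hu rfl, hv rfl]
  have hpv : ∀ w, vtx w ≠ p := fun w hw => hp (Or.inl ⟨w, hw⟩)
  have hEj : ∀ c ∈ C.support, JoinedIn (E c) p (vtx c) := fun c hc =>
    joinedIn_face h hp hDp (hnb1 c hc) (by
      rw [hfr]
      intro q hq
      simp only [WalkDrawing, Set.mem_iUnion]
      exact ⟨c, nb c, hnb1 c hc, hnb2 c hc, hq⟩)
  refine ⟨fun a => a.elim p vtx, fun a b => match a, b with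
    | some u, some v => ArcImage (arc u v)
    | none, some v => E v
    | some u, none => E u
    | none, none => ∅, ?_, ?_, ?_, ?_⟩
  · rintro (_ | u) (_ | v) huv
    · rfl
    · exact absurd huv.symm (hpv v)
    · exact absurd huv (hpv u)
    · exact congrArg some (h.vtx_inj huv)
  · rintro (_ | u) (_ | v) huv
    · exact huv.elim
    · exact hEj v huv
    · exact (hEj u huv).symm
    · have huv : G.Adj u v := huv
      have := joinedIn_arc (S := ArcImage (arc u v)) zero_le_one (h.arc_cont huv)
        fun t ht => ⟨t, ht, rfl⟩
      rwa [h.arc_start huv, h.arc_end huv] at this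
  · rintro (_ | u) (_ | v) (_ | w) huv hu hv hm
    · exact huv
    · exact huv
    · exact hu rfl
    · exact hEv v huv w (fun e => hv (congrArg some e)) hm
    · exact hv rfl
    · exact hEv u huv w (fun e => hu (congrArg some e)) hm
    · refine hp (Or.inr ?_)
      simp only [Set.mem_iUnion]
      exact ⟨u, v, huv, hm⟩
    · rcases arcImage_eq h huv hm with h1 | h1 | h1
      · exact hu (congrArg some (h.vtx_inj h1))
      · exact hv (congrArg some (h.vtx_inj h1))
      · exact h.arc_avoids_vtx huv _ h1
  · rintro (_ | u) (_ | v) (_ | u') (_ | v') h1 h2 n1 n2 n3 n4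
    all_goals first
      | exact absurd rfl n1
      | exact absurd rfl n2
      | exact absurd rfl n3
      | exact absurd rfl n4
      | exact h1.elim
      | exact h2.elim
      | skip
    · exact hEe v h1 u' v' h2 (fun e => n3 (congrArg some e)) (fun e => n4 (congrArg some e))
    · exact hEe u h1 u' v' h2 (fun e => n1 (congrArg some e)) (fun e => n2 (congrArg some e))
    · exact (hEe v' h2 u v h1 (fun e => n2 (congrArg some e.symm))
        (fun e => n4 (congrArg some e.symm))).symm
    · exact (hEe u' h2 u v h1 (fun e => n1 (congrArg some e.symm))
        (fun e => n3 (congrArg some e.symm))).symm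
    · rw [Set.disjoint_left]
      intro q hq hq'
      have h1 : G.Adj u v := h1
      have h2 : G.Adj u' v' := h2
      have m1 : u ≠ u' := fun e => n1 (congrArg some e)
      have m2 : u ≠ v' := fun e => n2 (congrArg some e)
      have m3 : v ≠ u' := fun e => n3 (congrArg some e)
      have m4 : v ≠ v' := fun e => n4 (congrArg some e)
      have hne : s(u, v) ≠ s(u', v') := by
        intro e
        rw [Sym2.eq_iff] at e
        tauto
      rcases arcImage_eq h h1 hq with e | e | e
      · subst e
        rcases arcImage_eq h h2 hq' with e | e | e
        exacts [m1 (h.vtx_inj e), m2 (h.vtx_inj e), h.arc_avoids_vtx h2 _ e]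
      · subst e
        rcases arcImage_eq h h2 hq' with e | e | e
        exacts [m3 (h.vtx_inj e), m4 (h.vtx_inj e), h.arc_avoids_vtx h2 _ e]
      · exact arcInterior_disjoint_arcImage h h1 h2 hne e hq'

section Collapse

variable {E : Type*} [NormedAddCommGroup E] [NormedSpace ℝ E]

/-- Radial collapse of a segment onto one of its ends, fixing a disjoint compact set. -/
theorem exists_segment_collapse (o e : E) {R : Set E} (hR : IsCompact R)
    (hd : Disjoint R (segment ℝ o e)) :
    ∃ l : E → ℝ, Continuous l ∧ (∀ x, 0 ≤ l x) ∧ (∀ x ∈ R, l x = 1) ∧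
      (∀ x ∈ segment ℝ o e, l x = 0) ∧
      ∀ x y, o + l x • (x - o) = o + l y • (y - o) →
        x = y ∨ (x ∈ segment ℝ o e ∧ y ∈ segment ℝ o e) := by
  set K := segment ℝ o e with hK
  have hKc : IsCompact K := by
    rw [hK, segment_eq_image_lineMap]
    exact isCompact_Icc.image (AffineMap.lineMap_continuous)
  have hKn : K.Nonempty := ⟨o, left_mem_segment _ _ _⟩
  obtain ⟨c, hc, hcR⟩ : ∃ c : ℝ, 0 < c ∧ ∀ x ∈ R, 1 ≤ c * Metric.infDist x K := by
    rcases R.eq_empty_or_nonempty with rfl | hRn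
    · exact ⟨1, one_pos, by simp⟩
    obtain ⟨x0, hx0, hmin⟩ := hR.exists_isMinOn hRn (Metric.continuous_infDist_pt K).continuousOn
    have hpos : 0 < Metric.infDist x0 K :=
      (hKc.isClosed.notMem_iff_infDist_pos hKn).1 (Set.disjoint_left.1 hd hx0)
    refine ⟨(Metric.infDist x0 K)⁻¹, inv_pos.2 hpos, fun x hx => ?_⟩
    rw [inv_mul_eq_div, le_div_iff₀ hpos, one_mul]
    exact hmin hx
  have hmono : ∀ (t : ℝ) (v : E), 0 ≤ t → t ≤ 1 →
      Metric.infDist (o + t • v) K ≤ Metric.infDist (o + v) K := by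
    intro t v h0 h1
    have : ∀ k ∈ K, Metric.infDist (o + t • v) K ≤ Dist.dist (o + v) k := by
      intro k hk
      have hk' : o + t • (k - o) ∈ K := by
        have := (convex_segment o e).add_smul_sub_mem (left_mem_segment ℝ o e) hk ⟨h0, h1⟩
        exact this
      refine (Metric.infDist_le_dist_of_mem hk').trans ?_
      have : Dist.dist (o + t • v) (o + t • (k - o)) = t * Dist.dist (o + v) k := by
        rw [dist_eq_norm, dist_eq_norm, add_sub_add_left_eq_sub, ← smul_sub, norm_smul,
          Real.norm_of_nonneg h0]
        congr 2
        abel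
      rw [this]
      exact mul_le_of_le_one_left dist_nonneg h1
    exact (Metric.le_infDist hKn).2 fun {y} hy => this y hy
  let l : E → ℝ := fun x => min 1 (c * Metric.infDist x K)
  have hl0 : ∀ x, 0 ≤ l x := fun x =>
    le_min zero_le_one (mul_nonneg hc.le Metric.infDist_nonneg)
  have hlK : ∀ x, l x = 0 → x ∈ K := by
    intro x hx
    by_contra hxK
    have hpos := (hKc.isClosed.notMem_iff_infDist_pos hKn).1 hxK
    exact absurd hx (lt_min one_pos (mul_pos hc hpos)).ne'
  have hinj : ∀ x y, l x ≤ l y → l x • (x - o) = l y • (y - o) →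
      x = y ∨ (x ∈ K ∧ y ∈ K) := by
    intro x y hle h
    rcases (hl0 y).eq_or_lt with h0 | hy
    · exact Or.inr ⟨hlK x (le_antisymm (h0 ▸ hle) (hl0 x)), hlK y h0.symm⟩
    have hyx : y - o = (l x / l y) • (x - o) := by
      rw [div_eq_inv_mul, mul_smul, h, smul_smul, inv_mul_cancel₀ hy.ne', one_smul]
    have h1 : Metric.infDist y K ≤ Metric.infDist x K := by
      have := hmono (l x / l y) (x - o) (div_nonneg (hl0 x) hy.le) ((div_le_one hy).2 hle)
      rwa [← hyx, add_sub_cancel, add_sub_cancel] at this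
    have h2 : l y ≤ l x := min_le_min_left _ (mul_le_mul_of_nonneg_left h1 hc.le)
    rw [le_antisymm hle h2, div_self hy.ne', one_smul] at hyx
    exact Or.inl (sub_left_injective hyx).symm
  refine ⟨l, by fun_prop, hl0, fun x hx => min_eq_left (hcR x hx), fun x hx => ?_,
    fun x y h => ?_⟩
  · simp only [l, Metric.infDist_zero_of_mem hx, mul_zero]
    exact min_eq_right zero_le_one
  · have h := add_left_cancel h
    rcases le_total (l x) (l y) with hle | hle
    · exact hinj x y hle h
    · rcases hinj y x hle h.symm with h' | ⟨h1, h2⟩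
      · exact Or.inl h'.symm
      · exact Or.inr ⟨h2, h1⟩

/-- Two points of a set `Z` that are joined by a polygonal chain which otherwise avoids `Z` can be
identified by a continuous map which is injective on the rest of `Z`. -/
theorem exists_collapse_of_chain (k : ℕ) : ∀ (Z : Set E) (a b : E) (p : ℕ → E), a ∈ Z → b ∈ Z →
    a ≠ b → p 0 = b → (∀ i, k ≤ i → p i = a) →
    (∀ i < k, ∀ q ∈ segment ℝ (p i) (p (i + 1)), q ∈ Z → q = a ∨ q = b) →
    ∃ φ : E → E, Continuous φ ∧ φ a = φ b ∧ ∀ x ∈ Z, ∀ y ∈ Z, φ x = φ y →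
      x = y ∨ ((x = a ∨ x = b) ∧ (y = a ∨ y = b)) := by
  induction k using Nat.strong_induction_on with
  | _ k ih =>
  intro Z a b p ha hb hab hp0 hpk hseg
  rcases k with _ | _ | k
  · exact absurd (hpk 0 le_rfl).symm (by rw [hp0]; exact hab)
  · have hp1 : p 1 = a := hpk 1 le_rfl
    obtain ⟨l, hl, -, -, hl0, hli⟩ := exists_segment_collapse a b (R := ∅) isCompact_empty (by simp)
    refine ⟨fun x => a + l x • (x - a), by fun_prop, ?_, ?_⟩
    · simp [hl0 b (right_mem_segment _ _ _)]
    · intro x hx y hy hxy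
      rcases hli x y hxy with h | ⟨h1, h2⟩
      · exact Or.inl h
      · rw [segment_symm, ← hp0, ← hp1] at h1 h2
        exact Or.inr ⟨hseg 0 one_pos x h1 hx, hseg 0 one_pos y h2 hy⟩
  by_cases hcross : ∃ j, 2 ≤ j ∧ j ≤ k + 2 ∧
      ∃ q ∈ segment ℝ (p 0) (p 1), q ∈ segment ℝ (p j) (p (j + 1))
  · obtain ⟨j, hj2, hjk, q, hq1, hq2⟩ := hcross
    by_cases hj : j = k + 2
    · refine ih 1 (by omega) Z a b (fun i => if i = 0 then b else a) ha hb hab (by simp)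
        (fun i hi => by simp; omega) fun i hi r hr hrZ => ?_
      have hi0 : i = 0 := by omega
      subst hi0
      have hqa : q = a := by
        rw [hpk j (by omega), hpk (j + 1) (by omega), segment_same] at hq2
        exact hq2
      subst hqa
      simp only [if_pos, zero_add, one_ne_zero, if_false] at hr
      refine hseg 0 (by omega) r ?_ hrZ
      exact (convex_segment _ _).segment_subset (hp0 ▸ left_mem_segment _ _ _) hq1 hr
    · refine ih (k + 2 - j + 1) (by omega) Z a b
        (fun i => if i = 0 then b else if i = 1 then q else p (i + j - 1)) ha hb hab (by simp)
        (fun i hi => ?_) fun i hi r hr hrZ => ?_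
      · rw [if_neg (by omega), if_neg (by omega)]
        exact hpk _ (by omega)
      · rcases i with _ | _ | i
        · simp only [if_pos, zero_add, one_ne_zero, if_false] at hr
          refine hseg 0 (by omega) r ?_ hrZ
          exact (convex_segment _ _).segment_subset (hp0 ▸ left_mem_segment _ _ _) hq1 hr
        · simp only [zero_add, one_ne_zero, if_false, if_true, Nat.reduceAdd, OfNat.ofNat_ne_zero,
            OfNat.ofNat_ne_one, show 2 + j - 1 = j + 1 by omega] at hr
          refine hseg j (by omega) r ?_ hrZ
          exact (convex_segment _ _).segment_subset hq2 (right_mem_segment _ _ _) hr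
        · rw [if_neg (by omega), if_neg (by omega), if_neg (by omega), if_neg (by omega)] at hr
          refine hseg (i + 1 + 1 + j - 1) (by omega) r ?_ hrZ
          rwa [show i + 1 + 1 + j - 1 + 1 = i + 1 + 1 + 1 + j - 1 by omega]
  · push Not at hcross
    set R := ⋃ j ∈ Finset.Icc 2 (k + 2), segment ℝ (p j) (p (j + 1)) with hR
    have hRc : IsCompact R := by
      refine Finset.isCompact_biUnion _ fun j _ => ?_
      rw [segment_eq_image_lineMap]
      exact isCompact_Icc.image (AffineMap.lineMap_continuous)
    have hRm : ∀ j, 2 ≤ j → j ≤ k + 2 → segment ℝ (p j) (p (j + 1)) ⊆ R := fun j h2 hk =>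
      Set.subset_biUnion_of_mem (u := fun j => segment ℝ (p j) (p (j + 1)))
        (by simpa using ⟨h2, hk⟩)
    have hRd : Disjoint R (segment ℝ (p 1) (p 0)) := by
      rw [Set.disjoint_left]
      intro q hq hq'
      simp only [hR, Set.mem_iUnion, Finset.mem_Icc] at hq
      obtain ⟨j, ⟨h2, hk⟩, hqj⟩ := hq
      exact hcross j h2 hk q (by rwa [segment_symm]) hqj
    obtain ⟨l, hl, hlnn, hl1, hl0, hli⟩ := exists_segment_collapse (p 1) (p 0) hRc hRd
    set ψ : E → E := fun x => p 1 + l x • (x - p 1) with hψ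
    have hψc : Continuous ψ := by fun_prop
    have hψR : ∀ x ∈ R, ψ x = x := fun x hx => by simp [hψ, hl1 x hx]
    have haR : a ∈ R := hRm (k + 2) (by omega) le_rfl (by
      rw [hpk (k + 2) le_rfl]; exact left_mem_segment _ _ _)
    have hψb : ψ b = p 1 := by
      simp [hψ, hl0 b (hp0 ▸ right_mem_segment _ _ _)]
    have hψa : ψ a = a := hψR a haR
    have hseg0 : ∀ q ∈ segment ℝ (p 1) (p 0), q ∈ Z → q = b := by
      intro q hq hqZ
      rcases hseg 0 (by omega) q (by rwa [segment_symm] at hq) hqZ with rfl | h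
      · exact absurd hq (Set.disjoint_left.1 hRd haR)
      · exact h
    have hstep : ∀ q, ψ q ∈ ψ '' Z → ψ q ≠ p 1 → q ∈ Z := by
      rintro q ⟨z, hz, hzq⟩ hne
      rcases hli z q hzq with rfl | ⟨-, h2⟩
      · exact hz
      · exact absurd (by simp [hψ, hl0 q h2]) hne
    obtain ⟨φ, hφ, hφab, hφi⟩ := ih (k + 1) (by omega) (ψ '' Z) a (p 1) (fun i => p (i + 1))
      ⟨a, ha, hψa⟩ ⟨b, hb, hψb⟩ (by
        rintro rfl
        exact Set.disjoint_left.1 hRd haR (left_mem_segment _ _ _)) rfl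
      (fun i hi => hpk _ (by omega)) (by
        intro i hi q hq hqZ
        by_contra hne
        push Not at hne
        rcases i with _ | i
        · obtain ⟨t, ⟨ht0, ht1⟩, htq⟩ : ∃ t ∈ Set.Icc (0 : ℝ) 1, q = p 1 + t • (p 2 - p 1) := by
            rw [segment_eq_image'] at hq
            obtain ⟨t, ht, rfl⟩ := hq
            exact ⟨t, ht, rfl⟩
          have h2R : p 2 ∈ R := hRm 2 le_rfl (by omega) (left_mem_segment _ _ _)
          have hcont : ContinuousOn (fun s : ℝ => l (p 1 + s • (p 2 - p 1)) * s) (Set.Icc 0 1) :=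
            by fun_prop
          obtain ⟨s, hs, hse⟩ := intermediate_value_Icc zero_le_one hcont
            (show t ∈ _ by simpa [hl1 _ h2R] using ⟨ht0, ht1⟩)
          set q' := p 1 + s • (p 2 - p 1) with hq'
          have hψq : ψ q' = q := by
            rw [htq, ← hse]
            simp [hψ, hq', smul_smul]
          have hq'Z := hstep q' (hψq ▸ hqZ) (hψq ▸ hne.2)
          have hq's : q' ∈ segment ℝ (p 1) (p 2) := by
            rw [segment_eq_image']
            exact ⟨s, hs, rfl⟩
          rcases hseg 1 (by omega) q' hq's hq'Z with h | h
          · exact hne.1 (by rw [← hψq, h, hψa])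
          · exact hne.2 (by rw [← hψq, h, hψb])
        · have hqR := hRm (i + 2) (by omega) (by omega) hq
          have hqZ' := hstep q (by rwa [hψR q hqR]) (by rw [hψR q hqR]; exact hne.2)
          rcases hseg (i + 2) (by omega) q hq hqZ' with h | rfl
          · exact hne.1 h
          · exact Set.disjoint_left.1 hRd hqR (hp0 ▸ right_mem_segment _ _ _))
    refine ⟨φ ∘ ψ, hφ.comp hψc, by simp [hψa, hψb, hφab], fun x hx y hy hxy => ?_⟩
    have hpt : ∀ z ∈ Z, ψ z = a ∨ ψ z = p 1 → z = a ∨ z = b := by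
      intro z hz h
      rcases h with h | h
      · rcases hli z a (h.trans hψa.symm) with h | ⟨-, h2⟩
        · exact Or.inl h
        · exact absurd h2 (Set.disjoint_left.1 hRd haR)
      · rcases hli z b (h.trans hψb.symm) with h | ⟨h1, -⟩
        · exact Or.inr h
        · exact Or.inr (hseg0 z h1 hz)
    rcases hφi _ ⟨x, hx, rfl⟩ _ ⟨y, hy, rfl⟩ hxy with h | ⟨h1, h2⟩
    · rcases hli x y h with h | ⟨h1, h2⟩
      · exact Or.inl h
      · exact Or.inl ((hseg0 x h1 hx).trans (hseg0 y h2 hy).symm)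
    · exact Or.inr ⟨hpt x hx h1, hpt y hy h2⟩

end Collapse

/-- A plane embedding can be assembled from arcs given in one orientation for every edge. -/
theorem IsPlaneEmbedding.of_oriented {G : SimpleGraph V} {vtx : V → ℝ × ℝ}
    (O : V → V → Prop) [DecidableRel O] (hO : ∀ ⦃u v⦄, G.Adj u v → (O u v ↔ ¬ O v u))
    (A : V → V → ℝ → ℝ × ℝ) (hv : Function.Injective vtx)
    (hc : ∀ ⦃u v⦄, G.Adj u v → O u v → ContinuousOn (A u v) (Set.Icc 0 1))
    (hi : ∀ ⦃u v⦄, G.Adj u v → O u v → Set.InjOn (A u v) (Set.Icc 0 1))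
    (hs : ∀ ⦃u v⦄, G.Adj u v → O u v → A u v 0 = vtx u)
    (he : ∀ ⦃u v⦄, G.Adj u v → O u v → A u v 1 = vtx v)
    (ha : ∀ ⦃u v⦄, G.Adj u v → O u v → ∀ w, vtx w ∉ ArcInterior (A u v))
    (hd : ∀ ⦃u v u' v'⦄, G.Adj u v → O u v → G.Adj u' v' → O u' v' → (u ≠ u' ∨ v ≠ v') →
      ArcInterior (A u v) ∩ ArcInterior (A u' v') = ∅) :
    IsPlaneEmbedding G vtx (fun u v => if O u v then A u v else fun t => A v u (1 - t)) := by
  have hrev : ∀ {u v}, G.Adj u v → ¬ O u v → O v u := fun h hn => (hO h.symm).2 hn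
  have hmaps : ∀ t ∈ Set.Icc (0 : ℝ) 1, 1 - t ∈ Set.Icc (0 : ℝ) 1 := fun t ht =>
    ⟨by linarith [ht.2], by linarith [ht.1]⟩
  have hint : ∀ γ : ℝ → ℝ × ℝ, ArcInterior (fun t => γ (1 - t)) = ArcInterior γ := by
    intro γ
    ext q
    constructor
    · rintro ⟨t, ht, rfl⟩
      exact ⟨1 - t, ⟨by linarith [ht.2], by linarith [ht.1]⟩, rfl⟩
    · rintro ⟨t, ht, rfl⟩
      exact ⟨1 - t, ⟨by linarith [ht.2], by linarith [ht.1]⟩, by simp⟩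
  refine ⟨hv, fun u v h => ?_, fun u v h => ?_, fun u v h => ?_, fun u v h => ?_,
    fun u v h t => ?_, fun u v h => ?_, fun u v u' v' h h' hne => ?_⟩
  · split_ifs with ho
    · exact hc h ho
    · exact (hc h.symm (hrev h ho)).comp (by fun_prop) hmaps
  · split_ifs with ho
    · exact hi h ho
    · intro s hs t ht hst
      have := hi h.symm (hrev h ho) (hmaps s hs) (hmaps t ht) hst
      linarith
  · split_ifs with ho
    · exact hs h ho
    · simpa using he h.symm (hrev h ho)
  · split_ifs with ho
    · exact he h ho
    · simpa using hs h.symm (hrev h ho)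
  · by_cases ho : O u v
    · rw [if_neg ((hO h).1 ho), if_pos ho]
    · rw [if_pos (hrev h ho), if_neg ho]
      simp
  · split_ifs with ho
    · exact ha h ho
    · rw [hint]
      exact ha h.symm (hrev h ho)
  · have hne1 : ¬ (u = u' ∧ v = v') := fun e => hne (by rw [e.1, e.2])
    have hne2 : ¬ (u = v' ∧ v = u') := fun e => hne (by rw [e.1, e.2, Sym2.eq_swap])
    split_ifs with h1 h2 h2
    · exact hd h h1 h' h2 (by tauto)
    · rw [hint]
      exact hd h h1 h'.symm (hrev h' h2) (by tauto)
    · rw [hint]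
      exact hd h.symm (hrev h h1) h' h2 (by tauto)
    · rw [hint, hint]
      exact hd h.symm (hrev h h1) h'.symm (hrev h' h2) (by tauto)

/-- An orientation of all pairs in which a given vertex is a source. -/
theorem exists_orientation [Finite V] (a : V) :
    ∃ O : V → V → Prop, (∀ u v, u ≠ v → (O u v ↔ ¬ O v u)) ∧ ∀ v, v ≠ a → O a v := by
  obtain ⟨n, ⟨e⟩⟩ := Finite.exists_equiv_fin V
  refine ⟨fun u v => u = a ∨ (v ≠ a ∧ e u < e v), fun u v huv => ?_, fun v _ => Or.inl rfl⟩
  have : e u ≠ e v := fun h => huv (e.injective h)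
  by_cases hu : u = a
  · subst hu
    simp [huv.symm]
  · by_cases hv : v = a
    · simp [hu, hv]
    · simp only [hu, hv, false_or, not_lt, ne_eq, not_false_eq_true, true_and]
      exact ⟨fun h => h.le, fun h => lt_of_le_of_ne h this⟩

theorem arcImage_symm {G : SimpleGraph V} {vtx : V → ℝ × ℝ} {arc : V → V → ℝ → ℝ × ℝ}
    (h : IsPlaneEmbedding G vtx arc) {u v : V} (huv : G.Adj u v) :
    ArcImage (arc v u) = ArcImage (arc u v) := by
  ext q
  constructor
  · rintro ⟨t, ht, rfl⟩
    exact ⟨1 - t, ⟨by linarith [ht.2], by linarith [ht.1]⟩, by rw [h.arc_symm huv]⟩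
  · rintro ⟨t, ht, rfl⟩
    exact ⟨1 - t, ⟨by linarith [ht.2], by linarith [ht.1]⟩, by rw [h.arc_symm huv]; simp⟩

theorem arcInterior_symm {G : SimpleGraph V} {vtx : V → ℝ × ℝ} {arc : V → V → ℝ → ℝ × ℝ}
    (h : IsPlaneEmbedding G vtx arc) {u v : V} (huv : G.Adj u v) :
    ArcInterior (arc v u) = ArcInterior (arc u v) := by
  ext q
  constructor
  · rintro ⟨t, ht, rfl⟩
    exact ⟨1 - t, ⟨by linarith [ht.2], by linarith [ht.1]⟩, by rw [h.arc_symm huv]⟩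
  · rintro ⟨t, ht, rfl⟩
    exact ⟨1 - t, ⟨by linarith [ht.2], by linarith [ht.1]⟩, by rw [h.arc_symm huv]; simp⟩

/-- Straighten the beginning of a curve starting at the centre of a ball. -/
theorem exists_straightened {γ : ℝ → ℝ × ℝ} {r : ℝ} (hr : 0 < r)
    (hc : ContinuousOn γ (Set.Icc 0 1)) (hi : Set.InjOn γ (Set.Icc 0 1))
    (hend : r < ‖γ 1 - γ 0‖) :
    ∃ (τ : ℝ) (δ : ℝ → ℝ × ℝ), τ ∈ Set.Ioo (0 : ℝ) 1 ∧ ‖γ τ - γ 0‖ = r ∧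
      (∀ t, τ < t → t ≤ 1 → r < ‖γ t - γ 0‖) ∧
      ContinuousOn δ (Set.Icc 0 1) ∧ Set.InjOn δ (Set.Icc 0 1) ∧ δ 0 = γ 0 ∧ δ 1 = γ 1 ∧
      segment ℝ (γ 0) (γ τ) ⊆ δ '' Set.Icc 0 (1 / 2) ∧ γ '' Set.Icc τ 1 ⊆ δ '' Set.Icc 0 1 ∧
      ∀ t ∈ Set.Ioo (0 : ℝ) 1, (∃ s : ℝ, 0 < s ∧ s ≤ 1 ∧ δ t = γ 0 + s • (γ τ - γ 0)) ∨
        ∃ s, τ < s ∧ s < 1 ∧ δ t = γ s := by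
  set T := Set.Icc (0 : ℝ) 1 ∩ {t | ‖γ t - γ 0‖ ≤ r} with hT
  have hTc : IsCompact T := by
    have : IsClosed T := by
      have := (hc.sub continuousOn_const (g := fun _ => γ 0)).norm.preimage_isClosed_of_isClosed
        isClosed_Icc (isClosed_Iic (a := r))
      exact this
    exact isCompact_Icc.of_isClosed_subset this Set.inter_subset_left
  have hTn : T.Nonempty := ⟨0, ⟨le_rfl, zero_le_one⟩, by simp [hr.le]⟩
  have hτT := hTc.sSup_mem hTn
  set τ := sSup T with hτ
  have hout : ∀ t, τ < t → t ≤ 1 → r < ‖γ t - γ 0‖ := by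
    intro t h1 h2
    by_contra hle
    exact absurd (le_csSup hTc.bddAbove (show t ∈ T from ⟨⟨hτT.1.1.trans h1.le, h2⟩, not_lt.1 hle⟩))
      (not_le.2 h1)
  have hτ1 : τ < 1 := by
    refine lt_of_le_of_ne hτT.1.2 fun h => ?_
    have := hτT.2
    rw [h] at this
    exact absurd this (not_le.2 hend)
  have hτr : ‖γ τ - γ 0‖ = r := by
    refine le_antisymm hτT.2 ?_
    have hcont : ContinuousOn (fun t => ‖γ t - γ 0‖) (Set.Icc τ 1) :=
      ((hc.sub continuousOn_const).norm).mono (Set.Icc_subset_Icc hτT.1.1 le_rfl)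
    have hcl : τ ∈ closure (Set.Ioc τ 1) := by
      rw [closure_Ioc hτ1.ne]
      exact ⟨le_rfl, hτ1.le⟩
    have hcw : ContinuousWithinAt (fun t => ‖γ t - γ 0‖) (Set.Ioc τ 1) τ :=
      (hcont τ ⟨le_rfl, hτ1.le⟩).mono Set.Ioc_subset_Icc_self
    exact ContinuousWithinAt.closure_le hcl continuousWithinAt_const hcw
      (fun t ht => (hout t ht.1 ht.2).le)
  have hτ0 : 0 < τ := by
    refine lt_of_le_of_ne hτT.1.1 fun h => ?_
    rw [← h, sub_self, norm_zero] at hτr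
    exact hr.ne hτr
  have hq0 : γ τ - γ 0 ≠ 0 := fun h => by
    rw [h, norm_zero] at hτr
    exact hr.ne hτr
  let δ : ℝ → ℝ × ℝ := fun t => if t ≤ 1 / 2 then γ 0 + (2 * t) • (γ τ - γ 0)
    else γ (τ + (2 * t - 1) * (1 - τ))
  have hδ1 : ∀ t, t ≤ 1 / 2 → δ t = γ 0 + (2 * t) • (γ τ - γ 0) := fun t ht => if_pos ht
  have hδ2 : ∀ t, 1 / 2 ≤ t → δ t = γ (τ + (2 * t - 1) * (1 - τ)) := by
    intro t ht
    rcases ht.eq_or_lt with rfl | h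
    · rw [hδ1 _ le_rfl]; simp
    · exact if_neg (not_le.2 h)
  have hp : ∀ t, 1 / 2 ≤ t → t ≤ 1 → τ + (2 * t - 1) * (1 - τ) ∈ Set.Icc τ 1 := by
    intro t h1 h2
    constructor <;> nlinarith
  have hn1 : ∀ t, 0 ≤ t → t ≤ 1 / 2 → ‖δ t - γ 0‖ = 2 * t * r := by
    intro t h0 h1
    rw [hδ1 t h1, add_sub_cancel_left, norm_smul, hτr, Real.norm_of_nonneg (by linarith)]
  have hn2 : ∀ t, 1 / 2 < t → t ≤ 1 → r < ‖δ t - γ 0‖ := by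
    intro t h0 h1
    rw [hδ2 t h0.le]
    refine hout _ ?_ (hp t h0.le h1).2
    nlinarith
  refine ⟨τ, δ, ⟨hτ0, hτ1⟩, hτr, hout, ?_, ?_, by simp [hδ1 0 (by norm_num)], ?_, ?_, ?_, ?_⟩
  · have e : Set.Icc (0 : ℝ) 1 = Set.Icc 0 (1 / 2) ∪ Set.Icc (1 / 2) 1 :=
      (Set.Icc_union_Icc_eq_Icc (by norm_num) (by norm_num)).symm
    rw [e]
    refine ContinuousOn.union_of_isClosed ?_ ?_ isClosed_Icc isClosed_Icc
    · refine ContinuousOn.congr (f := fun t => γ 0 + (2 * t) • (γ τ - γ 0)) (by fun_prop) ?_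
      intro t ht
      exact hδ1 t ht.2
    · refine ContinuousOn.congr (f := fun t => γ (τ + (2 * t - 1) * (1 - τ))) ?_ ?_
      · refine hc.comp (by fun_prop) fun t ht => ?_
        exact ⟨hτ0.le.trans (hp t ht.1 ht.2).1, (hp t ht.1 ht.2).2⟩
      · intro t ht
        exact hδ2 t ht.1
  · intro s hs t ht hst
    have key : ∀ s t, 0 ≤ s → s ≤ 1 / 2 → 1 / 2 < t → t ≤ 1 → δ s ≠ δ t := by
      intro s t h1 h2 h3 h4 h
      have h5 := hn1 s h1 h2
      rw [h] at h5
      have h6 := hn2 t h3 h4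
      nlinarith
    rcases le_or_gt s (1 / 2) with h1 | h1 <;> rcases le_or_gt t (1 / 2) with h2 | h2
    · have h3 := hn1 s hs.1 h1
      rw [hst, hn1 t ht.1 h2] at h3
      have := mul_right_cancel₀ hr.ne' h3
      linarith
    · exact absurd hst (key s t hs.1 h1 h2 ht.2)
    · exact absurd hst.symm (key t s ht.1 h2 h1 hs.2)
    · rw [hδ2 s h1.le, hδ2 t h2.le] at hst
      have hs' := hp s h1.le hs.2
      have ht' := hp t h2.le ht.2
      have := hi ⟨hτ0.le.trans hs'.1, hs'.2⟩ ⟨hτ0.le.trans ht'.1, ht'.2⟩ hst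
      have h3 := mul_right_cancel₀ (sub_pos.2 hτ1).ne' (add_left_cancel this)
      linarith
  · rw [hδ2 1 (by norm_num)]
    congr 1
    ring
  · rw [segment_eq_image']
    rintro _ ⟨t, ht, rfl⟩
    refine ⟨t / 2, ⟨by linarith [ht.1], by linarith [ht.2]⟩, ?_⟩
    rw [hδ1 _ (by linarith [ht.2])]
    congr 2
    ring
  · rintro _ ⟨t, ht, rfl⟩
    have h1τ : 0 < 1 - τ := sub_pos.2 hτ1
    have hfrac : 0 ≤ (t - τ) / (1 - τ) := div_nonneg (sub_nonneg.2 ht.1) h1τ.le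
    have hfrac' : (t - τ) / (1 - τ) ≤ 1 := (div_le_one h1τ).2 (by linarith [ht.2])
    refine ⟨((t - τ) / (1 - τ) + 1) / 2, ⟨by linarith, by linarith⟩, ?_⟩
    rw [hδ2 _ (by linarith)]
    congr 1
    field_simp
    ring
  · intro t ht
    rcases le_or_gt t (1 / 2) with h | h
    · exact Or.inl ⟨2 * t, by linarith [ht.1], by linarith, hδ1 t h⟩
    · refine Or.inr ⟨_, ?_, ?_, hδ2 t h.le⟩ <;> nlinarith [ht.2]

/-- A plane embedding can be modified so that all edges leave a given vertex `a` along a segment,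
without changing the final half of a given edge at `a`. -/
theorem exists_straight_at [Finite V] {G : SimpleGraph V} {vtx : V → ℝ × ℝ}
    {arc : V → V → ℝ → ℝ × ℝ} (h : IsPlaneEmbedding G vtx arc) {a b : V} (hab : G.Adj a b) :
    ∃ arc', IsPlaneEmbedding G vtx arc' ∧
      arc a b '' Set.Icc (1 / 2) 1 ⊆ ArcImage (arc' a b) ∧
      ∃ q ∈ ArcInterior (arc' a b), segment ℝ (vtx a) q ⊆ arc' a b '' Set.Icc 0 (1 / 2) := by
  set K := arc a b '' Set.Icc (1 / 2) 1 with hKdef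
  have hsub : Set.Icc (1 / 2 : ℝ) 1 ⊆ Set.Icc 0 1 := Set.Icc_subset_Icc (by norm_num) le_rfl
  have hK : IsCompact K := isCompact_Icc.image_of_continuousOn ((h.arc_cont hab).mono hsub)
  have haK : vtx a ∉ K := by
    rintro ⟨t, ht, hta⟩
    rw [← h.arc_start hab] at hta
    have := h.arc_injOn hab (hsub ht) ⟨le_rfl, zero_le_one⟩ hta
    linarith [ht.1]
  classical
  obtain ⟨O, hO, hOa⟩ := exists_orientation a
  set Z := vtx '' {w | w ≠ a} ∪ (⋃ (u : V) (v : V) (_ : G.Adj u v ∧ u ≠ a ∧ v ≠ a),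
    ArcImage (arc u v)) ∪ K with hZ
  have hZc : IsClosed Z := by
    refine (IsClosed.union (Set.toFinite _).isClosed ?_).union hK.isClosed
    refine isClosed_iUnion_of_finite fun u => isClosed_iUnion_of_finite fun v =>
      isClosed_iUnion_of_finite fun huv => (isCompact_arcImage h huv.1).isClosed
  have haZ : vtx a ∉ Z := by
    rintro ((⟨w, hw, hwa⟩ | hm) | hm)
    · exact hw (h.vtx_inj hwa)
    · simp only [Set.mem_iUnion] at hm
      obtain ⟨u, v, ⟨huv, hu, hv⟩, hm⟩ := hm
      rcases arcImage_eq h huv hm with e | e | e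
      · exact hu (h.vtx_inj e).symm
      · exact hv (h.vtx_inj e).symm
      · exact h.arc_avoids_vtx huv _ e
    · exact haK hm
  obtain ⟨r, hr, hball⟩ : ∃ r, 0 < r ∧ ∀ q, ‖q - vtx a‖ ≤ r → q ∉ Z := by
    obtain ⟨ε, hε, hb⟩ := Metric.isOpen_iff.1 hZc.isOpen_compl _ haZ
    refine ⟨ε / 2, half_pos hε, fun q hq => hb ?_⟩
    rw [Metric.mem_ball, dist_eq_norm]
    linarith
  have hend : ∀ v, G.Adj a v → r < ‖arc a v 1 - arc a v 0‖ := by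
    intro v hv
    by_contra hle
    rw [h.arc_end hv, h.arc_start hv] at hle
    exact hball _ (not_lt.1 hle) (Or.inl (Or.inl ⟨v, hv.ne', rfl⟩))
  have hstr := fun v (hv : G.Adj a v) =>
    exists_straightened hr (h.arc_cont hv) (h.arc_injOn hv) (hend v hv)
  choose! τ δ hτ hτr hout hδc hδi hδ0 hδ1 hδs hδr hδ using hstr
  have hst0 : ∀ v, G.Adj a v → arc a v 0 = vtx a := fun v hv => h.arc_start hv
  have hdich : ∀ v, G.Adj a v → ∀ t ∈ Set.Ioo (0 : ℝ) 1,
      (∃ s : ℝ, 0 < s ∧ s ≤ 1 ∧ δ v t = vtx a + s • (arc a v (τ v) - vtx a) ∧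
        ‖δ v t - vtx a‖ = s * r) ∨
      (δ v t ∈ ArcInterior (arc a v) ∧ r < ‖δ v t - vtx a‖) := by
    intro v hv t ht
    rcases hδ v hv t ht with ⟨s, h0, h1, he⟩ | ⟨s, h0, h1, he⟩
    · rw [hst0 v hv] at he
      refine Or.inl ⟨s, h0, h1, he, ?_⟩
      rw [he, add_sub_cancel_left, norm_smul, Real.norm_of_nonneg h0.le, ← hst0 v hv, hτr v hv]
    · refine Or.inr ⟨⟨s, ⟨(hτ v hv).1.trans h0, h1⟩, he.symm⟩, ?_⟩
      rw [he, ← hst0 v hv]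
      exact hout v hv s h0 h1.le
  let A : V → V → ℝ → ℝ × ℝ := fun u v => if u = a then δ v else arc u v
  have hA1 : ∀ v, A a v = δ v := fun v => if_pos rfl
  have hA2 : ∀ u v, u ≠ a → A u v = arc u v := fun u v hu => if_neg hu
  have hva : ∀ {u v}, G.Adj u v → O u v → v ≠ a := by
    rintro u v huv ho rfl
    exact (hO u v huv.ne).1 ho (hOa u huv.ne)
  have hdisj1 : ∀ v u' v', G.Adj a v → G.Adj u' v' → u' ≠ a → v' ≠ a →
      ArcInterior (δ v) ∩ ArcInterior (arc u' v') = ∅ := by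
    intro v u' v' hv huv' hu' hv'
    ext q
    refine ⟨?_, fun hq => hq.elim⟩
    rintro ⟨⟨t, ht, rfl⟩, hq⟩
    rcases hdich v hv t ht with ⟨s, h0, h1, -, hn⟩ | ⟨hin, -⟩
    · refine hball (δ v t) (by rw [hn]; nlinarith) (Or.inl (Or.inr ?_))
      simp only [Set.mem_iUnion]
      exact ⟨u', v', ⟨huv', hu', hv'⟩, arcInterior_subset _ hq⟩
    · refine arcInterior_disjoint_arcImage h hv huv' ?_ hin (arcInterior_subset _ hq)
      intro e
      have : a ∈ s(u', v') := e ▸ Sym2.mem_mk_left _ _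
      rcases Sym2.mem_iff.1 this with rfl | rfl
      exacts [hu' rfl, hv' rfl]
  have hdisj2 : ∀ v v', G.Adj a v → G.Adj a v' → v ≠ v' →
      ArcInterior (δ v) ∩ ArcInterior (δ v') = ∅ := by
    intro v v' hv hv' hne
    have hs : s(a, v) ≠ s(a, v') := by
      intro e
      rw [Sym2.eq_iff] at e
      rcases e with ⟨-, e⟩ | ⟨e, e'⟩
      · exact hne e
      · exact hv'.ne e
    ext q
    refine ⟨?_, fun hq => hq.elim⟩
    rintro ⟨⟨t, ht, rfl⟩, ⟨t', ht', he⟩⟩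
    rcases hdich v hv t ht with ⟨s, h0, h1, hse, hn⟩ | ⟨hin, hn⟩ <;>
      rcases hdich v' hv' t' ht' with ⟨s', h0', h1', hse', hn'⟩ | ⟨hin', hn'⟩
    · rw [he, hn] at hn'
      have hss : s = s' := mul_right_cancel₀ hr.ne' hn'
      rw [he, hse, hss] at hse'
      have hz := smul_right_injective (ℝ × ℝ) h0'.ne' (add_left_cancel hse')
      have hz' : arc a v (τ v) = arc a v' (τ v') := sub_left_injective hz
      have : arc a v (τ v) ∈ ArcInterior (arc a v) ∩ ArcInterior (arc a v') :=
        ⟨⟨_, hτ v hv, rfl⟩, ⟨_, hτ v' hv', hz'.symm⟩⟩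
      rw [h.arc_disjoint hv hv' hs] at this
      exact this
    · rw [he, hn] at hn'
      nlinarith
    · rw [← he, hn'] at hn
      nlinarith
    · rw [he] at hin'
      have : δ v t ∈ ArcInterior (arc a v) ∩ ArcInterior (arc a v') := ⟨hin, hin'⟩
      rw [h.arc_disjoint hv hv' hs] at this
      exact this
  have hemb := IsPlaneEmbedding.of_oriented (G := G) (vtx := vtx) O
    (fun u v huv => hO u v huv.ne) A h.vtx_inj
    (fun u v huv ho => by
      by_cases hu : u = a
      · subst hu; rw [hA1]; exact hδc v huv
      · rw [hA2 u v hu]; exact h.arc_cont huv)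
    (fun u v huv ho => by
      by_cases hu : u = a
      · subst hu; rw [hA1]; exact hδi v huv
      · rw [hA2 u v hu]; exact h.arc_injOn huv)
    (fun u v huv ho => by
      by_cases hu : u = a
      · subst hu; rw [hA1, hδ0 v huv]; exact h.arc_start huv
      · rw [hA2 u v hu]; exact h.arc_start huv)
    (fun u v huv ho => by
      by_cases hu : u = a
      · subst hu; rw [hA1, hδ1 v huv]; exact h.arc_end huv
      · rw [hA2 u v hu]; exact h.arc_end huv)
    (fun u v huv ho w => by
      by_cases hu : u = a
      · subst hu
        rw [hA1]
        rintro ⟨t, ht, hw⟩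
        rcases hdich v huv t ht with ⟨s, h0, h1, -, hn⟩ | ⟨hin, -⟩
        · by_cases hwu : w = u
          · subst hwu
            rw [hw, sub_self, norm_zero] at hn
            nlinarith
          · exact hball (δ v t) (by rw [hn]; nlinarith) (Or.inl (Or.inl ⟨w, hwu, hw.symm⟩))
        · exact h.arc_avoids_vtx huv w (hw ▸ hin)
      · rw [hA2 u v hu]; exact h.arc_avoids_vtx huv w)
    (fun u v u' v' huv ho huv' ho' hne => by
      by_cases hu : u = a <;> by_cases hu' : u' = a
      · subst hu; subst hu'
        rw [hA1, hA1]
        exact hdisj2 v v' huv huv' (by tauto)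
      · subst hu
        rw [hA1, hA2 _ _ hu']
        exact hdisj1 v u' v' huv huv' hu' (hva huv' ho')
      · subst hu'
        rw [hA1, hA2 _ _ hu, Set.inter_comm]
        exact hdisj1 v' u v huv' huv hu (hva huv ho)
      · rw [hA2 _ _ hu, hA2 _ _ hu']
        refine h.arc_disjoint huv huv' fun e => ?_
        rw [Sym2.eq_iff] at e
        rcases e with ⟨rfl, rfl⟩ | ⟨rfl, rfl⟩
        · simp at hne
        · exact (hO _ _ huv.ne).1 ho ho')
  refine ⟨_, hemb, ?_⟩
  rw [if_pos (hOa b hab.ne'), hA1]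
  refine ⟨fun q hq => ?_, arc a b (τ b), ?_, ?_⟩
  · obtain ⟨t, ht, rfl⟩ := hq
    refine hδr b hab ⟨t, ⟨?_, ht.2⟩, rfl⟩
    by_contra hlt
    push Not at hlt
    refine hball (arc a b (τ b)) ?_ (Or.inr ⟨τ b, ⟨ht.1.trans hlt.le, (hτ b hab).2.le⟩, rfl⟩)
    rw [← hst0 b hab, hτr b hab]
  · obtain ⟨t, ht, hte⟩ := hδs b hab (right_mem_segment _ _ _)
    have hq : arc a b (τ b) ∈ ArcInterior (arc a b) := ⟨_, hτ b hab, rfl⟩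
    refine ⟨t, ⟨lt_of_le_of_ne ht.1 ?_, by linarith [ht.2]⟩, hte⟩
    rintro rfl
    rw [hδ0 b hab, hst0 b hab] at hte
    exact h.arc_avoids_vtx hab a (hte ▸ hq)
  · rw [← hst0 b hab]
    exact hδs b hab

/-- Two points of a preconnected subset of an open set are joined by a polygonal chain. -/
theorem exists_chain_of_isPreconnected {E : Type*} [NormedAddCommGroup E] [NormedSpace ℝ E]
    {U S : Set E} (hU : IsOpen U) (hS : IsPreconnected S) (hSU : S ⊆ U) {x y : E} (hx : x ∈ S)
    (hy : y ∈ S) : Relation.ReflTransGen (fun p q => segment ℝ p q ⊆ U) x y := by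
  refine hS.induction₂ (Relation.ReflTransGen fun p q => segment ℝ p q ⊆ U) (fun z hz => ?_)
    (fun _ _ _ _ _ _ h h' => h.trans h') (fun p q _ _ h => ?_) hx hy
  · obtain ⟨ε, hε, hb⟩ := Metric.isOpen_iff.1 hU z (hSU hz)
    refine Filter.Eventually.filter_mono nhdsWithin_le_nhds ?_
    filter_upwards [Metric.ball_mem_nhds z hε] with w hw
    exact .single (((convex_ball z ε).segment_subset (Metric.mem_ball_self hε) hw).trans hb)
  · have : Std.Symm (fun p q : E => segment ℝ p q ⊆ U) := ⟨fun p q h => by rwa [segment_symm]⟩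
    exact Std.Symm.symm _ _ h

theorem exists_seq_of_reflTransGen {α : Type*} {r : α → α → Prop} {x y : α}
    (h : Relation.ReflTransGen r x y) :
    ∃ (k : ℕ) (p : ℕ → α), p 0 = x ∧ (∀ i, k ≤ i → p i = y) ∧ ∀ i < k, r (p i) (p (i + 1)) := by
  induction h using Relation.ReflTransGen.head_induction_on with
  | refl => exact ⟨0, fun _ => y, rfl, fun _ _ => rfl, fun i hi => absurd hi i.not_lt_zero⟩
  | @head a c hac _ ih =>
    obtain ⟨k, p, h0, hk, hp⟩ := ih
    refine ⟨k + 1, fun i => i.casesOn a p, rfl, fun i hi => ?_, fun i hi => ?_⟩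
    · cases i with
      | zero => omega
      | succ i => exact hk i (by omega)
    · cases i with
      | zero => simpa [h0] using hac
      | succ i => exact hp i (by omega)

/-- The drawing of all edges except `ab`. -/
def drawingExcept (G : SimpleGraph V) (vtx : V → ℝ × ℝ) (arc : V → V → ℝ → ℝ × ℝ) (a b : V) :
    Set (ℝ × ℝ) :=
  Set.range vtx ∪ ⋃ (u : V) (v : V) (_ : G.Adj u v ∧ s(u, v) ≠ s(a, b)), ArcImage (arc u v)

theorem mem_drawingExcept {G : SimpleGraph V} {vtx : V → ℝ × ℝ} {arc : V → V → ℝ → ℝ × ℝ}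
    {a b u v : V} (huv : G.Adj u v) (hne : s(u, v) ≠ s(a, b)) {q : ℝ × ℝ}
    (hq : q ∈ ArcImage (arc u v)) : q ∈ drawingExcept G vtx arc a b := by
  refine Or.inr ?_
  simp only [Set.mem_iUnion]
  exact ⟨u, v, ⟨huv, hne⟩, hq⟩

theorem isCompact_drawingExcept [Finite V] {G : SimpleGraph V} {vtx : V → ℝ × ℝ}
    {arc : V → V → ℝ → ℝ × ℝ} (h : IsPlaneEmbedding G vtx arc) (a b : V) :
    IsCompact (drawingExcept G vtx arc a b) := by
  refine (Set.finite_range vtx).isCompact.union ?_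
  refine isCompact_iUnion fun u => isCompact_iUnion fun v =>
    isCompact_iUnion fun huv => isCompact_arcImage h huv.1

/-- After modifying the drawing, an edge can be collapsed by a continuous map which is otherwise
injective on the drawing of the remaining edges. -/
theorem exists_edge_collapse [Finite V] {G : SimpleGraph V} {vtx : V → ℝ × ℝ}
    {arc : V → V → ℝ → ℝ × ℝ} (h : IsPlaneEmbedding G vtx arc) {a b : V} (hab : G.Adj a b) :
    ∃ arc', IsPlaneEmbedding G vtx arc' ∧ ∃ φ : ℝ × ℝ → ℝ × ℝ, Continuous φ ∧
      φ (vtx a) = φ (vtx b) ∧ ∀ x ∈ drawingExcept G vtx arc' a b,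
        ∀ y ∈ drawingExcept G vtx arc' a b, φ x = φ y →
          x = y ∨ ((x = vtx a ∨ x = vtx b) ∧ (y = vtx a ∨ y = vtx b)) := by
  obtain ⟨arc₁, h₁, -, q₁, hq₁, hs₁⟩ := exists_straight_at h hab
  obtain ⟨arc₂, h₂, hk, q₂, hq₂, hs₂⟩ := exists_straight_at h₁ hab.symm
  have hs₁' : segment ℝ (vtx a) q₁ ⊆ ArcImage (arc₂ a b) := by
    rw [arcImage_symm h₂ hab.symm]
    refine hs₁.trans (Set.Subset.trans ?_ hk)
    rintro _ ⟨t, ht, rfl⟩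
    exact ⟨1 - t, ⟨by linarith [ht.2], by linarith [ht.1]⟩, by rw [h₁.arc_symm hab]; simp⟩
  have hs₂' : segment ℝ (vtx b) q₂ ⊆ ArcImage (arc₂ a b) := by
    rw [arcImage_symm h₂ hab.symm]
    exact hs₂.trans (Set.image_mono (Set.Icc_subset_Icc le_rfl (by norm_num)))
  have hq₁' : q₁ ∈ ArcInterior (arc₂ a b) := by
    rcases arcImage_eq h₂ hab (hs₁' (right_mem_segment _ _ _)) with e | e | e
    · exact absurd (e ▸ hq₁) (h₁.arc_avoids_vtx hab a)
    · exact absurd (e ▸ hq₁) (h₁.arc_avoids_vtx hab b)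
    · exact e
  have hq₂' : q₂ ∈ ArcInterior (arc₂ a b) := by
    rwa [arcInterior_symm h₂ hab.symm]
  set Z := drawingExcept G vtx arc₂ a b with hZ
  have hZc : IsClosed Z := (isCompact_drawingExcept h₂ a b).isClosed
  have hint : ArcInterior (arc₂ a b) ⊆ Zᶜ := by
    rintro q hq (⟨w, rfl⟩ | hm)
    · exact h₂.arc_avoids_vtx hab w hq
    · simp only [Set.mem_iUnion] at hm
      obtain ⟨u, v, ⟨huv, hne⟩, hm⟩ := hm
      exact arcInterior_disjoint_arcImage h₂ hab huv hne.symm hq hm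
  have harc : ∀ q ∈ ArcImage (arc₂ a b), q ∈ Z → q = vtx a ∨ q = vtx b := by
    intro q hq hqZ
    rcases arcImage_eq h₂ hab hq with e | e | e
    · exact Or.inl e
    · exact Or.inr e
    · exact absurd hqZ (hint e)
  have hpre : IsPreconnected (ArcInterior (arc₂ a b)) :=
    isPreconnected_Ioo.image _ ((h₂.arc_cont hab).mono Set.Ioo_subset_Icc_self)
  have hchain := exists_chain_of_isPreconnected hZc.isOpen_compl hpre hint hq₂' hq₁'
  have hle : (fun p q => segment ℝ p q ⊆ Zᶜ) ≤
      fun p q => ∀ z ∈ segment ℝ p q, z ∈ Z → z = vtx a ∨ z = vtx b := by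
    intro p q hpq z hz hzZ
    exact absurd hzZ (hpq hz)
  have hchain' : Relation.ReflTransGen
      (fun p q => ∀ z ∈ segment ℝ p q, z ∈ Z → z = vtx a ∨ z = vtx b) (vtx b) (vtx a) := by
    refine .head (b := q₂) (fun z hz => harc z (hs₂' hz)) (.tail (b := q₁)
      (Relation.ReflTransGen.mono hle _ _ hchain) fun z hz => harc z ?_)
    rw [segment_symm] at hz
    exact hs₁' hz
  obtain ⟨k, p, hp0, hpk, hp⟩ := exists_seq_of_reflTransGen hchain'
  exact ⟨arc₂, h₂, exists_collapse_of_chain k Z (vtx a) (vtx b) p (Or.inl ⟨a, rfl⟩)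
    (Or.inl ⟨b, rfl⟩) (h₂.vtx_inj.ne hab.ne) hp0 hpk hp⟩

/-- Contracting an edge (keeping the removed vertex as an isolated one) preserves planarity. -/
theorem IsPlanarGraph.contract [Finite V] [DecidableEq V] {G : SimpleGraph V}
    (h : IsPlanarGraph G) {a b : V} (hab : G.Adj a b) :
    IsPlanarGraph (G.map (Function.update id b a)) := by
  classical
  obtain ⟨vtx, arc₀, h₀⟩ := h
  obtain ⟨arc, h, φ, hφ, hφab, hφi⟩ := exists_edge_collapse h₀ hab
  set g := Function.update id b a with hg
  have hgb : g b = a := Function.update_self ..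
  have hgn : ∀ v, v ≠ b → g v = v := fun v hv => Function.update_of_ne hv ..
  have hgnb : ∀ v, g v ≠ b := by
    intro v
    by_cases hv : v = b
    · rw [hv, hgb]; exact hab.ne
    · rwa [hgn v hv]
  have hga : ∀ v, g v ≠ a → g v = v ∧ v ≠ a ∧ v ≠ b := by
    intro v hv
    have hvb : v ≠ b := by rintro rfl; exact hv hgb
    have := hgn v hvb
    exact ⟨this, by rwa [this] at hv, hvb⟩
  obtain ⟨O, hO, hOa⟩ := exists_orientation a
  have hva : ∀ {u v}, u ≠ v → O u v → v ≠ a := by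
    rintro u v huv ho rfl
    exact (hO u v huv).1 ho (hOa u huv)
  have hrep : ∀ u v, (G.map g).Adj u v → O u v → ∃ u', G.Adj u' v ∧ g u' = u ∧ v ≠ a ∧ v ≠ b := by
    rintro u v ⟨hne, u', v', huv, rfl, rfl⟩ ho
    obtain ⟨h1, h2, h3⟩ := hga v' (hva hne ho)
    rw [h1] at hne ho ⊢
    exact ⟨u', huv, rfl, h2, h3⟩
  choose! ρ hρ hρg hρa hρb using hrep
  have hρe : ∀ u v, (G.map g).Adj u v → O u v → s(ρ u v, v) ≠ s(a, b) := by
    intro u v huv ho e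
    have : v ∈ s(a, b) := e ▸ Sym2.mem_mk_right _ _
    rcases Sym2.mem_iff.1 this with e | e
    exacts [hρa u v huv ho e, hρb u v huv ho e]
  have hmem : ∀ u v, (G.map g).Adj u v → O u v → ∀ q ∈ ArcImage (arc (ρ u v) v),
      q ∈ drawingExcept G vtx arc a b := fun u v huv ho q hq =>
    mem_drawingExcept (hρ u v huv ho) (hρe u v huv ho) hq
  have hmeet : ∀ u v, (G.map g).Adj u v → O u v → ∀ q ∈ ArcImage (arc (ρ u v) v),
      q = vtx a ∨ q = vtx b → q = vtx (ρ u v) := by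
    intro u v huv ho q hq hqab
    rcases arcImage_eq h (hρ u v huv ho) hq with e | e | e
    · exact e
    · rcases hqab with e' | e'
      · exact absurd (h.vtx_inj (e.symm.trans e')) (hρa u v huv ho)
      · exact absurd (h.vtx_inj (e.symm.trans e')) (hρb u v huv ho)
    · rcases hqab with rfl | rfl
      exacts [absurd e (h.arc_avoids_vtx (hρ u v huv ho) _),
        absurd e (h.arc_avoids_vtx (hρ u v huv ho) _)]
  have hmeet' : ∀ u v, (G.map g).Adj u v → O u v → ∀ q ∈ ArcInterior (arc (ρ u v) v),
      ¬ (q = vtx a ∨ q = vtx b) := by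
    rintro u v huv ho q hq (rfl | rfl)
    exacts [h.arc_avoids_vtx (hρ u v huv ho) _ hq, h.arc_avoids_vtx (hρ u v huv ho) _ hq]
  have hZc := (isCompact_drawingExcept h a b).image hφ
  obtain ⟨p₀, hp₀⟩ : ∃ p₀, p₀ ∉ φ '' drawingExcept G vtx arc a b := by
    by_contra! hall
    exact hZc.ne_univ (Set.eq_univ_of_forall hall)
  have hvZ : ∀ w, vtx w ∈ drawingExcept G vtx arc a b := fun w => Or.inl ⟨w, rfl⟩
  let vtx' : V → ℝ × ℝ := fun w => if w = b then p₀ else φ (vtx w)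
  have hvb : vtx' b = p₀ := if_pos rfl
  have hvn : ∀ w, w ≠ b → vtx' w = φ (vtx w) := fun w hw => if_neg hw
  have hvg : ∀ w, vtx' (g w) = φ (vtx w) := by
    intro w
    by_cases hw : w = b
    · rw [hw, hgb, hvn a hab.ne, hφab]
    · rw [hgn w hw, hvn w hw]
  refine ⟨vtx', _, IsPlaneEmbedding.of_oriented O (fun u v huv => hO u v huv.ne)
    (fun u v t => φ (arc (ρ u v) v t)) ?_ ?_ ?_ ?_ ?_ ?_ ?_⟩
  · intro w w' hww
    by_cases hw : w = b <;> by_cases hw' : w' = b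
    · rw [hw, hw']
    · rw [hw, hvb, hvn w' hw'] at hww
      exact absurd ⟨_, hvZ w', hww.symm⟩ hp₀
    · rw [hw', hvb, hvn w hw] at hww
      exact absurd ⟨_, hvZ w, hww⟩ hp₀
    · rw [hvn w hw, hvn w' hw'] at hww
      rcases hφi _ (hvZ w) _ (hvZ w') hww with e | ⟨e | e, e' | e'⟩
      · exact h.vtx_inj e
      · rw [h.vtx_inj e, h.vtx_inj e']
      · exact absurd (h.vtx_inj e') hw'
      · exact absurd (h.vtx_inj e) hw
      · exact absurd (h.vtx_inj e) hw
  · exact fun u v huv ho => hφ.comp_continuousOn (h.arc_cont (hρ u v huv ho))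
  · intro u v huv ho s hs t ht hst
    have hs' : arc (ρ u v) v s ∈ ArcImage (arc (ρ u v) v) := ⟨s, hs, rfl⟩
    have ht' : arc (ρ u v) v t ∈ ArcImage (arc (ρ u v) v) := ⟨t, ht, rfl⟩
    refine h.arc_injOn (hρ u v huv ho) hs ht ?_
    rcases hφi _ (hmem u v huv ho _ hs') _ (hmem u v huv ho _ ht') hst with e | ⟨e, e'⟩
    · exact e
    · rw [hmeet u v huv ho _ hs' e, hmeet u v huv ho _ ht' e']
  · intro u v huv ho
    rw [h.arc_start (hρ u v huv ho), ← hvg, hρg u v huv ho]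
  · intro u v huv ho
    rw [h.arc_end (hρ u v huv ho), hvn v (hρb u v huv ho)]
  · rintro u v huv ho w ⟨t, ht, hw⟩
    have ht' : arc (ρ u v) v t ∈ ArcInterior (arc (ρ u v) v) := ⟨t, ht, rfl⟩
    have htm := hmem u v huv ho _ (arcInterior_subset _ ht')
    by_cases hwb : w = b
    · rw [hwb, hvb] at hw
      exact hp₀ ⟨_, htm, hw⟩
    · rw [hvn w hwb] at hw
      rcases hφi _ htm _ (hvZ w) hw with e | ⟨e, -⟩
      · exact h.arc_avoids_vtx (hρ u v huv ho) w (e ▸ ht')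
      · exact hmeet' u v huv ho _ ht' e
  · intro u v u' v' huv ho huv' ho' hne
    ext q
    refine ⟨?_, fun hq => hq.elim⟩
    rintro ⟨⟨t, ht, rfl⟩, ⟨t', ht', he⟩⟩
    have h1 : arc (ρ u v) v t ∈ ArcInterior (arc (ρ u v) v) := ⟨t, ht, rfl⟩
    have h2 : arc (ρ u' v') v' t' ∈ ArcInterior (arc (ρ u' v') v') := ⟨t', ht', rfl⟩
    rcases hφi _ (hmem u' v' huv' ho' _ (arcInterior_subset _ h2)) _
      (hmem u v huv ho _ (arcInterior_subset _ h1)) he with e | ⟨e, -⟩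
    · have hs : s(ρ u v, v) ≠ s(ρ u' v', v') := by
        intro hs
        rw [Sym2.eq_iff] at hs
        rcases hs with ⟨e1, rfl⟩ | ⟨e1, e2⟩
        · have := hρg u v huv ho
          rw [e1, hρg u' v huv' ho'] at this
          rcases hne with hne | hne
          exacts [hne this.symm, hne rfl]
        · have e3 := hρg u v huv ho
          have e4 := hρg u' v' huv' ho'
          rw [e1, hgn v' (hρb u' v' huv' ho')] at e3
          rw [← e2, hgn v (hρb u v huv ho)] at e4
          rw [e3, ← e4] at ho'
          exact (hO u v huv.ne).1 ho ho'
      have := h.arc_disjoint (hρ u v huv ho) (hρ u' v' huv' ho') hs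
      exact (Set.ext_iff.1 this (arc (ρ u v) v t)).1 ⟨h1, e ▸ h2⟩
    · exact hmeet' u' v' huv' ho' _ h2 e

theorem IsPlanarGraph.mono {G H : SimpleGraph V} (h : IsPlanarGraph G) (hle : H ≤ G) :
    IsPlanarGraph H := by
  obtain ⟨vtx, arc, h⟩ := h
  exact ⟨vtx, arc, h.vtx_inj, fun _ _ e => h.arc_cont (hle e), fun _ _ e => h.arc_injOn (hle e),
    fun _ _ e => h.arc_start (hle e), fun _ _ e => h.arc_end (hle e),
    fun _ _ e => h.arc_symm (hle e), fun _ _ e => h.arc_avoids_vtx (hle e),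
    fun _ _ _ _ e e' => h.arc_disjoint (hle e) (hle e')⟩

theorem IsPlanarGraph.of_equiv {W : Type} {G : SimpleGraph V} {H : SimpleGraph W} (e : W ≃ V)
    (he : ∀ u v, H.Adj u v → G.Adj (e u) (e v)) (h : IsPlanarGraph G) : IsPlanarGraph H := by
  obtain ⟨vtx, arc, h⟩ := h
  refine ⟨fun w => vtx (e w), fun u v => arc (e u) (e v), h.vtx_inj.comp e.injective,
    fun _ _ a => h.arc_cont (he _ _ a), fun _ _ a => h.arc_injOn (he _ _ a),
    fun _ _ a => h.arc_start (he _ _ a), fun _ _ a => h.arc_end (he _ _ a),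
    fun _ _ a => h.arc_symm (he _ _ a), fun _ _ a w => h.arc_avoids_vtx (he _ _ a) _,
    fun u v u' v' a a' hne => h.arc_disjoint (he _ _ a) (he _ _ a') fun hs => hne ?_⟩
  exact Sym2.map.injective e.injective hs

/-- Any two distinct cycles of length at most `5` are not joined by a walk of length less
than `3`. -/
def ShortApart (H : SimpleGraph V) : Prop :=
  ∀ ⦃u v : V⦄ (c₁ : H.Walk u u) (c₂ : H.Walk v v), c₁.IsCycle → c₂.IsCycle →
    c₁.length ≤ 5 → c₂.length ≤ 5 →
    {e : Sym2 V | e ∈ c₁.edges} ≠ {e : Sym2 V | e ∈ c₂.edges} →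
    ∀ x ∈ c₁.support, ∀ y ∈ c₂.support, ∀ p : H.Walk x y, 3 ≤ p.length

theorem Cycles5Apart.shortApart {H : SimpleGraph V} (h : Cycles5Apart H) : ShortApart H :=
  fun _ _ c₁ c₂ h₁ h₂ l₁ l₂ hne x hx y hy p =>
    (h c₁ c₂ h₁ h₂ l₁ l₂ hne x hx y hy).trans (SimpleGraph.dist_le p)

theorem ShortApart.mono {G H : SimpleGraph V} (h : ShortApart G) (hle : H ≤ G) :
    ShortApart H := by
  intro u v c₁ c₂ h₁ h₂ l₁ l₂ hne x hx y hy p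
  have := h (c₁.mapLe hle) (c₂.mapLe hle) (h₁.mapLe hle) (h₂.mapLe hle) (by simpa) (by simpa)
    (by simpa using hne) x (by simpa) y (by simpa) (p.mapLe hle)
  simpa using this

theorem exists_cycle_of_walk {H : SimpleGraph V} {u v : V} (huv : H.Adj u v) (p : H.Walk u v)
    (hp : s(u, v) ∉ p.edges) :
    ∃ c : H.Walk u u, c.IsCycle ∧ c.length ≤ p.length + 1 ∧ s(u, v) ∈ c.edges ∧
      ∀ e ∈ c.edges, e = s(u, v) ∨ e ∈ p.edges := by
  classical
  have hsub : ∀ e ∈ p.bypass.reverse.edges, e ∈ p.edges := fun e he => by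
    rw [Walk.edges_reverse, List.mem_reverse] at he
    exact p.edges_bypass_subset_edges he
  refine ⟨.cons huv p.bypass.reverse, ?_, ?_, by simp, fun e he => ?_⟩
  · rw [Walk.cons_isCycle_iff]
    exact ⟨p.bypass_isPath.reverse, fun h => hp (hsub _ h)⟩
  · have := p.length_bypass_le_length
    simpa using this
  · rw [Walk.edges_cons, List.mem_cons] at he
    exact he.imp_right (hsub e)

theorem ShortApart.three_le_of_cycle {H : SimpleGraph V} (h : ShortApart H) {a : V}
    {w : H.Walk a a} (hw : w.IsCycle) (hwl : w.length ≤ 5) {u v : V} (huv : H.Adj u v)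
    (hne : s(u, v) ∉ w.edges) {p : H.Walk u v} (hp : s(u, v) ∉ p.edges) (hpl : p.length ≤ 4)
    {y : V} (hy : y ∈ w.support) (q : H.Walk u y) : 3 ≤ q.length := by
  obtain ⟨c, hc, hcl, hce, -⟩ := exists_cycle_of_walk huv p hp
  refine h c w hc hw (by omega) hwl (fun e => hne ?_) u c.start_mem_support y hy q
  exact (Set.ext_iff.1 e _).1 hce

theorem ShortApart.three_le {H : SimpleGraph V} (h : ShortApart H) {u v u' v' : V}
    (huv : H.Adj u v) {p : H.Walk u v} (hp : s(u, v) ∉ p.edges) (hpl : p.length ≤ 4)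
    (huv' : H.Adj u' v') {p' : H.Walk u' v'} (hp' : s(u', v') ∉ p'.edges) (hpl' : p'.length ≤ 4)
    (hne : s(u', v') ≠ s(u, v)) (hne' : s(u', v') ∉ p.edges) (q : H.Walk u u') :
    3 ≤ q.length := by
  obtain ⟨c, hc, hcl, -, hce⟩ := exists_cycle_of_walk huv p hp
  refine le_trans (h.three_le_of_cycle hc (by omega) huv' (fun he => ?_) hp' hpl'
    c.start_mem_support q.reverse) (by simp)
  rcases hce _ he with e | e
  exacts [hne e, hne' e]

/-- Split a walk at the first vertex outside a given set. -/
theorem exists_first_exit {H : SimpleGraph V} (X : Set V) : ∀ {s t : V} (p : H.Walk s t),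
    s ∈ X → t ∉ X → ∃ (b : V) (r : H.Walk s b) (r' : H.Walk b t), p = r.append r' ∧ b ∉ X ∧
      (∀ x ∈ r.support, x ≠ b → x ∈ X) ∧ (∀ e ∈ r.edges, ∃ x ∈ X, x ∈ e) ∧
      ∃ b' ∈ X, H.Adj b' b := by
  intro s t p
  induction p with
  | nil => exact fun h h' => absurd h h'
  | @cons s s' t hs p ih =>
    intro h h'
    by_cases h1 : s' ∈ X
    · obtain ⟨b, r, r', rfl, hb, hr, he, hb'⟩ := ih h1 h'
      refine ⟨b, .cons hs r, r', rfl, hb, fun x hx hxb => ?_, fun e hee => ?_, hb'⟩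
      · rw [Walk.support_cons, List.mem_cons] at hx
        rcases hx with rfl | hx
        exacts [h, hr x hx hxb]
      · rw [Walk.edges_cons, List.mem_cons] at hee
        rcases hee with rfl | hee
        exacts [⟨s, h, Sym2.mem_mk_left _ _⟩, he e hee]
    · refine ⟨s', .cons hs .nil, p, rfl, h1, fun x hx hxb => ?_, fun e hee => ?_, s, h, hs⟩
      · simp only [Walk.support_cons, Walk.support_nil, List.mem_cons, List.not_mem_nil,
          or_false] at hx
        rcases hx with rfl | rfl
        exacts [h, absurd rfl hxb]
      · simp only [Walk.edges_cons, Walk.edges_nil, List.mem_cons, List.not_mem_nil,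
          or_false] at hee
        exact ⟨s, h, hee ▸ Sym2.mem_mk_left _ _⟩

/-- A path with both ends outside a set which it visits contains an excursion into this set. -/
theorem exists_excursion {H : SimpleGraph V} {X K : Set V}
    (hX : ∀ u ∈ X, ∀ v, H.Adj u v → v ∉ X → v ∈ K) : ∀ {s t : V} (p : H.Walk s t), p.IsPath →
    s ∉ X → t ∉ X → (∃ x ∈ p.support, x ∈ X) →
    ∃ (a b : V) (q : H.Walk a b), q.IsPath ∧ q.support ⊆ p.support ∧ a ∈ K ∧ b ∈ K ∧
      a ∉ X ∧ b ∉ X ∧ 2 ≤ q.length ∧ (∀ x ∈ q.support, x ≠ a → x ≠ b → x ∈ X) ∧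
      ∀ e ∈ q.edges, ∃ x ∈ X, x ∈ e := by
  intro s t p
  induction p with
  | nil =>
    rintro - h - ⟨x, hx, hxX⟩
    rw [Walk.support_nil, List.mem_singleton] at hx
    exact absurd (hx ▸ hxX) h
  | @cons s s' t hs p ih =>
    rintro hp h h' ⟨x, hx, hxX⟩
    rw [Walk.cons_isPath_iff] at hp
    by_cases h1 : s' ∈ X
    · obtain ⟨b, r, r', rfl, hb, hr, he, b', hb', hbb⟩ := exists_first_exit X p h1 h'
      have hsr : s ∉ r.support := fun hsr => hp.2 (Walk.support_subset_support_append_left _ _ hsr)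
      have hl : 1 ≤ r.length := by
        rcases Nat.eq_zero_or_pos r.length with h0 | h0
        · exact absurd (Walk.eq_of_length_eq_zero h0 ▸ h1) hb
        · exact h0
      refine ⟨s, b, .cons hs r, ?_, ?_, hX _ h1 _ hs.symm h, hX _ hb' _ hbb hb, h, hb, ?_, ?_, ?_⟩
      · exact (Walk.cons_isPath_iff _ _).2 ⟨hp.1.of_append_left, hsr⟩
      · rw [Walk.support_cons, Walk.support_cons]
        exact List.cons_subset_cons _ (Walk.support_subset_support_append_left _ _)
      · rw [Walk.length_cons]
        omega
      · intro y hy hya hyb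
        rw [Walk.support_cons, List.mem_cons] at hy
        exact hr y (hy.resolve_left hya) hyb
      · intro e hee
        rw [Walk.edges_cons, List.mem_cons] at hee
        rcases hee with rfl | hee
        exacts [⟨s', h1, Sym2.mem_mk_right _ _⟩, he e hee]
    · rw [Walk.support_cons, List.mem_cons] at hx
      obtain ⟨a, b, q, hq, hsub, hrest⟩ := ih hp.1 h1 h'
        ⟨x, hx.resolve_left (fun e => h (e ▸ hxX)), hxX⟩
      exact ⟨a, b, q, hq, fun y hy => List.mem_cons_of_mem _ (hsub hy), hrest⟩

section Cyclic

variable {H : SimpleGraph V} {v : V} {C : H.Walk v v}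

/-- Cyclic enumeration of the vertices of a closed walk. -/
def cyc (C : H.Walk v v) (i : ℕ) : V := C.getVert (i % C.length)

theorem cyc_mem (C : H.Walk v v) (i : ℕ) : cyc C i ∈ C.support := C.getVert_mem_support _

theorem cyc_step (hC : C.IsCycle) (i : ℕ) :
    H.Adj (cyc C i) (cyc C (i + 1)) ∧ s(cyc C i, cyc C (i + 1)) ∈ C.edges := by
  have hl : 0 < C.length := by have := hC.three_le_length; omega
  have hi := Nat.mod_lt i hl
  have key : cyc C (i + 1) = C.getVert (i % C.length + 1) := by
    unfold cyc
    rcases Nat.lt_or_ge (i % C.length + 1) C.length with h | h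
    · rw [Nat.add_mod, Nat.mod_eq_of_lt (a := 1) (by have := hC.three_le_length; omega),
        Nat.mod_eq_of_lt h]
    · have h' : i % C.length + 1 = C.length := by omega
      have h0 : (i + 1) % C.length = 0 := by
        rw [Nat.add_mod, Nat.mod_eq_of_lt (a := 1) (by have := hC.three_le_length; omega), h',
          Nat.mod_self]
      rw [h0, h', Walk.getVert_zero, Walk.getVert_length]
  rw [key]
  have hadj := C.adj_getVert_succ hi
  refine ⟨hadj, ?_⟩
  exact C.mk_mem_edges_iff_exists.2 ⟨_, hi, rfl⟩

theorem exists_cyc_eq (hC : C.IsCycle) {x : V} (hx : x ∈ C.support) :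
    ∃ i < C.length, cyc C i = x := by
  have hl : 0 < C.length := by have := hC.three_le_length; omega
  obtain ⟨n, hn, hnl⟩ := Walk.mem_support_iff_exists_getVert.1 hx
  rcases hnl.eq_or_lt with rfl | h
  · refine ⟨0, hl, ?_⟩
    rw [← hn]
    simp [cyc]
  · exact ⟨n, h, by rw [cyc, Nat.mod_eq_of_lt h, hn]⟩

theorem cyc_inj (hC : C.IsCycle) {i j : ℕ} (h : cyc C i = cyc C j) :
    i % C.length = j % C.length := by
  have hl : 0 < C.length := by have := hC.three_le_length; omega
  have hi := Nat.mod_lt i hl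
  have hj := Nat.mod_lt j hl
  exact hC.getVert_injOn' (by simp only [Set.mem_ofPred_eq]; omega)
    (by simp only [Set.mem_ofPred_eq]; omega) h

theorem exists_cyc_walk (hC : C.IsCycle) (i d : ℕ) :
    ∃ q : H.Walk (cyc C i) (cyc C (i + d)), q.length = d ∧ ∀ e ∈ q.edges, e ∈ C.edges := by
  induction d with
  | zero => exact ⟨.nil, rfl, by simp⟩
  | succ d ih =>
    obtain ⟨q, hq, hqe⟩ := ih
    refine ⟨q.concat (cyc_step hC (i + d)).1, by simp [hq], fun e he => ?_⟩
    rw [Walk.edges_concat, List.concat_eq_append, List.mem_append, List.mem_singleton] at he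
    rcases he with he | rfl
    exacts [hqe e he, (cyc_step hC (i + d)).2]

theorem cyc_add_length (C : H.Walk v v) (i : ℕ) : cyc C (i + C.length) = cyc C i := by
  simp [cyc]

/-- Two vertices of a cycle are joined along it in at most half of its length. -/
theorem exists_short_arc (hC : C.IsCycle) {x y : V} (hx : x ∈ C.support) (hy : y ∈ C.support) :
    ∃ q : H.Walk x y, 2 * q.length ≤ C.length ∧ ∀ e ∈ q.edges, e ∈ C.edges := by
  have key : ∀ i j, i ≤ j → j < C.length →
      ∃ q : H.Walk (cyc C i) (cyc C j), 2 * q.length ≤ C.length ∧ ∀ e ∈ q.edges, e ∈ C.edges := by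
    intro i j hij hj
    rcases le_or_gt (2 * (j - i)) C.length with h | h
    · have hex := exists_cyc_walk hC i (j - i)
      rw [Nat.add_sub_cancel' hij] at hex
      obtain ⟨q, hq, hqe⟩ := hex
      exact ⟨q, by omega, hqe⟩
    · have hex := exists_cyc_walk hC j (C.length - j + i)
      rw [show j + (C.length - j + i) = i + C.length by omega, cyc_add_length] at hex
      obtain ⟨q, hq, hqe⟩ := hex
      exact ⟨q.reverse, by rw [Walk.length_reverse]; omega, by simpa using hqe⟩
  obtain ⟨i, hi, rfl⟩ := exists_cyc_eq hC hx
  obtain ⟨j, hj, rfl⟩ := exists_cyc_eq hC hy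
  rcases le_total i j with h | h
  · exact key i j h hj
  · obtain ⟨q, hq, hqe⟩ := key j i h hi
    exact ⟨q.reverse, by simpa, by simpa⟩

end Cyclic

/-- The graph obtained by deleting all edges with an end in `X`. -/
def delEdgesAt {W : Type*} (A : SimpleGraph W) (X : Set W) : SimpleGraph W where
  Adj a b := A.Adj a b ∧ a ∉ X ∧ b ∉ X
  symm := ⟨fun _ _ h => ⟨h.1.symm, h.2.2, h.2.1⟩⟩
  loopless := ⟨fun _ h => h.1.ne rfl⟩

theorem delEdgesAt_le {W : Type*} (A : SimpleGraph W) (X : Set W) : delEdgesAt A X ≤ A :=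
  fun _ _ h => h.1

theorem not_isAcyclic_edge {W : Type*} {A : SimpleGraph W} (hA : A.IsAcyclic) {u v : W}
    (huv : A.Adj u v) : ¬ (A \ fromEdgeSet {s(u, v)}).Reachable u v :=
  (isBridge_iff.1 (isAcyclic_iff_forall_adj_isBridge.1 hA huv))

theorem isCycle_edge_reachable {W : Type*} {A : SimpleGraph W} {a : W} {w : A.Walk a a}
    (hw : w.IsCycle) {u v : W} (he : s(u, v) ∈ w.edges) :
    (A \ fromEdgeSet {s(u, v)}).Reachable u v := by
  have := adj_and_reachable_delete_edges_iff_exists_cycle.2 ⟨a, w, hw, he⟩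
  exact this.2

theorem reachable_of_forall_adj {W W' : Type*} {H : SimpleGraph W} {H' : SimpleGraph W'}
    (g : W → W') (h : ∀ a b, H.Adj a b → H'.Reachable (g a) (g b)) {u v : W}
    (huv : H.Reachable u v) : H'.Reachable (g u) (g v) := by
  obtain ⟨p⟩ := huv
  induction p with
  | nil => rfl
  | cons hadj _ ih => exact (h _ _ hadj).trans ih

/-- Removing a vertex with at most one neighbor does not affect acyclicity. -/
theorem isAcyclic_of_del_leaf {W : Type*} {A : SimpleGraph W} (v : W)
    (hv : ∀ a b, A.Adj v a → A.Adj v b → a = b) (h : (delEdgesAt A {v}).IsAcyclic) :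
    A.IsAcyclic := by
  intro a w hw
  have key : ∀ x, s(v, x) ∉ w.edges := by
    intro x hx
    have hvx : A.Adj v x := w.adj_of_mem_edges hx
    obtain ⟨p⟩ := isCycle_edge_reachable hw hx
    cases p with
    | nil => exact hvx.ne rfl
    | cons hadj _ =>
      rw [sdiff_adj, fromEdgeSet_adj] at hadj
      exact hadj.2 ⟨by rw [hv _ _ hadj.1 hvx]; rfl, hadj.1.ne⟩
  refine h (w.transfer _ ?_) (hw.transfer ?_)
  all_goals
    intro e he
    induction e with | _ x y
    refine ⟨w.adj_of_mem_edges he, ?_, ?_⟩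
    · rintro rfl
      exact key _ he
    · rintro rfl
      exact key _ (Sym2.eq_swap ▸ he)

theorem isAcyclic_of_peel {W : Type*} : ∀ {A : SimpleGraph W} (l : List W),
    (∀ l₁ v l₂, l = l₁ ++ v :: l₂ → ∀ a b, A.Adj v a → a ∉ l₁ → A.Adj v b → b ∉ l₁ → a = b) →
    (delEdgesAt A {w | w ∈ l}).IsAcyclic → A.IsAcyclic
  | A, [], _, h => h.anti fun _ _ hab => (⟨hab, by simp, by simp⟩ : A.Adj _ _ ∧ _ ∧ _)
  | A, v :: l, hl, h => by
    refine isAcyclic_of_del_leaf v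
      (fun a b ha hb => hl [] v l rfl a b ha (by simp) hb (by simp))
      (isAcyclic_of_peel l (fun l₁ w l₂ hs a b ha ha' hb hb' => ?_) (h.anti ?_))
    · refine hl (v :: l₁) w l₂ (by rw [hs]; rfl) a b ha.1 ?_ hb.1 ?_
      · exact fun h => (List.mem_cons.1 h).elim ha.2.2 ha'
      · exact fun h => (List.mem_cons.1 h).elim hb.2.2 hb'
    · rintro a b ⟨⟨hab, ha, hb⟩, ha', hb'⟩
      exact ⟨hab, fun h => (List.mem_cons.1 h).elim ha ha',
        fun h => (List.mem_cons.1 h).elim hb hb'⟩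

/-- A graph is acyclic if contracting an acyclic part of it leaves an acyclic graph without
creating parallel edges. -/
theorem isAcyclic_of_quotient {W W' : Type*} {H K : SimpleGraph W} {H' : SimpleGraph W'}
    (g : W → W') (hH' : H'.IsAcyclic) (hK : K.IsAcyclic)
    (hadj : ∀ u v, H.Adj u v → g u ≠ g v → H'.Adj (g u) (g v))
    (hinj : ∀ u v u' v', H.Adj u v → H.Adj u' v' → g u ≠ g v → g u = g u' → g v = g v' →
      u = u' ∧ v = v')
    (hcol : ∀ u v, H.Adj u v → g u = g v → K.Adj u v) : H.IsAcyclic := by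
  intro a w hw
  by_cases hall : ∀ u v, s(u, v) ∈ w.edges → g u = g v
  · have : ∀ e ∈ w.edges, e ∈ K.edgeSet := by
      intro e he
      induction e with | _ x y
      exact hcol _ _ (w.adj_of_mem_edges he) (hall _ _ he)
    exact hK (w.transfer K this) (hw.transfer this)
  · push Not at hall
    obtain ⟨u, v, he, hne⟩ := hall
    have huv : H.Adj u v := w.adj_of_mem_edges he
    refine not_isAcyclic_edge hH' (hadj u v huv hne)
      (reachable_of_forall_adj g (fun x y hxy => ?_) (isCycle_edge_reachable hw he))
    rw [sdiff_adj, fromEdgeSet_adj] at hxy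
    by_cases hg : g x = g y
    · rw [hg]
    · refine Adj.reachable ?_
      rw [sdiff_adj, fromEdgeSet_adj]
      refine ⟨hadj x y hxy.1 hg, fun h => hxy.2 ⟨?_, hxy.1.ne⟩⟩
      rcases Sym2.eq_iff.1 (Set.mem_singleton_iff.1 h.1) with ⟨h1, h2⟩ | ⟨h1, h2⟩
      · obtain ⟨rfl, rfl⟩ := hinj u v x y huv hxy.1 hne h1.symm h2.symm
        rfl
      · obtain ⟨rfl, rfl⟩ := hinj u v y x huv hxy.1.symm hne h2.symm h1.symm
        exact Sym2.eq_swap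

/-- The graph formed by the `F`-colored vertices, where the edges inside `Q` are replaced by
edges to an additional vertex. -/
def linkGraph (G : SimpleGraph V) (Q : Set V) (c : V → Bool) : SimpleGraph (Option V) where
  Adj a b := match a, b with
    | some u, some v => G.Adj u v ∧ c u = false ∧ c v = false ∧ ¬ (u ∈ Q ∧ v ∈ Q)
    | some u, none => u ∈ Q ∧ c u = false
    | none, some u => u ∈ Q ∧ c u = false
    | none, none => False
  symm := ⟨fun a b h => by
    rcases a with - | a <;> rcases b with - | b
    · exact h
    · exact h
    · exact h
    · exact ⟨h.1.symm, h.2.2.1, h.2.1, fun hh => h.2.2.2 hh.symm⟩⟩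
  loopless := ⟨fun a h => by
    rcases a with - | a
    · exact h
    · exact h.1.ne rfl⟩

section linkGraph

variable {G : SimpleGraph V} {Q : Set V} {c : V → Bool}

theorem linkGraph_not_reachable (hac : (linkGraph G Q c).IsAcyclic) {u v : V}
    (huv : G.Adj u v) (hu : c u = false) (hv : c v = false) (hQ : ¬ (u ∈ Q ∧ v ∈ Q))
    {H : SimpleGraph V} (hH : ∀ a b, H.Adj a b → c a = false ∧ c b = false ∧
      s(u, v) ≠ s(a, b) ∧ (G.Adj a b ∨ (a ∈ Q ∧ b ∈ Q))) : ¬ H.Reachable u v := by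
  intro hr
  have hadj : (linkGraph G Q c).Adj (some u) (some v) := ⟨huv, hu, hv, hQ⟩
  refine not_isAcyclic_edge hac hadj (reachable_of_forall_adj some (fun a b hab => ?_) hr)
  obtain ⟨ha, hb, hne, h⟩ := hH a b hab
  by_cases hab' : a ∈ Q ∧ b ∈ Q
  · have h1 : (linkGraph G Q c \ fromEdgeSet {s(some u, some v)}).Adj (some a) none := by
      rw [sdiff_adj, fromEdgeSet_adj]
      exact ⟨⟨hab'.1, ha⟩, fun h => by simpa using h.1⟩
    have h2 : (linkGraph G Q c \ fromEdgeSet {s(some u, some v)}).Adj none (some b) := by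
      rw [sdiff_adj, fromEdgeSet_adj]
      exact ⟨⟨hab'.2, hb⟩, fun h => by simpa using h.1⟩
    exact h1.reachable.trans h2.reachable
  · refine Adj.reachable ?_
    rw [sdiff_adj, fromEdgeSet_adj]
    refine ⟨⟨h.resolve_right hab', ha, hb, hab'⟩, fun h => hne ?_⟩
    have := h.1
    simpa [eq_comm] using this

theorem superIFColoring_of_isAcyclic
    (hI : ∀ ⦃u v : V⦄, G.Adj u v → c u = true → c v = false) (hQ : IFColoringOn G Q c)
    (hac : (linkGraph G Q c).IsAcyclic) : SuperIFColoring G Q c := by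
  refine ⟨⟨hI, fun v w hw hF => ?_⟩, fun a b p ⟨hp, hF, ha, hb, hl, hpQ⟩ => ?_⟩
  · by_cases hall : ∀ x ∈ w.support, x ∈ Q
    · exact hQ.2 v w hw hall hF
    push Not at hall
    obtain ⟨x, hx, hxQ⟩ := hall
    obtain ⟨y, hy⟩ : ∃ y, s(x, y) ∈ w.edges := by
      obtain ⟨e, he, hxe⟩ := (Walk.mem_support_iff_exists_mem_edges_of_not_nil hw.not_nil).1 hx
      obtain ⟨y, rfl⟩ := hxe
      exact ⟨y, he⟩
    have hsub : ∀ e ∈ w.edges, e ∈ (fromEdgeSet {e | e ∈ w.edges}).edgeSet := fun e he => by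
      rw [edgeSet_fromEdgeSet]
      exact ⟨he, G.not_isDiag_of_mem_edgeSet (w.edges_subset_edgeSet he)⟩
    refine linkGraph_not_reachable hac (w.adj_of_mem_edges hy) (hF _ hx)
      (hF _ (w.snd_mem_support_of_mem_edges hy)) (fun h => hxQ h.1) (fun s t hst => ?_)
      (isCycle_edge_reachable (hw.transfer hsub) (by simpa using hy))
    rw [sdiff_adj, fromEdgeSet_adj, fromEdgeSet_adj] at hst
    have hst' : s(s, t) ∈ w.edges := hst.1.1
    exact ⟨hF _ (w.fst_mem_support_of_mem_edges hst'), hF _ (w.snd_mem_support_of_mem_edges hst'),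
      fun h => hst.2 ⟨h.symm, hst.1.2⟩, Or.inl (w.adj_of_mem_edges hst')⟩
  · cases p with
    | nil => simp at hl
    | @cons _ y _ hay p =>
      rw [Walk.cons_isPath_iff] at hp
      rw [Walk.support_cons] at hF hpQ
      have hya : y ≠ a := hay.ne'
      have hyb : y ≠ b := by
        rintro rfl
        have := Walk.isPath_iff_nil.1 hp.1
        rw [Walk.length_cons, Walk.length_eq_zero_iff.2 this] at hl
        omega
      have hyQ : y ∉ Q := hpQ y (List.mem_cons_of_mem _ p.start_mem_support) hya hyb
      have hsub : ∀ e ∈ p.edges,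
          e ∈ (fromEdgeSet ({e | e ∈ p.edges} ∪ {s(a, b)} : Set (Sym2 V))).edgeSet := fun e he => by
        rw [edgeSet_fromEdgeSet]
        exact ⟨Or.inl he, G.not_isDiag_of_mem_edgeSet (p.edges_subset_edgeSet he)⟩
      have hab : a ≠ b := by
        rintro rfl
        exact hp.2 p.end_mem_support
      have hr1 : (fromEdgeSet ({e | e ∈ p.edges} ∪ {s(a, b)} : Set (Sym2 V))).Adj a b :=
        (fromEdgeSet_adj _).2 ⟨Or.inr rfl, hab⟩
      refine linkGraph_not_reachable hac hay (hF a List.mem_cons_self)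
        (hF y (List.mem_cons_of_mem _ p.start_mem_support)) (fun h => hyQ h.2) (fun s t hst => ?_)
        (hr1.reachable.trans (p.transfer _ hsub).reachable.symm)
      rw [fromEdgeSet_adj] at hst
      rcases hst.1 with h | h
      · have hs := p.fst_mem_support_of_mem_edges h
        have ht := p.snd_mem_support_of_mem_edges h
        refine ⟨hF _ (List.mem_cons_of_mem _ hs), hF _ (List.mem_cons_of_mem _ ht), fun he => ?_,
          Or.inl (p.adj_of_mem_edges h)⟩
        rcases Sym2.eq_iff.1 he with ⟨rfl, rfl⟩ | ⟨rfl, rfl⟩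
        exacts [hp.2 hs, hp.2 ht]
      · have hFa := hF a List.mem_cons_self
        have hFb := hF b (List.mem_cons_of_mem _ p.end_mem_support)
        have hne : s(a, y) ≠ s(a, b) := fun he =>
          (Sym2.eq_iff.1 he).elim (fun h => hyb h.2) (fun h => hab h.1)
        rw [Set.mem_singleton_iff] at h
        rw [h]
        rcases Sym2.eq_iff.1 h with ⟨rfl, rfl⟩ | ⟨rfl, rfl⟩
        exacts [⟨hFa, hFb, hne, Or.inr ⟨ha, hb⟩⟩, ⟨hFb, hFa, hne, Or.inr ⟨hb, ha⟩⟩]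

theorem linkGraph_lift : ∀ {a b : Option V} (p : (linkGraph G Q c).Walk a b) (u v : V),
    a = some u → b = some v → none ∉ p.support →
    ∃ p' : G.Walk u v, p'.support.map some = p.support ∧
      p'.edges.map (Sym2.map some) = p.edges := by
  intro a b p
  induction p with
  | nil =>
    rintro u v rfl h -
    obtain rfl : u = v := Option.some_injective _ h
    exact ⟨.nil, rfl, rfl⟩
  | @cons a a' b h p ih =>
    rintro u v rfl rfl hn
    rw [Walk.support_cons, List.mem_cons, not_or] at hn
    rcases a' with - | u'
    · exact absurd p.start_mem_support hn.2
    obtain ⟨p', h1, h2⟩ := ih u' v rfl rfl hn.2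
    exact ⟨.cons h.1 p', by simp [h1], by simp [h2]⟩

theorem linkGraph_color {a b : Option V} {u : V} {p : (linkGraph G Q c).Walk a b}
    (hp : ¬ p.Nil) (hu : some u ∈ p.support) : c u = false := by
  obtain ⟨e, he, hue⟩ := (Walk.mem_support_iff_exists_mem_edges_of_not_nil hp).1 hu
  obtain ⟨y, rfl⟩ := hue
  have := p.adj_of_mem_edges he
  rcases y with - | y
  exacts [this.2, this.2.1]

theorem SuperIFColoring.isAcyclic_linkGraph (h : SuperIFColoring G Q c) :
    (linkGraph G Q c).IsAcyclic := by
  classical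
  intro a w hw
  by_cases hn : none ∈ w.support
  · obtain ⟨w', hw'⟩ : ∃ w' : (linkGraph G Q c).Walk none none, w'.IsCycle :=
      ⟨_, hw.rotate hn⟩
    cases w' with
    | nil => exact hw'.not_nil .nil
    | @cons _ a _ h1 p =>
      rw [Walk.cons_isCycle_iff] at hw'
      obtain ⟨hp, hne⟩ := hw'
      rcases a with - | q
      · exact h1
      rw [← p.reverse_reverse, Walk.edges_reverse, List.mem_reverse] at hne
      rw [← Walk.isPath_reverse_iff] at hp
      generalize p.reverse = p at hp hne
      cases p with
      | @cons _ b _ h2 p =>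
        rcases b with - | q'
        · exact h2
        rw [Walk.cons_isPath_iff] at hp
        have hqq : q' ≠ q := by
          rintro rfl
          simp at hne
        obtain ⟨p', hs, he⟩ := linkGraph_lift p q' q rfl rfl hp.2
        have hp' : p'.IsPath := by
          rw [Walk.isPath_def]
          exact List.Nodup.of_map some (hs ▸ hp.1.support_nodup)
        have hpn : ¬ p.Nil := fun hh => hqq (Option.some_injective _ hh.eq)
        have hF : ∀ x ∈ p'.support, c x = false := fun x hx =>
          linkGraph_color hpn (hs ▸ List.mem_map_of_mem hx)
        have hE : ∀ u v, s(u, v) ∈ p'.edges → ¬ (u ∈ Q ∧ v ∈ Q) := fun u v huv => by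
          have : s(some u, some v) ∈ p.edges := he ▸ List.mem_map_of_mem huv
          exact (p.adj_of_mem_edges this).2.2.2
        clear hs he
        cases p' with
        | nil => exact hqq rfl
        | @cons _ y _ hy r =>
          have hyQ : y ∉ Q := fun hyQ => hE q' y (by simp) ⟨h2.1, hyQ⟩
          obtain ⟨b, r₁, r₂, rfl, hb, hr, -⟩ := exists_first_exit Qᶜ r hyQ (fun hh => hh h1.1)
          rw [Walk.cons_isPath_iff] at hp'
          have hsub := Walk.support_subset_support_append_left r₁ r₂
          refine h.2 q' b (.cons hy r₁) ⟨?_, fun x hx => hF x ?_, h2.1, not_not.1 hb, ?_, ?_⟩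
          · exact (Walk.cons_isPath_iff _ _).2 ⟨hp'.1.of_append_left, fun hh => hp'.2 (hsub hh)⟩
          · rw [Walk.support_cons] at hx ⊢
            exact List.cons_subset_cons _ hsub hx
          · have : r₁.length ≠ 0 := fun h0 => hb (Walk.eq_of_length_eq_zero h0 ▸ hyQ)
            rw [Walk.length_cons]
            omega
          · intro x hx hxq hxb
            rw [Walk.support_cons, List.mem_cons] at hx
            exact hr x (hx.resolve_left hxq) hxb
  · rcases a with - | u
    · exact hn w.start_mem_support
    obtain ⟨w', h1, h2⟩ := linkGraph_lift w u u rfl rfl hn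
    refine h.1.2 u w' ?_ fun x hx => linkGraph_color hw.not_nil ?_
    · rw [Walk.isCycle_def, Walk.isTrail_def]
      refine ⟨?_, ?_, ?_⟩
      · exact List.Nodup.of_map _ (h2 ▸ hw.edges_nodup)
      · rintro rfl
        have := hw.three_le_length
        rw [← Walk.length_edges, ← h2] at this
        simp at this
      · refine List.Nodup.of_map some ?_
        rw [List.map_tail, h1]
        exact hw.support_nodup
    · rw [← h1]
      exact List.mem_map_of_mem hx

end linkGraph

section Iso

variable {W : Type} {G : SimpleGraph V} {H : SimpleGraph W}

theorem Cycles5Apart.of_iso (f : G ≃g H) (h : Cycles5Apart G) : Cycles5Apart H := by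
  intro u v c₁ c₂ h₁ h₂ l₁ l₂ hne x hx y hy
  have hinj := f.symm.toEquiv.injective
  have key := h (c₁.map f.symm.toHom) (c₂.map f.symm.toHom)
    ((Walk.isCycle_map_iff_of_injective hinj).2 h₁) ((Walk.isCycle_map_iff_of_injective hinj).2 h₂)
    (by simpa) (by simpa) (fun he => hne (Set.ext fun e => ?_)) (f.symm x)
    (by rw [Walk.support_map]; exact List.mem_map_of_mem hx) (f.symm y)
    (by rw [Walk.support_map]; exact List.mem_map_of_mem hy)
  · have hr : G.Reachable (f.symm x) (f.symm y) :=
      Reachable.of_dist_ne_zero (by omega)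
    have hr' : H.Reachable x y := by
      have := hr.map f.toHom
      simpa using this
    obtain ⟨p, hp⟩ := hr'.exists_walk_length_eq_dist
    have := G.dist_le (p.map f.symm.toHom)
    rw [Walk.length_map, hp] at this
    exact key.trans this
  · have hi := Sym2.map.injective hinj
    have := Set.ext_iff.1 he (Sym2.map f.symm e)
    simp only [Walk.edges_map, Set.mem_ofPred_eq] at this
    exact (List.mem_map_of_injective hi).symm.trans (this.trans (List.mem_map_of_injective hi))

theorem mem_support_map_iso {a : V} {C : G.Walk a a} (f : G ≃g H) {x : W} :
    x ∈ (C.map f.toHom).support ↔ f.symm x ∈ C.support := by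
  rw [Walk.support_map, List.mem_map]
  exact ⟨fun ⟨y, hy, hyx⟩ => hyx ▸ (by simpa using hy), fun h => ⟨_, h, by simp⟩⟩

theorem IsGoodCycle.map_iso {a : V} {C : G.Walk a a} (f : G ≃g H) (h : IsGoodCycle G C) :
    IsGoodCycle H (C.map f.toHom) := by
  have hadj : ∀ {x y}, H.Adj x y → G.Adj (f.symm x) (f.symm y) := fun h => f.symm.map_adj_iff.2 h
  have hinj := f.symm.toEquiv.injective
  have hne : ∀ {x y}, x ≠ y → f.symm x ≠ f.symm y := fun h => hinj.ne h
  refine ⟨(Walk.isCycle_map_iff_of_injective f.toEquiv.injective).2 h.1, fun hb =>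
    h.2 ⟨h.1, by simpa using hb.2.1, ?_⟩⟩
  rcases hb.2.2 with ⟨x, hx, a, b, c, ha, hb, hc, hab, hac, hbc, h1, h2, h3⟩ |
    ⟨x, y, z, hx, hy, hz, hxy, hyz, hxz, a, b, c, ha, hb, hc, hab, hac, hbc, h1, h2, h3⟩
  · rw [mem_support_map_iso] at *
    exact Or.inl ⟨_, hx, _, _, _, ha, hb, hc, hne hab, hne hac, hne hbc, hadj h1, hadj h2,
      hadj h3⟩
  · rw [mem_support_map_iso] at *
    exact Or.inr ⟨_, _, _, hx, hy, hz, hadj hxy, hadj hyz, hadj hxz, _, _, _, ha, hb, hc, hne hab,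
      hne hac, hne hbc, hadj h1, hadj h2, hadj h3⟩

theorem IFColoringOn.map_iso {S : Set V} {S' : Set W} {c : V → Bool} (f : G ≃g H)
    (hS : ∀ x, x ∈ S' → f.symm x ∈ S) (h : IFColoringOn G S c) :
    IFColoringOn H S' (c ∘ f.symm) := by
  refine ⟨fun u v hu hv huv => h.1 (hS u hu) (hS v hv) (f.symm.map_adj_iff.2 huv),
    fun v w hw hwS hF => ?_⟩
  refine h.2 _ (w.map f.symm.toHom)
    ((Walk.isCycle_map_iff_of_injective f.symm.toEquiv.injective).2 hw) ?_ ?_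
  all_goals
    intro x hx
    rw [Walk.support_map, List.mem_map] at hx
    obtain ⟨y, hy, rfl⟩ := hx
  exacts [hS y (hwS y hy), hF y hy]

theorem ExtendsToSuper.of_iso {a : V} {C : G.Walk a a} {c₀ : V → Bool} (f : G ≃g H)
    (h : ExtendsToSuper H (C.map f.toHom) (c₀ ∘ f.symm)) : ExtendsToSuper G C c₀ := by
  obtain ⟨c, ⟨⟨hI, hF⟩, hs⟩, hc⟩ := h
  have hinj := f.toEquiv.injective
  have hmem : ∀ x, f x ∈ (C.map f.toHom).support ↔ x ∈ C.support := fun x => by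
    rw [mem_support_map_iso]; simp
  refine ⟨c ∘ f, ⟨⟨fun u v huv => hI (f.map_adj_iff.2 huv), fun v w hw h => ?_⟩,
    fun a b p ⟨hp, hpF, ha, hb, hl, hQ⟩ => ?_⟩, fun x hx => ?_⟩
  · refine hF _ (w.map f.toHom) ((Walk.isCycle_map_iff_of_injective hinj).2 hw) fun x hx => ?_
    rw [Walk.support_map, List.mem_map] at hx
    obtain ⟨y, hy, rfl⟩ := hx
    exact h y hy
  · refine hs _ _ (p.map f.toHom) ⟨(Walk.isPath_map_iff_of_injective hinj).2 hp, ?_,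
      (hmem a).2 ha, (hmem b).2 hb, by simpa, ?_⟩
    all_goals
      intro x hx
      rw [Walk.support_map, List.mem_map] at hx
      obtain ⟨y, hy, rfl⟩ := hx
    · exact hpF y hy
    · exact fun h1 h2 h3 => hQ y hy (fun h => h1 (h ▸ rfl)) (fun h => h2 (h ▸ rfl)) ((hmem y).1 h3)
  · have := hc (f x) ((hmem x).2 hx)
    simpa using this

end Iso

theorem walk_edges_delEdgesAt {H : SimpleGraph V} {X : Set V} {a b : V} (p : H.Walk a b)
    (hp : ∀ x ∈ p.support, x ∉ X) : ∀ e ∈ p.edges, e ∈ (delEdgesAt H X).edgeSet := by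
  intro e he
  induction e with | _ x y
  exact ⟨p.adj_of_mem_edges he, hp _ (p.fst_mem_support_of_mem_edges he),
    hp _ (p.snd_mem_support_of_mem_edges he)⟩

theorem walk_support_subset_of_closed {H : SimpleGraph V} {X : Set V}
    (hX : ∀ u ∈ X, ∀ v, H.Adj u v → v ∈ X) {a b : V} (p : H.Walk a b) (ha : a ∈ X) :
    ∀ x ∈ p.support, x ∈ X := by
  induction p with
  | nil => simpa
  | cons h p ih =>
    intro x hx
    rw [Walk.support_cons, List.mem_cons] at hx
    rcases hx with rfl | hx
    exacts [ha, ih (hX _ ha _ h) x hx]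

theorem IsGoodCycle.transfer {G H : SimpleGraph V} {a : V} {C : G.Walk a a} (h : IsGoodCycle G C)
    (hle : H ≤ G) (hC : ∀ e ∈ C.edges, e ∈ H.edgeSet) : IsGoodCycle H (C.transfer H hC) := by
  refine ⟨h.1.transfer hC, fun hb => h.2 ⟨h.1, by simpa using hb.2.1, ?_⟩⟩
  rcases hb.2.2 with ⟨x, hx, a, b, c, ha, hb, hc, hab, hac, hbc, h1, h2, h3⟩ |
    ⟨x, y, z, hx, hy, hz, hxy, hyz, hxz, a, b, c, ha, hb, hc, hab, hac, hbc, h1, h2, h3⟩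
  all_goals rw [Walk.support_transfer] at *
  · exact Or.inl ⟨x, hx, a, b, c, ha, hb, hc, hab, hac, hbc, hle h1, hle h2, hle h3⟩
  · exact Or.inr ⟨x, y, z, hx, hy, hz, hle hxy, hle hyz, hle hxz, a, b, c, ha, hb, hc, hab, hac,
      hbc, hle h1, hle h2, hle h3⟩

theorem IFColoringOn.anti {G H : SimpleGraph V} {S : Set V} {c : V → Bool}
    (h : IFColoringOn G S c) (hle : H ≤ G) : IFColoringOn H S c :=
  ⟨fun _ _ hu hv huv => h.1 hu hv (hle huv), fun v w hw hwS hF =>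
    h.2 v (w.mapLe hle) (hw.mapLe hle) (by simpa using hwS) (by simpa using hF)⟩

theorem IsGoodCycle.of_length_ne {G : SimpleGraph V} {a : V} {C : G.Walk a a} (h : C.IsCycle)
    (hl : C.length ≠ 9) : IsGoodCycle G C :=
  ⟨h, fun hb => hl hb.2.1⟩

/-- Every planar graph with fewer than `M` vertices and edges satisfies the extension theorem. -/
def ExtendsBelow (M : ℕ) : Prop :=
  ∀ (n : ℕ) (G : SimpleGraph (Fin n)) (v : Fin n) (C : G.Walk v v) (c : Fin n → Bool),
    IsCounterexample G C c → M ≤ graphSize G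

theorem ExtendsBelow.extendsToSuper_of_cycles5Apart [Fintype V] {M : ℕ} (hM : ExtendsBelow M)
    {H : SimpleGraph V} (hpl : IsPlanarGraph H) (hap : Cycles5Apart H) {v : V} {C : H.Walk v v}
    (hC : IsGoodCycle H C) (hl : C.length ≤ 9) {c₀ : V → Bool}
    (hc₀ : IFColoringOn H {x | x ∈ C.support} c₀) (hs : graphSize H < M) :
    ExtendsToSuper H C c₀ := by
  classical
  by_contra hne
  let e := Fintype.equivFin V
  let f : H ≃g H.map e := Iso.map e H
  refine hs.not_ge ((hM _ (H.map e) _ (C.map f.toHom) (c₀ ∘ f.symm) ⟨?_, hap.of_iso f,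
    hC.map_iso f, by simpa, hc₀.map_iso f fun x => (mem_support_map_iso f).1,
    fun h => hne (h.of_iso f)⟩).trans_eq ?_)
  · exact hpl.of_equiv e.symm fun u v h => f.symm.map_adj_iff.2 h
  · unfold graphSize
    rw [Fintype.card_fin, ← Nat.card_coe_set_eq, ← Nat.card_coe_set_eq,
      Nat.card_congr f.mapEdgeSet]

theorem graphSize_lt_of_le [Fintype V] {G H : SimpleGraph V} (hle : H ≤ G) {u v : V}
    (hG : G.Adj u v) (hH : ¬ H.Adj u v) : graphSize H < graphSize G := by
  unfold graphSize
  refine Nat.add_lt_add_left (Set.ncard_lt_ncard ?_ (Set.toFinite _)) _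
  refine ⟨edgeSet_mono hle, fun h => hH ?_⟩
  exact h (show s(u, v) ∈ G.edgeSet from hG)

theorem ShortApart.ifColoringOn_cycle {H : SimpleGraph V} (hap : ShortApart H) {t : V}
    {T : H.Walk t t} (hT : T.IsCycle) (hl : T.length ≤ 5) [DecidableEq V] :
    IFColoringOn H {x | x ∈ T.support} (fun u => decide (u = t)) := by
  refine ⟨fun u v _ _ huv hu => ?_, fun v w hw hwS hF => ?_⟩
  · simp only [decide_eq_true_eq, decide_eq_false_iff_not] at hu ⊢
    exact fun hv => huv.ne (hu.trans hv.symm)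
  · have ht : t ∉ w.support := fun h => by simpa using hF t h
    have hlen : w.length ≤ 5 := by
      have h1 : w.support.tail.Nodup := hw.support_nodup
      have h2 : w.support.tail ⊆ T.support := fun x hx => hwS x (List.mem_of_mem_tail hx)
      have h3 : w.support.tail ⊆ T.support.tail := fun x hx => by
        have hx' := h2 hx
        rw [← Walk.cons_tail_support, List.mem_cons] at hx'
        exact hx'.resolve_left fun h => ht (h ▸ List.mem_of_mem_tail hx)
      have := (List.subperm_of_subset h1 h3).length_le
      simp only [List.length_tail, Walk.length_support] at this
      omega
    have := hap w T hw hT hlen hl (fun he => ?_) v w.start_mem_support v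
      (hwS v w.start_mem_support) .nil
    · simp at this
    · have h1 : s(t, T.snd) ∈ T.edges := T.mk_start_snd_mem_edges hT.not_nil
      have h2 : s(t, T.snd) ∈ w.edges := (Set.ext_iff.1 he _).2 h1
      exact ht (w.fst_mem_support_of_mem_edges h2)

theorem ExtendsBelow.extendsToSuper [Fintype V] {M : ℕ} (hM : ExtendsBelow M) :
    ∀ (N : ℕ) {H : SimpleGraph V}, graphSize H ≤ N → IsPlanarGraph H → ShortApart H →
    ∀ {v : V} {C : H.Walk v v}, IsGoodCycle H C → C.length ≤ 9 → ∀ {c₀ : V → Bool},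
    IFColoringOn H {x | x ∈ C.support} c₀ → graphSize H < M → ExtendsToSuper H C c₀ := by
  classical
  intro N
  induction N with
  | zero =>
    intro H h0 _ _ v
    have : 0 < Fintype.card V := Fintype.card_pos_iff.2 ⟨v⟩
    unfold graphSize at h0
    omega
  | succ N ih =>
    intro H hN hpl hap v C hC hl c₀ hc₀ hs
    by_cases h5 : Cycles5Apart H
    · exact hM.extendsToSuper_of_cycles5Apart hpl h5 hC hl hc₀ hs
    have hex : ∃ (t : V) (T : H.Walk t t), T.IsCycle ∧ T.length ≤ 5 ∧ ¬ H.Reachable v t := by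
      unfold Cycles5Apart at h5
      push Not at h5
      obtain ⟨t₁, t₂, T₁, T₂, h₁, h₂, l₁, l₂, hne, x, hx, y, hy, hxy⟩ := h5
      by_contra hcon
      push Not at hcon
      have hr : H.Reachable x y :=
        (((T₁.takeUntil x hx).reachable.symm.trans (hcon _ T₁ h₁ l₁).symm).trans
          (hcon _ T₂ h₂ l₂)).trans (T₂.takeUntil y hy).reachable
      obtain ⟨p, hp⟩ := hr.exists_walk_length_eq_dist
      have := hap T₁ T₂ h₁ h₂ l₁ l₂ hne x hx y hy p
      omega
    obtain ⟨t, T, hT, hTl, ht⟩ := hex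
    set X : Set V := {u | ¬ H.Reachable v u} with hX
    have hXc : ∀ u ∈ X, ∀ w, H.Adj u w → w ∈ X := fun u hu w huw hw =>
      hu (hw.trans huw.symm.reachable)
    have hXc' : ∀ u ∈ Xᶜ, ∀ w, H.Adj u w → w ∈ Xᶜ := fun u hu w huw hw =>
      hu (hXc w hw u huw.symm)
    have hvX : v ∈ Xᶜ := fun h => h (Reachable.refl v)
    have hCX := walk_support_subset_of_closed hXc' C hvX
    have hTX := walk_support_subset_of_closed hXc T ht
    have hTX' : ∀ x ∈ T.support, x ∉ Xᶜ := fun x hx h => h (hTX x hx)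
    have s₁ : graphSize (delEdgesAt H X) < graphSize H :=
      graphSize_lt_of_le (delEdgesAt_le _ _) (T.adj_snd hT.not_nil) (fun h => h.2.1 ht)
    have s₂ : graphSize (delEdgesAt H Xᶜ) < graphSize H :=
      graphSize_lt_of_le (delEdgesAt_le _ _) (C.adj_snd hC.1.not_nil) (fun h => h.2.1 hvX)
    have hap₁ := hap.mono (delEdgesAt_le H X)
    have hap₂ := hap.mono (delEdgesAt_le H Xᶜ)
    obtain ⟨c₁, hc₁, hc₁C⟩ := ih (c₀ := c₀) (by omega) (hpl.mono (delEdgesAt_le H X)) hap₁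
      (hC.transfer (delEdgesAt_le H X) (walk_edges_delEdgesAt C hCX)) (by simpa)
      (by simpa using hc₀.anti (delEdgesAt_le H X)) (by omega)
    obtain ⟨c₂, hc₂, -⟩ := ih (by omega) (hpl.mono (delEdgesAt_le H Xᶜ)) hap₂
      (IsGoodCycle.of_length_ne (hT.transfer (walk_edges_delEdgesAt T hTX'))
        (by rw [Walk.length_transfer]; omega)) (by rw [Walk.length_transfer]; omega)
      (hap₂.ifColoringOn_cycle (hT.transfer (walk_edges_delEdgesAt T hTX'))
        (by rwa [Walk.length_transfer])) (by omega)
    refine ⟨fun u => if u ∈ X then c₂ u else c₁ u, ⟨⟨fun a b hab => ?_, fun a w hw hF => ?_⟩,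
      fun a b p ⟨hp, hF, ha, hb, hpl, hQ⟩ => ?_⟩, fun x hx => ?_⟩
    · by_cases ha : a ∈ X
      · have hb := hXc a ha b hab
        simp only [ha, hb, if_true]
        exact hc₂.1.1 ⟨hab, fun h => h ha, fun h => h hb⟩
      · have hb := hXc' a ha b hab
        simp only [ha, show b ∉ X from hb, if_false]
        exact hc₁.1.1 ⟨hab, ha, hb⟩
    · by_cases ha : a ∈ X
      · have hwX := walk_support_subset_of_closed hXc w ha
        have hwX' : ∀ x ∈ w.support, x ∉ Xᶜ := fun x hx h => h (hwX x hx)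
        refine hc₂.1.2 a _ (hw.transfer (walk_edges_delEdgesAt w hwX')) fun x hx => ?_
        rw [Walk.support_transfer] at hx
        simpa [hwX x hx] using hF x hx
      · have hwX := walk_support_subset_of_closed hXc' w ha
        refine hc₁.1.2 a _ (hw.transfer (walk_edges_delEdgesAt w hwX)) fun x hx => ?_
        rw [Walk.support_transfer] at hx
        simpa [show x ∉ X from hwX x hx] using hF x hx
    · have hwX := walk_support_subset_of_closed hXc' p (hCX a ha)
      refine hc₁.2 a b (p.transfer _ (walk_edges_delEdgesAt p hwX))
        ⟨hp.transfer _, fun x hx => ?_, by simpa using ha, by simpa using hb, by simpa, ?_⟩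
      · rw [Walk.support_transfer] at hx
        simpa [show x ∉ X from hwX x hx] using hF x hx
      · simpa using hQ
    · simp only [show x ∉ X from hCX x hx, if_false]
      exact hc₁C x (by simpa)

/-- In a minimal counterexample no nonempty part is separated from the outer cycle by a short
good cycle. -/
theorem ExtendsBelow.not_separated [Fintype V] {G : SimpleGraph V} (hM : ExtendsBelow (graphSize G))
    {v₀ : V} {C₀ : G.Walk v₀ v₀} {φ₀ : V → Bool} (hcex : IsCounterexample G C₀ φ₀)
    {k : V} {K : G.Walk k k} (hK : IsGoodCycle G K) (hKl : K.length ≤ 9) {X : Set V}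
    (hXK : ∀ x ∈ K.support, x ∉ X) (hX : ∀ u ∈ X, ∀ v, G.Adj u v → v ∉ X → v ∈ K.support)
    (hC₀X : ∀ x ∈ C₀.support, x ∉ X) (hXe : ∃ u ∈ X, ∃ v, G.Adj u v)
    (hout : ∃ u v, G.Adj u v ∧ u ∉ X ∧ u ∉ K.support) : False := by
  classical
  obtain ⟨hpl, hap, hC₀, hC₀l, hφ₀, hext⟩ := hcex
  replace hap := hap.shortApart
  set Y : Set V := {u | u ∉ X ∧ u ∉ K.support} with hY
  have hA : delEdgesAt G X ≤ G := delEdgesAt_le G X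
  have hB : delEdgesAt G Y ≤ G := delEdgesAt_le G Y
  have hKY : ∀ x ∈ K.support, x ∉ Y := fun x hx h => h.2 hx
  have hXY : ∀ x ∈ X, x ∉ Y := fun x hx h => h.1 hx
  obtain ⟨c₁, ⟨hc₁, hs₁⟩, hφ⟩ := hM.extendsToSuper _ le_rfl (hpl.mono hA) (hap.mono hA)
    (hC₀.transfer hA (walk_edges_delEdgesAt C₀ hC₀X)) (by simpa)
    (by simpa using hφ₀.anti hA) (by
      obtain ⟨u, hu, v, huv⟩ := hXe
      exact graphSize_lt_of_le hA huv fun h => h.2.1 hu)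
  obtain ⟨c₂, ⟨hc₂, hs₂⟩, hK₂⟩ := hM.extendsToSuper (c₀ := c₁) _ le_rfl (hpl.mono hB) (hap.mono hB)
    (hK.transfer hB (walk_edges_delEdgesAt K hKY)) (by simpa) (by
      refine ⟨fun u v hu hv huv => ?_, fun v w hw hwK hF => ?_⟩
      · simp only [Walk.support_transfer, Set.mem_ofPred_eq] at hu hv
        exact hc₁.1 ⟨huv.1, hXK u hu, hXK v hv⟩
      · simp only [Walk.support_transfer, Set.mem_ofPred_eq] at hwK
        have := hw.mapLe hB
        refine hc₁.2 v ((w.mapLe hB).transfer _ (walk_edges_delEdgesAt (X := X) _ ?_))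
          (this.transfer _) ?_
        · simpa using fun x hx => hXK x (hwK x hx)
        · simpa using hF) (by
      obtain ⟨u, v, huv, hu⟩ := hout
      exact graphSize_lt_of_le hB huv fun h => h.2.1 hu)
  simp only [Walk.support_transfer] at hφ hs₁ hs₂ hK₂
  set c : V → Bool := fun u => if u ∈ X then c₂ u else c₁ u with hc
  have cX : ∀ u ∉ X, c u = c₁ u := fun u hu => by simp [hc, hu]
  have cY : ∀ u ∉ Y, c u = c₂ u := fun u hu => by
    by_cases huX : u ∈ X
    · simp [hc, huX]
    · have : u ∈ K.support := by
        by_contra h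
        exact hu ⟨huX, h⟩
      simp [hc, huX, hK₂ u this]
  have hpath : ∀ {s t : V} (p : G.Walk s t), p.IsPath → (∀ x ∈ p.support, c x = false) →
      s ∉ X → t ∉ X → ∀ x ∈ p.support, x ∉ X := by
    intro s t p hp hF hs ht x hx hxX
    obtain ⟨a, b, q, hq, hsub, ha, hb, -, -, hl, hint, he⟩ :=
      exists_excursion (K := {x | x ∈ K.support}) hX p hp hs ht ⟨x, hx, hxX⟩
    have hqY : ∀ x ∈ q.support, x ∉ Y := by
      intro x hx
      by_cases h1 : x = a
      · exact h1 ▸ hKY a ha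
      by_cases h2 : x = b
      · exact h2 ▸ hKY b hb
      exact hXY x (hint x hx h1 h2)
    refine hs₂ a b (q.transfer _ (walk_edges_delEdgesAt q hqY)) ⟨hq.transfer _, ?_, ha, hb, ?_, ?_⟩
    · intro x hx
      rw [Walk.support_transfer] at hx
      rw [← cY x (hqY x hx)]
      exact hF x (hsub hx)
    · simpa
    · intro x hx h1 h2 hxK
      rw [Walk.support_transfer] at hx
      exact hXK x hxK (hint x hx h1 h2)
  refine hext ⟨c, ⟨⟨fun u v huv => ?_, fun v w hw hF => ?_⟩,
    fun a b p ⟨hp, hF, ha, hb, hl, hQ⟩ => ?_⟩, fun x hx => (cX x (hC₀X x hx)).trans (hφ x hx)⟩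
  · by_cases hu : u ∈ X
    · have hv : v ∉ Y := fun h => h.2 (hX u hu v huv h.1)
      rw [cY u (hXY u hu), cY v hv]
      exact hc₂.1 ⟨huv, hXY u hu, hv⟩
    by_cases hv : v ∈ X
    · have hu' : u ∉ Y := fun h => h.2 (hX v hv u huv.symm h.1)
      rw [cY v (hXY v hv), cY u hu']
      exact hc₂.1 ⟨huv, hu', hXY v hv⟩
    · rw [cX u hu, cX v hv]
      exact hc₁.1 ⟨huv, hu, hv⟩
  · by_cases hall : ∀ x ∈ w.support, x ∉ Y
    · refine hc₂.2 v _ (hw.transfer (walk_edges_delEdgesAt w hall)) fun x hx => ?_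
      rw [Walk.support_transfer] at hx
      rw [← cY x (hall x hx)]
      exact hF x hx
    push Not at hall
    obtain ⟨s, hs, hsY⟩ := hall
    obtain ⟨w', hw', hF'⟩ : ∃ w' : G.Walk s s, w'.IsCycle ∧ ∀ x ∈ w'.support, c x = false :=
      ⟨_, hw.rotate hs, fun x hx => hF x ((w.mem_support_rotate_iff s hs).1 hx)⟩
    have hw'X : ∀ x ∈ w'.support, x ∉ X := by
      cases w' with
      | nil => exact absurd .nil hw'.not_nil
      | @cons _ s' _ h p =>
        rw [Walk.cons_isCycle_iff] at hw'
        have hs' : s' ∉ X := fun hs' => hsY.2 (hX s' hs' s h.symm hsY.1)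
        have := hpath p hw'.1 (fun x hx => hF' x (List.mem_cons_of_mem _ hx)) hs' hsY.1
        intro x hx
        rw [Walk.support_cons, List.mem_cons] at hx
        rcases hx with rfl | hx
        exacts [hsY.1, this x hx]
    refine hc₁.2 s _ (hw'.transfer (walk_edges_delEdgesAt w' hw'X)) fun x hx => ?_
    rw [Walk.support_transfer] at hx
    rw [← cX x (hw'X x hx)]
    exact hF' x hx
  · have hpX := hpath p hp hF (hC₀X a ha) (hC₀X b hb)
    refine hs₁ a b (p.transfer _ (walk_edges_delEdgesAt p hpX)) ⟨hp.transfer _, ?_, ha, hb, ?_, ?_⟩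
    · intro x hx
      rw [Walk.support_transfer] at hx
      rw [← cX x (hpX x hx)]
      exact hF x hx
    · simpa
    · simpa using hQ

/-- The positions `i` and `j` on a `9`-cycle are at distance at most `d` along the cycle. -/
def NearOnNine (d i j : ℕ) : Prop := ∃ e < d + 1, (i + e) % 9 = j ∨ (j + e) % 9 = i

instance (d i j : ℕ) : Decidable (NearOnNine d i j) := by
  unfold NearOnNine
  infer_instance

theorem nearOnNine_three_or : ∀ i j l : Fin 9, (i : ℕ) ≠ j → (i : ℕ) ≠ l → (j : ℕ) ≠ l →
    (NearOnNine 3 i j ∧ NearOnNine 3 i l) ∨ (NearOnNine 3 j i ∧ NearOnNine 3 j l) ∨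
    (NearOnNine 3 l i ∧ NearOnNine 3 l j) ∨
    ∃ t : Fin 9, ((t : ℕ) = i ∨ (t : ℕ) = j ∨ (t : ℕ) = l) ∧
      ((t + 1 : ℕ) % 9 = i ∨ (t + 1 : ℕ) % 9 = j ∨ (t + 1 : ℕ) % 9 = l) ∧
      ((t + 5 : ℕ) % 9 = i ∨ (t + 5 : ℕ) % 9 = j ∨ (t + 5 : ℕ) % 9 = l) := by
  decide +kernel

theorem nearOnNine_two_or : ∀ i j l : Fin 9, (i : ℕ) ≠ j → (i : ℕ) ≠ l → (j : ℕ) ≠ l →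
    NearOnNine 2 i j ∨ NearOnNine 2 i l ∨ NearOnNine 2 j l ∨ (i : ℕ) < 3 ∨ (j : ℕ) < 3 ∨
    (l : ℕ) < 3 := by
  decide +kernel

theorem nearOnNine_one_of : ∀ i j l : Fin 9, (i : ℕ) ≠ j →
    ¬ NearOnNine 3 i l → ¬ NearOnNine 3 j l → NearOnNine 1 i j := by
  decide +kernel

section

variable {H : SimpleGraph V} {v : V} {C : H.Walk v v}

theorem cyc_congr (C : H.Walk v v) {i j : ℕ} (h : i % C.length = j % C.length) :
    cyc C i = cyc C j := by
  simp [cyc, h]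

theorem NearOnNine.exists_walk (hC : C.IsCycle) (h9 : C.length = 9) {d i j : ℕ}
    (h : NearOnNine d i j) :
    ∃ p : H.Walk (cyc C i) (cyc C j), p.length ≤ d ∧ ∀ e ∈ p.edges, e ∈ C.edges := by
  obtain ⟨e, he, h | h⟩ := h
  · obtain ⟨p, hp, hpe⟩ := exists_cyc_walk hC i e
    have : cyc C (i + e) = cyc C j := cyc_congr C (by rw [h9]; omega)
    exact ⟨p.copy rfl this, by simp; omega, by simpa using hpe⟩
  · obtain ⟨p, hp, hpe⟩ := exists_cyc_walk hC j e
    have : cyc C (j + e) = cyc C i := cyc_congr C (by rw [h9]; omega)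
    exact ⟨(p.copy rfl this).reverse, by simp; omega, by simpa using hpe⟩

theorem ShortApart.not_near_legs (hap : ShortApart H) {x a b c : V} (hx : x ∉ C.support)
    (hab : a ≠ b) (hac : a ≠ c) (hbc : b ≠ c) (ha : H.Adj x a) (hb : H.Adj x b)
    (hc : H.Adj x c) {p : H.Walk a b} (hp : p.length ≤ 3) (hpC : ∀ e ∈ p.edges, e ∈ C.edges)
    {q : H.Walk a c} (hq : q.length ≤ 3) (hqC : ∀ e ∈ q.edges, e ∈ C.edges) : False := by
  have hxe : ∀ y, s(x, y) ∉ C.edges := fun y h => hx (C.fst_mem_support_of_mem_edges h)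
  have key := hap.three_le hb (p := .cons ha p) (p' := .cons ha q) ?_
    (by rw [Walk.length_cons]; omega) hc ?_ (by rw [Walk.length_cons]; omega)
    ?_ ?_ .nil
  · simp at key
  · rw [Walk.edges_cons, List.mem_cons, Sym2.congr_right]
    exact fun h => h.elim (fun h => hab h.symm) (fun h => hxe _ (hpC _ h))
  · rw [Walk.edges_cons, List.mem_cons, Sym2.congr_right]
    exact fun h => h.elim (fun h => hac h.symm) (fun h => hxe _ (hqC _ h))
  · rw [Ne, Sym2.congr_right]
    exact hbc.symm
  · rw [Walk.edges_cons, List.mem_cons, Sym2.congr_right]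
    exact fun h => h.elim (fun h => hac h.symm) (fun h => hxe _ (hpC _ h))

/-- The legs of a claw of a `9`-cycle split it into arcs of lengths `1`, `4` and `4`. -/
theorem ShortApart.claw_legs (hap : ShortApart H) (hC : C.IsCycle) (h9 : C.length = 9) {x a b c : V}
    (hx : x ∉ C.support) (ha : a ∈ C.support) (hb : b ∈ C.support) (hc : c ∈ C.support)
    (hab : a ≠ b) (hac : a ≠ c) (hbc : b ≠ c) (h1 : H.Adj x a) (h2 : H.Adj x b)
    (h3 : H.Adj x c) :
    ∃ t < 9, H.Adj x (cyc C t) ∧ H.Adj x (cyc C (t + 1)) ∧ H.Adj x (cyc C (t + 5)) := by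
  obtain ⟨i, hi, rfl⟩ := exists_cyc_eq hC ha
  obtain ⟨j, hj, rfl⟩ := exists_cyc_eq hC hb
  obtain ⟨l, hl, rfl⟩ := exists_cyc_eq hC hc
  rw [h9] at hi hj hl
  have hij : i ≠ j := fun h => hab (h ▸ rfl)
  have hil : i ≠ l := fun h => hac (h ▸ rfl)
  have hjl : j ≠ l := fun h => hbc (h ▸ rfl)
  rcases nearOnNine_three_or ⟨i, hi⟩ ⟨j, hj⟩ ⟨l, hl⟩ hij hil hjl with
    h | h | h | ⟨⟨t, ht⟩, h, h', h''⟩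
  · obtain ⟨p, hp, hpe⟩ := h.1.exists_walk hC h9
    obtain ⟨q, hq, hqe⟩ := h.2.exists_walk hC h9
    exact (hap.not_near_legs hx hab hac hbc h1 h2 h3 hp hpe hq hqe).elim
  · obtain ⟨p, hp, hpe⟩ := h.1.exists_walk hC h9
    obtain ⟨q, hq, hqe⟩ := h.2.exists_walk hC h9
    exact (hap.not_near_legs hx hab.symm hbc hac h2 h1 h3 hp hpe hq hqe).elim
  · obtain ⟨p, hp, hpe⟩ := h.1.exists_walk hC h9
    obtain ⟨q, hq, hqe⟩ := h.2.exists_walk hC h9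
    exact (hap.not_near_legs hx hac.symm hbc.symm hab h3 h1 h2 hp hpe hq hqe).elim
  · have key : ∀ s, s % 9 = i ∨ s % 9 = j ∨ s % 9 = l → H.Adj x (cyc C s) := by
      intro s hs
      rw [show cyc C s = cyc C (s % 9) from cyc_congr C (by rw [h9, Nat.mod_mod])]
      rcases hs with hs | hs | hs <;> rw [hs] <;> assumption
    exact ⟨t, ht, key t (by rwa [Nat.mod_eq_of_lt ht]), key _ h', key _ h''⟩

theorem ShortApart.not_near_triangle_legs (hap : ShortApart H) {x y z a b : V} (hx : x ∉ C.support)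
    (hy : y ∉ C.support) (hz : z ∉ C.support) (ha : a ∈ C.support)
    (hxy : H.Adj x y) (hyz : H.Adj y z) (hxz : H.Adj x z) (hxa : H.Adj x a) (hyb : H.Adj y b)
    {p : H.Walk b a} (hp : p.length ≤ 2) (hpC : ∀ e ∈ p.edges, e ∈ C.edges) : False := by
  have hxe : ∀ y, s(x, y) ∉ C.edges := fun y h => hx (C.fst_mem_support_of_mem_edges h)
  have hay : a ≠ y := fun h => hy (h ▸ ha)
  have haz : a ≠ z := fun h => hz (h ▸ ha)
  have key := hap.three_le hxy (p := .cons hxz (.cons hyz.symm .nil))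
    (p' := .cons hxy (.cons hyb p)) ?_ (by simp) hxa ?_
    (by rw [Walk.length_cons, Walk.length_cons]; omega) ?_ ?_ .nil
  · simp at key
  · simp [hyz.ne, hxz.ne, hxy.ne]
  · rw [Walk.edges_cons, List.mem_cons, Walk.edges_cons, List.mem_cons, Sym2.congr_right]
    rintro (h | h | h)
    · exact hay h
    · rcases Sym2.eq_iff.1 h with h | h
      exacts [hxy.ne h.1, hay h.2]
    · exact hxe _ (hpC _ h)
  · rw [Ne, Sym2.congr_right]
    exact hay
  · simp [haz, hxz.ne, hay]

/-- One of the legs of a triclaw of a `9`-cycle ends at one of the first three vertices. -/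
theorem ShortApart.triclaw_legs (hap : ShortApart H) (hC : C.IsCycle) (h9 : C.length = 9)
    {x y z a b c : V} (hx : x ∉ C.support) (hy : y ∉ C.support) (hz : z ∉ C.support)
    (hxy : H.Adj x y) (hyz : H.Adj y z) (hxz : H.Adj x z)
    (ha : a ∈ C.support) (hb : b ∈ C.support) (hc : c ∈ C.support)
    (hab : a ≠ b) (hac : a ≠ c) (hbc : b ≠ c) (h1 : H.Adj x a) (h2 : H.Adj y b)
    (h3 : H.Adj z c) :
    ∃ t < 3, a = cyc C t ∨ b = cyc C t ∨ c = cyc C t := by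
  obtain ⟨i, hi, rfl⟩ := exists_cyc_eq hC ha
  obtain ⟨j, hj, rfl⟩ := exists_cyc_eq hC hb
  obtain ⟨l, hl, rfl⟩ := exists_cyc_eq hC hc
  rw [h9] at hi hj hl
  have hij : i ≠ j := fun h => hab (h ▸ rfl)
  have hil : i ≠ l := fun h => hac (h ▸ rfl)
  have hjl : j ≠ l := fun h => hbc (h ▸ rfl)
  rcases nearOnNine_two_or ⟨i, hi⟩ ⟨j, hj⟩ ⟨l, hl⟩ hij hil hjl with
    h | h | h | h | h | h
  · obtain ⟨p, hp, hpe⟩ := h.exists_walk hC h9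
    exact (hap.not_near_triangle_legs hy hx hz hb hxy.symm hxz hyz h2 h1 hp hpe).elim
  · obtain ⟨p, hp, hpe⟩ := h.exists_walk hC h9
    exact (hap.not_near_triangle_legs hz hx hy hc hxz.symm hxy hyz.symm h3 h1 hp
      hpe).elim
  · obtain ⟨p, hp, hpe⟩ := h.exists_walk hC h9
    exact (hap.not_near_triangle_legs hz hy hx hc hyz.symm hxy.symm hxz.symm h3 h2 hp
      hpe).elim
  exacts [⟨i, h, Or.inl rfl⟩, ⟨j, h, Or.inr (Or.inl rfl)⟩, ⟨l, h, Or.inr (Or.inr rfl)⟩]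

end

/-- Adjacency in the union of the cycles `1 2 3 4 5 6` and `1 6 7 … m`. -/
def ThetaAdj (m i j : ℕ) : Prop :=
  (1 ≤ i ∧ i ≤ m ∧ 1 ≤ j ∧ j ≤ m) ∧
    (i + 1 = j ∨ j + 1 = i ∨ (i = 1 ∧ j = 6) ∨ (i = 6 ∧ j = 1) ∨ (i = 1 ∧ j = m) ∨ (i = m ∧ j = 1))

instance (m i j : ℕ) : Decidable (ThetaAdj m i j) := by
  unfold ThetaAdj
  infer_instance

theorem ThetaAdj.symm {m i j : ℕ} (h : ThetaAdj m i j) : ThetaAdj m j i := by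
  unfold ThetaAdj at *
  omega

/-- The index `i` belongs to the cycle `1 6 7 … m`. -/
def OnFace (m i : ℕ) : Prop := i = 1 ∨ 6 ≤ i ∧ i ≤ m

/-- Two adjacent cycles `x 1, …, x 6` and `x 1, x 6, …, x m` such that every other short cycle is
far from the second one. -/
structure ThetaConfig (G : SimpleGraph V) (m : ℕ) (x : ℕ → V) : Prop where
  seven_le : 7 ≤ m
  le_nine : m ≤ 9
  inj : Set.InjOn x (Set.Icc 1 m)
  adj : ∀ {i j}, ThetaAdj m i j → G.Adj (x i) (x j)
  apart : ShortApart G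
  far : ∀ ⦃u v⦄, G.Adj u v →
    (∀ i j, OnFace m i → OnFace m j → ThetaAdj m i j → s(u, v) ≠ s(x i, x j)) →
    ∀ p : G.Walk u v, s(u, v) ∉ p.edges → p.length ≤ 4 →
    ∀ i, OnFace m i → ∀ q : G.Walk u (x i), 3 ≤ q.length

namespace ThetaConfig

variable {G : SimpleGraph V} {m : ℕ} {x : ℕ → V} (h : ThetaConfig G m x)

include h

theorem eq_of_eq {i j : ℕ} (hi : 1 ≤ i ∧ i ≤ m) (hj : 1 ≤ j ∧ j ≤ m) (hij : x i = x j) : i = j :=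
  h.inj hi hj hij

theorem exists_walk_up {i : ℕ} (hi : 1 ≤ i) (d : ℕ) (hd : i + d ≤ m) :
    ∃ p : G.Walk (x i) (x (i + d)), p.length = d ∧
      ∀ e ∈ p.edges, ∃ a b, ThetaAdj m a b ∧ e = s(x a, x b) := by
  induction d with
  | zero => exact ⟨.nil, rfl, by simp⟩
  | succ d ih =>
    obtain ⟨p, hp, hpe⟩ := ih (by omega)
    have ht : ThetaAdj m (i + d) (i + d + 1) := by
      unfold ThetaAdj
      omega
    refine ⟨p.concat (h.adj ht), by simp [hp], fun e he => ?_⟩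
    rw [Walk.edges_concat, List.concat_eq_append, List.mem_append, List.mem_singleton] at he
    rcases he with he | rfl
    · exact hpe e he
    · exact ⟨_, _, ht, rfl⟩

theorem exists_walk {i j : ℕ} (hi : 1 ≤ i ∧ i ≤ m) (hj : 1 ≤ j ∧ j ≤ m) :
    ∃ p : G.Walk (x i) (x j), p.length ≤ 4 ∧
      ∀ e ∈ p.edges, ∃ a b, ThetaAdj m a b ∧ e = s(x a, x b) := by
  have h7 := h.seven_le
  have h9 := h.le_nine
  have key : ∀ i j, 1 ≤ i → i ≤ j → j ≤ m → ∃ p : G.Walk (x i) (x j), p.length ≤ 4 ∧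
      ∀ e ∈ p.edges, ∃ a b, ThetaAdj m a b ∧ e = s(x a, x b) := by
    intro i j hi hij hj
    by_cases hd : j ≤ i + 4
    · have hex := h.exists_walk_up hi (j - i) (by omega)
      rw [Nat.add_sub_cancel' hij] at hex
      obtain ⟨p, hp, hpe⟩ := hex
      exact ⟨p, by omega, hpe⟩
    · have hex := h.exists_walk_up (i := 1) le_rfl (i - 1) (by omega)
      rw [Nat.add_sub_cancel' hi] at hex
      obtain ⟨p, hp, hpe⟩ := hex
      have hex := h.exists_walk_up (i := j) (by omega) (m - j) (by omega)
      rw [Nat.add_sub_cancel' hj] at hex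
      obtain ⟨q, hq, hqe⟩ := hex
      have ht : ThetaAdj m 1 m := by
        unfold ThetaAdj
        omega
      refine ⟨p.reverse.append (.cons (h.adj ht) q.reverse), by simp; omega, fun e he => ?_⟩
      simp only [Walk.edges_append, Walk.edges_cons, Walk.edges_reverse, List.mem_append,
        List.mem_reverse, List.mem_cons] at he
      rcases he with he | rfl | he
      exacts [hpe e he, ⟨_, _, ht, rfl⟩, hqe e he]
  rcases le_total i j with hij | hij
  · exact key i j hi.1 hij hj.2
  · obtain ⟨p, hp, hpe⟩ := key j i hj.1 hij hi.2
    exact ⟨p.reverse, by simpa, by simpa using hpe⟩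

theorem exists_walk_face {i : ℕ} (hi : 1 ≤ i ∧ i ≤ m) :
    ∃ j, OnFace m j ∧ ∃ p : G.Walk (x i) (x j), p.length ≤ 2 := by
  have h7 := h.seven_le
  have h9 := h.le_nine
  have e : ∀ {a b}, ThetaAdj m a b → G.Adj (x a) (x b) := h.adj
  by_cases hf : OnFace m i
  · exact ⟨i, hf, .nil, by simp⟩
  have h1 : OnFace m 1 := Or.inl rfl
  have h6 : OnFace m 6 := Or.inr (by omega)
  have : i = 2 ∨ i = 3 ∨ i = 4 ∨ i = 5 := by
    unfold OnFace at hf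
    omega
  have e12 : ThetaAdj m 2 1 := by unfold ThetaAdj; omega
  have e23 : ThetaAdj m 3 2 := by unfold ThetaAdj; omega
  have e45 : ThetaAdj m 4 5 := by unfold ThetaAdj; omega
  have e56 : ThetaAdj m 5 6 := by unfold ThetaAdj; omega
  rcases this with rfl | rfl | rfl | rfl
  · exact ⟨1, h1, .cons (e e12) .nil, by simp⟩
  · exact ⟨1, h1, .cons (e e23) (.cons (e e12) .nil), by simp⟩
  · exact ⟨6, h6, .cons (e e45) (.cons (e e56) .nil), by simp⟩
  · exact ⟨6, h6, .cons (e e56) .nil, by simp⟩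

theorem adj_iff {i j : ℕ} (hi : 1 ≤ i ∧ i ≤ m) (hj : 1 ≤ j ∧ j ≤ m) :
    G.Adj (x i) (x j) ↔ ThetaAdj m i j := by
  refine ⟨fun hij => ?_, h.adj⟩
  by_contra ht
  have hne : ∀ a b, ThetaAdj m a b → s(x i, x j) ≠ s(x a, x b) := by
    intro a b hab he
    rcases Sym2.eq_iff.1 he with ⟨h1, h2⟩ | ⟨h1, h2⟩
    · rw [h.eq_of_eq hi ⟨hab.1.1, hab.1.2.1⟩ h1, h.eq_of_eq hj ⟨hab.1.2.2.1, hab.1.2.2.2⟩ h2] at ht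
      exact ht hab
    · rw [h.eq_of_eq hi ⟨hab.1.2.2.1, hab.1.2.2.2⟩ h1, h.eq_of_eq hj ⟨hab.1.1, hab.1.2.1⟩ h2] at ht
      exact ht hab.symm
  obtain ⟨p, hp, hpe⟩ := h.exists_walk hi hj
  obtain ⟨l, hl, q, hq⟩ := h.exists_walk_face hi
  have := h.far hij (fun a b _ _ => hne a b) p
    (fun he => let ⟨a, b, hab, he⟩ := hpe _ he; hne a b hab he) hp l hl q
  omega

/-- No triangle with a vertex off the short face is close to that face. -/
theorem no_triangle {a b c : V} (hab : G.Adj a b) (hbc : G.Adj b c) (hac : G.Adj a c)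
    {i : ℕ} (hi : OnFace m i) (q : G.Walk a (x i)) (hq : q.length ≤ 2)
    (hoff : ∃ u, (u = a ∨ u = b ∨ u = c) ∧ ∀ j, OnFace m j → u ≠ x j) : False := by
  have key : ∀ b c, G.Adj a b → G.Adj b c → G.Adj a c →
      (∃ u, (u = a ∨ u = b) ∧ ∀ j, OnFace m j → u ≠ x j) → False := by
    rintro b c hab hbc hac ⟨u, hu, hoff⟩
    have := h.far hab ?_ (.cons hac (.cons hbc.symm .nil)) ?_ (by simp) i hi q
    · omega
    · intro k j hk hj _ he
      have hmem : u ∈ s(a, b) := Sym2.mem_iff.2 hu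
      rw [he, Sym2.mem_iff] at hmem
      exact hmem.elim (hoff k hk) (hoff j hj)
    · simp [hab.ne, hac.ne, hbc.ne]
  obtain ⟨u, rfl | rfl | rfl, hoff⟩ := hoff
  · exact key b c hab hbc hac ⟨_, Or.inl rfl, hoff⟩
  · exact key u c hab hbc hac ⟨_, Or.inr rfl, hoff⟩
  · exact key u b hac hbc.symm hab ⟨_, Or.inr rfl, hoff⟩

end ThetaConfig

theorem notMem_of_reachable_delEdgesAt {A : SimpleGraph V} {X : Set V} {s t : V}
    (h : (delEdgesAt A X).Reachable s t) (hs : s ∉ X) : t ∉ X := by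
  obtain ⟨p⟩ := h
  exact walk_support_subset_of_closed (H := delEdgesAt A X) (X := Xᶜ) (fun u _ v huv => huv.2.2)
    p hs t p.end_mem_support

theorem reachable_delEdgesAt_of_adj {A : SimpleGraph V} {X : Set V} {s u v : V}
    (h : (delEdgesAt A X).Reachable s u) (hs : s ∉ X) (huv : A.Adj u v) (hv : v ∉ X) :
    (delEdgesAt A X).Reachable s v :=
  h.trans (SimpleGraph.Adj.reachable ⟨huv, notMem_of_reachable_delEdgesAt h hs, hv⟩)

theorem walkConnected_reachable_delEdgesAt {A : SimpleGraph V} {X : Set V} {s : V} :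
    WalkConnected A {u | (delEdgesAt A X).Reachable s u} := by
  rintro u hu v ⟨q⟩
  obtain ⟨p⟩ := hu.symm
  refine ⟨(p.append q).mapLe (delEdgesAt_le A X), fun x hx => ?_⟩
  rw [Walk.support_mapLe_eq_support] at hx
  exact walk_support_subset_of_closed (X := {u | (delEdgesAt A X).Reachable s u})
    (fun u hu v huv => hu.trans huv.reachable) (p.append q) hu x hx

theorem walkConnected_support {A : SimpleGraph V} {a b : V} (p : A.Walk a b) :
    WalkConnected A {x | x ∈ p.support} := by
  classical
  intro u hu v hv
  refine ⟨(p.takeUntil u hu).reverse.append (p.takeUntil v hv), fun x hx => ?_⟩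
  rw [Walk.mem_support_append_iff, Walk.support_reverse, List.mem_reverse] at hx
  exact hx.elim (fun h => p.support_takeUntil_subset_support hu h)
    (fun h => p.support_takeUntil_subset_support hv h)

/-- A component that remains after deleting a set meets the boundary of every further set
containing one of its vertices. -/
theorem exists_adj_of_reachable_delEdgesAt {A : SimpleGraph V} {K L J : Set V} {s t : V}
    (hr : (delEdgesAt A K).Reachable s t) (hs : s ∉ J) (hJ : J ⊆ K ∪ L)
    (htJ : t ∈ J) :
    ∃ u, (delEdgesAt A J).Reachable s u ∧ ∃ v ∈ L, A.Adj u v := by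
  by_contra hno
  push Not at hno
  obtain ⟨p⟩ := hr
  have := walk_support_subset_of_closed (H := delEdgesAt A K)
    (X := {u | (delEdgesAt A J).Reachable s u})
    (fun u hu v huv => reachable_delEdgesAt_of_adj hu hs huv.1 (fun hv =>
      (hJ hv).elim huv.2.2 (fun hvL => hno u hu v hvL huv.1))) p (Reachable.refl _) t
      p.end_mem_support
  exact notMem_of_reachable_delEdgesAt this hs htJ

/-- In a minimal counterexample, deleting a short good cycle does not separate two vertices from
each other once the vertices of the outer cycle are joined to a new vertex. -/
theorem ExtendsBelow.reachable_addApex [Fintype V] {G : SimpleGraph V}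
    (hM : ExtendsBelow (graphSize G)) {v₀ : V} {C₀ : G.Walk v₀ v₀} {φ₀ : V → Bool}
    (hcex : IsCounterexample G C₀ φ₀) {k : V} {K : G.Walk k k} (hK : IsGoodCycle G K)
    (hKl : K.length ≤ 9) {s t : V} (hs : s ∉ K.support) (ht : t ∉ K.support)
    (hse : ∃ v, G.Adj s v) (hte : ∃ v, G.Adj t v) :
    (delEdgesAt (addApex G {x | x ∈ C₀.support}) (some '' {x | x ∈ K.support})).Reachable
      (some s) (some t) := by
  set D := delEdgesAt (addApex G {x | x ∈ C₀.support}) (some '' {x | x ∈ K.support}) with hD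
  have hmem : ∀ {u}, u ∉ K.support → some u ∉ some '' {x | x ∈ K.support} := by
    rintro u hu ⟨v, hv, hvu⟩
    exact hu (Option.some.inj hvu ▸ hv)
  have key : ∀ s t, s ∉ K.support → t ∉ K.support → (∃ v, G.Adj s v) → (∃ v, G.Adj t v) →
      ¬ D.Reachable (some s) none → ¬ D.Reachable (some s) (some t) → False := by
    intro s t hs ht hse hte hn hst
    have hX : ∀ u, D.Reachable (some s) (some u) → u ∉ K.support := fun u hu huK =>
      notMem_of_reachable_delEdgesAt hu (hmem hs) ⟨u, huK, rfl⟩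
    refine hM.not_separated hcex hK hKl (X := {u | D.Reachable (some s) (some u)})
      (fun x hx h => hX x h hx) (fun u hu v huv hv => ?_) (fun x hx h => hn ?_)
      ⟨s, Reachable.refl _, hse⟩ (let ⟨v, hv⟩ := hte; ⟨t, v, hv, hst, ht⟩)
    · by_contra hvK
      exact hv (reachable_delEdgesAt_of_adj hu (hmem hs) (by exact huv) (hmem hvK))
    · exact reachable_delEdgesAt_of_adj h (hmem hs) (by exact hx) (by simp)
  by_contra hst
  by_cases hn : D.Reachable (some s) none
  · exact key t s ht hs hte hse (fun h => hst (hn.trans h.symm)) (fun h => hst h.symm)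
  · exact key s t hs ht hse hte hn hst

/-- The index of a vertex of the configuration with a neighbor outside. -/
def HasOut (m i : ℕ) : Prop := 3 ≤ i ∧ i ≤ m ∧ i ≠ 6

instance (m i : ℕ) : Decidable (HasOut m i) := by
  unfold HasOut
  infer_instance

/-- A configuration all of whose vertices except possibly `x 2` have degree `3`; the outer
neighbor of `x i` is `y i`. -/
structure OuterConfig (G : SimpleGraph V) (m : ℕ) (x y : ℕ → V) : Prop
    extends ThetaConfig G m x where
  nbr : ∀ {i u}, 1 ≤ i → i ≤ m → i ≠ 2 → G.Adj (x i) u →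
    (∃ j, ThetaAdj m i j ∧ u = x j) ∨ (HasOut m i ∧ u = y i)
  out_adj : ∀ {i}, HasOut m i → G.Adj (x i) (y i)
  out_ne : ∀ {i j}, HasOut m i → 1 ≤ j → j ≤ m → y i ≠ x j

/-- The vertices of a configuration. -/
def configSet (m : ℕ) (x : ℕ → V) : Set V := x '' Set.Icc 1 m

theorem mem_configSet {m : ℕ} (x : ℕ → V) {i : ℕ} (h1 : 1 ≤ i) (hm : i ≤ m) :
    x i ∈ configSet m x := ⟨i, ⟨h1, hm⟩, rfl⟩

theorem ne_of_notMem_configSet {m : ℕ} {x : ℕ → V} {u : V} (hu : u ∉ configSet m x) {i : ℕ}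
    (hi : OnFace m i) (h7 : 7 ≤ m) : u ≠ x i := by
  rintro rfl
  refine hu (mem_configSet x ?_ ?_) <;> unfold OnFace at hi <;> omega

namespace OuterConfig

variable {G : SimpleGraph V} {m : ℕ} {x y : ℕ → V} (h : OuterConfig G m x y)

include h

theorem hasOut_last : HasOut m m := by
  have := h.seven_le
  unfold HasOut
  omega

theorem thetaAdj : ThetaAdj m m 1 ∧ ThetaAdj m 1 2 ∧ ThetaAdj m 2 1 ∧ ThetaAdj m 1 6 := by
  have := h.seven_le
  unfold ThetaAdj
  omega

theorem out_notMem {i : ℕ} (hi : HasOut m i) : y i ∉ configSet m x := by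
  rintro ⟨j, ⟨hj, hjm⟩, he⟩
  exact h.out_ne hi hj hjm he.symm

theorem x_two_off : ∀ j, OnFace m j → x 2 ≠ x j := by
  intro j hj he
  have h7 := h.seven_le
  have := h.eq_of_eq (by omega) (by unfold OnFace at hj; omega) he
  unfold OnFace at hj
  omega

/-- A `9`-cycle through `x m`, `x 1`, `x 2` and otherwise off the configuration is good. -/
theorem isGoodCycle_of_cyc {k : V} {K : G.Walk k k} (hK : K.IsCycle) (h9 : K.length = 9)
    (h0 : cyc K 0 = x m) (h1 : cyc K 1 = x 1) (h2 : cyc K 2 = x 2)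
    (hoff : ∀ i, 3 ≤ i → i < 9 → cyc K i ∉ configSet m x) : IsGoodCycle G K := by
  have h7 := h.seven_le
  obtain ⟨am1, a12, a21, a16⟩ := h.thetaAdj
  have hoff' : ∀ i, 3 ≤ i → i < 9 → ∀ j, OnFace m j → cyc K i ≠ x j :=
    fun i h3 h9 j hj => ne_of_notMem_configSet (hoff i h3 h9) hj h7
  have f1 : OnFace m 1 := Or.inl rfl
  have fm : OnFace m m := Or.inr (by omega)
  have step := fun i => (cyc_step hK i).1
  have per : ∀ i, cyc K (i + 9) = cyc K i := fun i => by rw [← cyc_add_length K i, h9]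
  have e21 : G.Adj (x 2) (x 1) := h.adj a21
  have hK0 : x m ∈ K.support := h0 ▸ cyc_mem K 0
  have hK1 : x 1 ∈ K.support := h1 ▸ cyc_mem K 1
  have hK2 : x 2 ∈ K.support := h2 ▸ cyc_mem K 2
  have s23 : G.Adj (cyc K 3) (x 2) := h2 ▸ (step 2).symm
  have s80 : G.Adj (cyc K 8) (x m) := by
    have := step 8
    rwa [per 0, h0] at this
  refine ⟨hK, ?_⟩
  rintro ⟨-, -, hclaw | htri⟩
  · obtain ⟨v, hv, a, b, c, ha, hb, hc, hab, hac, hbc, va, vb, vc⟩ := hclaw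
    obtain ⟨t, ht, t0, t1, t5⟩ :=
      h.apart.claw_legs hK h9 hv ha hb hc hab hac hbc va vb vc
    interval_cases t
    · rw [zero_add, h1] at t1
      rcases h.nbr le_rfl (by omega) (by omega) t1.symm with ⟨j, hj, rfl⟩ | ⟨hj, -⟩
      · have : j = 6 := by
          have : j ≠ 2 := by rintro rfl; exact hv hK2
          have : j ≠ m := by rintro rfl; exact hv hK0
          unfold ThetaAdj at hj
          omega
        subst this
        rcases h.nbr (by omega) (by omega) (by omega) t5 with ⟨j, hj, he⟩ | ⟨hj, -⟩
        · exact hoff 5 (by omega) (by omega) (he ▸ mem_configSet x hj.1.2.2.1 hj.1.2.2.2)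
        · exact hj.2.2 rfl
      · exact absurd hj.1 (by omega)
    · rw [h1] at t0
      rw [h2] at t1
      exact h.no_triangle e21.symm t1.symm t0.symm f1 .nil (by simp) ⟨x 2, by simp, h.x_two_off⟩
    · rw [h2] at t0
      exact h.no_triangle s23.symm t1.symm t0.symm f1 (.cons e21 .nil) (by simp)
        ⟨x 2, by simp, h.x_two_off⟩
    · exact h.no_triangle (step 3) t1.symm t0.symm f1 (.cons s23 (.cons e21 .nil)) (by simp)
        ⟨_, by simp, hoff' 3 (by omega) (by omega)⟩
    · rw [per 0, h0] at t5
      exact h.no_triangle t0 (step 4) t1 fm (.cons t5 .nil) (by simp)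
        ⟨_, by simp, hoff' 4 (by omega) (by omega)⟩
    · rw [per 1, h1] at t5
      exact h.no_triangle t0 (step 5) t1 f1 (.cons t5 .nil) (by simp)
        ⟨_, by simp, hoff' 5 (by omega) (by omega)⟩
    · rw [per 2, h2] at t5
      exact h.no_triangle t0 (step 6) t1 f1 (.cons t5 (.cons e21 .nil)) (by simp)
        ⟨_, by simp, hoff' 6 (by omega) (by omega)⟩
    · exact h.no_triangle t1.symm t0 (step 7).symm fm (.cons s80 .nil) (by simp)
        ⟨_, by simp, hoff' 8 (by omega) (by omega)⟩
    · rw [per 0, h0] at t1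
      exact h.no_triangle s80 t1.symm t0.symm fm (.cons s80 .nil) (by simp)
        ⟨_, by simp, hoff' 8 (by omega) (by omega)⟩
  · obtain ⟨p, q, r, hp, hq, hr, pq, qr, pr, a, b, c, ha, hb, hc, hab, hac, hbc, pa, qb, rc⟩ := htri
    have key : ∀ p q r a t, t < 3 → a = cyc K t → p ∉ K.support → q ∉ K.support → r ∉ K.support →
        G.Adj p q → G.Adj q r → G.Adj p r → G.Adj p a → False := by
      rintro p q r a t ht rfl hp hq hr pq qr pr pa
      have hoffT : ∃ u, (u = p ∨ u = q ∨ u = r) ∧ ∀ j, OnFace m j → u ≠ x j := by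
        by_contra hno
        push Not at hno
        obtain ⟨i, hi, hpi⟩ := hno p (by simp)
        obtain ⟨j, hj, hqj⟩ := hno q (by simp)
        obtain ⟨l, hl, hrl⟩ := hno r (by simp)
        have rng : ∀ u i, OnFace m i → u = x i → u ∉ K.support → 6 ≤ i ∧ i < m := by
          rintro u i hi rfl hu
          have : i ≠ 1 := by rintro rfl; exact hu hK1
          have : i ≠ m := by rintro rfl; exact hu hK0
          unfold OnFace at hi
          omega
        have hi := rng p i hi hpi hp
        have hj := rng q j hj hqj hq
        have hl := rng r l hl hrl hr
        rw [hpi, hqj, h.adj_iff (by omega) (by omega)] at pq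
        rw [hqj, hrl, h.adj_iff (by omega) (by omega)] at qr
        rw [hpi, hrl, h.adj_iff (by omega) (by omega)] at pr
        unfold ThetaAdj at pq qr pr
        omega
      interval_cases t
      · rw [h0] at pa
        exact h.no_triangle pq qr pr fm (.cons pa .nil) (by simp) hoffT
      · rw [h1] at pa
        exact h.no_triangle pq qr pr f1 (.cons pa .nil) (by simp) hoffT
      · rw [h2] at pa
        exact h.no_triangle pq qr pr f1 (.cons pa (.cons e21 .nil)) (by simp) hoffT
    obtain ⟨t, ht, he | he | he⟩ := h.apart.triclaw_legs hK h9 hp hq hr pq qr pr ha hb hc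
      hab hac hbc pa qb rc
    · exact key p q r a t ht he hp hq hr pq qr pr pa
    · exact key q p r b t ht he hq hp hr pq.symm pr qr qb
    · exact key r p q c t ht he hr hp hq pr.symm pq qr.symm rc

end OuterConfig

namespace OuterConfig

variable {G : SimpleGraph V} {m : ℕ} {x y : ℕ → V} (h : OuterConfig G m x y)

include h

theorem exists_ring {z : V} (hz : G.Adj (x 2) z) {P : G.Walk (y m) z} (hP : P.IsPath)
    (hoff : ∀ u ∈ P.support, u ∉ configSet m x) (hl : P.length ≤ 5) :
    ∃ K : G.Walk (x m) (x m), IsGoodCycle G K ∧ K.length ≤ 9 ∧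
      ∀ u, u ∈ K.support ↔ u = x m ∨ u = x 1 ∨ u = x 2 ∨ u ∈ P.support := by
  have h7 := h.seven_le
  obtain ⟨am1, a12, a21, a16⟩ := h.thetaAdj
  have hmem : ∀ i, 1 ≤ i → i ≤ m → x i ∉ P.support :=
    fun i h1 hm hi => hoff _ hi (mem_configSet x h1 hm)
  have hne : ∀ i j, 1 ≤ i → i ≤ m → 1 ≤ j → j ≤ m → i ≠ j → x i ≠ x j :=
    fun i j hi hi' hj hj' hij he => hij (h.eq_of_eq ⟨hi, hi'⟩ ⟨hj, hj'⟩ he)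
  set K : G.Walk (x m) (x m) := .cons (h.adj am1) (.cons (h.adj a12) (.cons hz
    (P.reverse.concat (h.out_adj h.hasOut_last).symm))) with hKdef
  have hsupp : ∀ u, u ∈ K.support ↔ u = x m ∨ u = x 1 ∨ u = x 2 ∨ u ∈ P.support := by
    intro u
    simp only [hKdef, Walk.support_cons, Walk.support_concat, Walk.support_reverse,
      List.mem_cons, List.mem_append, List.mem_reverse, List.not_mem_nil]
    tauto
  have hKl : K.length = P.length + 4 := by
    simp [hKdef]
  have hKc : K.IsCycle := by
    rw [hKdef, Walk.cons_isCycle_iff]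
    refine ⟨?_, ?_⟩
    · rw [Walk.cons_isPath_iff, Walk.cons_isPath_iff, Walk.concat_isPath_iff]
      refine ⟨⟨⟨hP.reverse, by simpa using hmem m (by omega) le_rfl⟩, ?_⟩, ?_⟩
      · simp [Walk.support_concat, hmem 2 (by omega) (by omega),
          hne 2 m (by omega) (by omega) (by omega) (by omega) (by omega)]
      · simp [Walk.support_concat, hmem 1 (by omega) (by omega),
          hne 1 m (by omega) (by omega) (by omega) (by omega) (by omega),
          hne 1 2 (by omega) (by omega) (by omega) (by omega) (by omega)]
    · intro he
      rw [Walk.edges_cons, Walk.edges_cons, Walk.edges_concat] at he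
      simp only [List.mem_cons, List.concat_eq_append, List.mem_append, Walk.edges_reverse,
        List.mem_reverse, List.not_mem_nil, or_false] at he
      have hm1 := hne m 1 (by omega) (by omega) (by omega) (by omega) (by omega)
      have hm2 := hne m 2 (by omega) (by omega) (by omega) (by omega) (by omega)
      have h12 := hne 1 2 (by omega) (by omega) (by omega) (by omega) (by omega)
      rcases he with he | he | he | he
      · rcases Sym2.eq_iff.1 he with ⟨e, -⟩ | ⟨e, -⟩
        exacts [hm1 e, hm2 e]
      · rcases Sym2.eq_iff.1 he with ⟨e, -⟩ | ⟨-, e⟩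
        exacts [hm2 e, h12 e]
      · exact hmem m (by omega) le_rfl (P.fst_mem_support_of_mem_edges he)
      · rcases Sym2.eq_iff.1 he with ⟨-, e⟩ | ⟨-, e⟩
        exacts [hm1 e.symm, h.out_ne h.hasOut_last le_rfl (by omega) e.symm]
  refine ⟨K, ?_, by omega, hsupp⟩
  by_cases h9 : K.length = 9
  · have c0 : cyc K 0 = x m := by simp [cyc]
    have c1 : cyc K 1 = x 1 := by simp [cyc, hKdef]
    have c2 : cyc K 2 = x 2 := by
      rw [cyc, h9]
      rfl
    refine h.isGoodCycle_of_cyc hKc h9 c0 c1 c2 fun i h3 hi9 hS => ?_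
    have key : ∀ j < 3, cyc K i ≠ cyc K j := by
      intro j hj he
      have := cyc_inj hKc he
      rw [h9] at this
      omega
    rcases (hsupp _).1 (cyc_mem K i) with e | e | e | e
    · exact key 0 (by omega) (e.trans c0.symm)
    · exact key 1 (by omega) (e.trans c1.symm)
    · exact key 2 (by omega) (e.trans c2.symm)
    · exact hoff _ e hS
  · exact IsGoodCycle.of_length_ne hKc h9

/-- The outer neighbor of `x m` and an outer neighbor of `x 2` are joined by no very short
walk. -/
theorem two_le_of_walk {z : V} (hz : G.Adj (x 2) z) (hzS : z ∉ configSet m x)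
    {P : G.Walk (y m) z} (hoff : ∀ u ∈ P.support, u ∉ configSet m x) : 2 ≤ P.length := by
  have h7 := h.seven_le
  obtain ⟨am1, a12, a21, a16⟩ := h.thetaAdj
  by_contra hl
  have hS : ∀ i, 1 ≤ i → i ≤ m → z ≠ x i ∧ y m ≠ x i := fun i h1 hm =>
    ⟨fun e => hzS (e ▸ mem_configSet x h1 hm), h.out_ne h.hasOut_last h1 hm⟩
  have hm2 : x m ≠ x 2 := fun e => by
    have := h.eq_of_eq ⟨by omega, le_rfl⟩ ⟨by omega, by omega⟩ e
    omega
  have h1m := (h.adj am1).ne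
  have h12 := (h.adj a12).ne
  have hsupp : ∀ i, 1 ≤ i → i ≤ m → x i ∉ P.support :=
    fun i h1 hm hi => hoff _ hi (mem_configSet x h1 hm)
  refine absurd (h.far (h.adj a12) ?_ (.cons (h.adj am1).symm (.cons (h.out_adj h.hasOut_last)
    (P.concat hz.symm))) ?_ (by simp; omega) 1 (Or.inl rfl) .nil) (by simp)
  · intro i j hi hj _ he
    rcases Sym2.eq_iff.1 he with ⟨-, e⟩ | ⟨-, e⟩
    exacts [h.x_two_off _ hj e, h.x_two_off _ hi e]
  · simp only [Walk.edges_cons, Walk.edges_concat, List.mem_cons, List.concat_eq_append,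
      List.mem_append, List.not_mem_nil, or_false]
    rintro (e | e | e | e)
    · rcases Sym2.eq_iff.1 e with ⟨-, e⟩ | ⟨e, -⟩
      exacts [hm2 e.symm, h1m e.symm]
    · rcases Sym2.eq_iff.1 e with ⟨e, -⟩ | ⟨-, e⟩
      exacts [h1m e.symm, hm2 e.symm]
    · exact hsupp 1 le_rfl (by omega) (P.fst_mem_support_of_mem_edges e)
    · rcases Sym2.eq_iff.1 e with ⟨e, -⟩ | ⟨e, -⟩
      exacts [(hS 1 le_rfl (by omega)).1 e.symm, h12 e]

/-- Two outer neighbors of `x 2` do not both lie on a short walk from the outer neighbor of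
`x m`. -/
theorem notMem_support_of_walk {z z' : V} (hz : G.Adj (x 2) z)
    (hz' : G.Adj (x 2) z') (hzS' : z' ∉ configSet m x) (hne : z' ≠ z)
    {P : G.Walk (y m) z} (hoff : ∀ u ∈ P.support, u ∉ configSet m x) (hl : P.length ≤ 5) :
    z' ∉ P.support := by
  classical
  intro hzP
  have h7 := h.seven_le
  obtain ⟨am1, a12, a21, a16⟩ := h.thetaAdj
  have h2 := h.two_le_of_walk hz' hzS' (P := P.takeUntil z' hzP)
    (fun u hu => hoff u (P.support_takeUntil_subset_support hzP hu))
  have hsum := congrArg Walk.length (P.take_spec hzP)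
  rw [Walk.length_append] at hsum
  have hx2 : x 2 ∉ (P.dropUntil z' hzP).support := fun hi =>
    hoff _ (P.support_dropUntil_subset_support hzP hi) (mem_configSet x (by omega) (by omega))
  refine absurd (h.far hz ?_ (.cons hz' (P.dropUntil z' hzP)) ?_ (by simp; omega) 1 (Or.inl rfl)
    (.cons (h.adj a21) .nil)) (by simp)
  · intro i j hi hj _ he
    rcases Sym2.eq_iff.1 he with ⟨e, -⟩ | ⟨e, -⟩
    exacts [h.x_two_off _ hi e, h.x_two_off _ hj e]
  · simp only [Walk.edges_cons, List.mem_cons]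
    rintro (e | e)
    · exact hne (Sym2.congr_right.1 e).symm
    · exact hx2 (Walk.fst_mem_support_of_mem_edges _ e)

end OuterConfig

theorem exists_minimal_walk {G : SimpleGraph V} {a b : V} {S : Set V} (P : G.Walk a b)
    (hP : ∀ u ∈ P.support, u ∉ S) :
    ∃ P' : G.Walk a b, P'.IsPath ∧ (∀ u ∈ P'.support, u ∉ S) ∧
      ∀ Q : G.Walk a b, (∀ u ∈ Q.support, u ∉ S) → P'.length ≤ Q.length := by
  classical
  have hex : ∃ n, ∃ Q : G.Walk a b, (∀ u ∈ Q.support, u ∉ S) ∧ Q.length = n := ⟨_, P, hP, rfl⟩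
  obtain ⟨Q, hQ, hQl⟩ := Nat.find_spec hex
  refine ⟨Q.bypass, Q.bypass_isPath, fun u hu => hQ u (Q.support_bypass_subset_support hu),
    fun R hR => Q.length_bypass_le_length.trans ?_⟩
  rw [hQl]
  exact Nat.find_min' hex ⟨R, hR, rfl⟩

theorem or_regroup {a b c t w q : Prop} (h : w → t) :
    a ∨ b ∨ c ∨ t ∨ w ∨ q ↔ (a ∨ b ∨ c) ∨ t ∨ q := by
  tauto

namespace OuterConfig

variable {G : SimpleGraph V} {m : ℕ} {x y : ℕ → V} (h : OuterConfig G m x y)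

include h

/-- Short walks from the outer neighbor of `x m` to two outer neighbors of `x 2` can be
rearranged so that they agree up to a vertex `w` and are disjoint after it. -/
theorem exists_fork {z z' : V}
    (hz : G.Adj (x 2) z) (hzS : z ∉ configSet m x)
    (hz' : G.Adj (x 2) z') (hzS' : z' ∉ configSet m x) (hne : z ≠ z')
    {P : G.Walk (y m) z} (hP : ∀ u ∈ P.support, u ∉ configSet m x) (hPl : P.length ≤ 5)
    {P' : G.Walk (y m) z'} (hP' : ∀ u ∈ P'.support, u ∉ configSet m x) (hPl' : P'.length ≤ 5) :
    ∃ (w a b : V) (T : G.Walk (y m) w) (q : G.Walk a z) (q' : G.Walk b z'),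
      G.Adj w a ∧ G.Adj w b ∧
      (∀ u ∈ T.support, u ∉ q.support) ∧ (∀ u ∈ q'.support, u ∉ T.support ∧ u ∉ q.support) ∧
      (∀ u ∈ T.support, u ∉ configSet m x) ∧ (∀ u ∈ q.support, u ∉ configSet m x) ∧
      (∀ u ∈ q'.support, u ∉ configSet m x) ∧
      (∃ K : G.Walk (x m) (x m), IsGoodCycle G K ∧ K.length ≤ 9 ∧ ∀ u, u ∈ K.support ↔
        (u = x m ∨ u = x 1 ∨ u = x 2) ∨ u ∈ T.support ∨ u ∈ q.support) ∧
      (∃ K : G.Walk (x m) (x m), IsGoodCycle G K ∧ K.length ≤ 9 ∧ ∀ u, u ∈ K.support ↔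
        (u = x m ∨ u = x 1 ∨ u = x 2) ∨ u ∈ T.support ∨ u ∈ q'.support) := by
  classical
  obtain ⟨P₁, h₁, hS₁, hmin⟩ := exists_minimal_walk P hP
  have hl₁ := (hmin P hP).trans hPl
  clear! P
  obtain ⟨P₂, h₂, hS₂, hl₂⟩ : ∃ P₂ : G.Walk (y m) z', P₂.IsPath ∧
      (∀ u ∈ P₂.support, u ∉ configSet m x) ∧ P₂.length ≤ 5 :=
    ⟨P'.bypass, P'.bypass_isPath, fun u hu => hP' u (P'.support_bypass_subset_support hu),
      P'.length_bypass_le_length.trans hPl'⟩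
  clear! P'
  have hz'P := h.notMem_support_of_walk hz hz' hzS' hne.symm hS₁ hl₁
  have hzP := h.notMem_support_of_walk hz' hz hzS hne hS₂ hl₂
  obtain ⟨w, r, r', hr, hw, hrX, -, -⟩ := exists_first_exit {u | u ∉ P₁.support} P₂.reverse
    hz'P (by simp)
  have hwP : w ∈ P₁.support := not_not.1 hw
  obtain ⟨T, L, hTL⟩ : ∃ (T : G.Walk (y m) w) (L : G.Walk w z), P₁ = T.append L :=
    ⟨_, _, (P₁.take_spec hwP).symm⟩
  obtain ⟨R, hR⟩ : ∃ R : G.Walk w z', r = R.reverse := ⟨r.reverse, by simp⟩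
  have hP₂ : P₂ = r'.reverse.append R := by
    rw [← Walk.reverse_reverse P₂, hr, hR, Walk.reverse_append, Walk.reverse_reverse]
  subst hR hP₂ hTL
  have hRX : ∀ u ∈ R.support, u ≠ w → u ∉ (T.append L).support := fun u hu huw =>
    hrX u (by simpa using hu) huw
  clear hr hw hrX
  cases L with
  | nil => exact (hzP (by simp)).elim
  | @cons _ a _ ha q =>
  cases R with
  | nil => exact (hz'P hwP).elim
  | @cons _ b _ hb q' =>
  have hTle : T.length ≤ r'.length := by
    have := hmin (r'.reverse.append (.cons ha q)) (fun u hu => by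
      rw [Walk.mem_support_append_iff] at hu
      rcases hu with hu | hu
      · exact hS₂ u (Walk.support_subset_support_append_left _ _ hu)
      · exact hS₁ u (Walk.support_subset_support_append_right _ _ hu))
    simp only [Walk.length_append, Walk.length_reverse] at this
    omega
  have hqw : w ∉ q.support := (Walk.cons_isPath_iff _ _).1 h₁.of_append_right |>.2
  have hq'w : w ∉ q'.support := (Walk.cons_isPath_iff _ _).1 h₂.of_append_right |>.2
  have hTq : ∀ u ∈ T.support, u ∉ q.support := by
    intro u hu huq
    have := h₁.support_nodup
    rw [Walk.support_append, List.nodup_append] at this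
    exact this.2.2 u hu u (by simpa using huq) rfl
  have hq'P : ∀ u ∈ q'.support, u ∉ T.support ∧ u ∉ q.support := by
    intro u hu
    have := hRX u (by simp [hu]) (fun e => hq'w (e ▸ hu))
    rw [Walk.mem_support_append_iff, not_or, Walk.support_cons, List.mem_cons, not_or] at this
    exact ⟨this.1, this.2.2⟩
  have hTS : ∀ u ∈ T.support, u ∉ configSet m x := fun u hu =>
    hS₁ u (Walk.support_subset_support_append_left _ _ hu)
  have hqS : ∀ u ∈ q.support, u ∉ configSet m x := fun u hu =>
    hS₁ u (Walk.support_subset_support_append_right _ _ (by simp [hu]))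
  have hq'S : ∀ u ∈ q'.support, u ∉ configSet m x := fun u hu =>
    hS₂ u (Walk.support_subset_support_append_right _ _ (by simp [hu]))
  have h₂' : (T.append (.cons hb q')).IsPath := by
    rw [Walk.isPath_def, Walk.support_append, List.nodup_append]
    refine ⟨h₁.of_append_left.support_nodup, ?_, fun u hu v hv e => ?_⟩
    · simpa using ((Walk.cons_isPath_iff _ _).1 h₂.of_append_right).1.support_nodup
    · subst e
      exact (hq'P u (by simpa using hv)).1 hu
  obtain ⟨K₁, hK₁, hK₁l, hK₁s⟩ := h.exists_ring hz h₁ hS₁ hl₁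
  obtain ⟨K₂, hK₂, hK₂l, hK₂s⟩ := h.exists_ring hz' h₂' (fun u hu => by
      rw [Walk.mem_support_append_iff, Walk.support_cons, List.mem_cons] at hu
      rcases hu with hu | rfl | hu
      exacts [hTS u hu, hTS u T.end_mem_support, hq'S u hu]) (by
      simp only [Walk.length_append, Walk.length_reverse, Walk.length_cons] at hl₂ ⊢
      omega)
  have hw : ∀ u, u = w → u ∈ T.support := fun u e => e ▸ T.end_mem_support
  refine ⟨w, a, b, T, q, q', ha, hb, hTq, hq'P, hTS, hqS, hq'S, ⟨K₁, hK₁, hK₁l, fun u => ?_⟩,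
    ⟨K₂, hK₂, hK₂l, fun u => ?_⟩⟩
  · rw [hK₁s, Walk.mem_support_append_iff, Walk.support_cons, List.mem_cons]
    exact or_regroup (hw u)
  · rw [hK₂s, Walk.mem_support_append_iff, Walk.support_cons, List.mem_cons]
    exact or_regroup (hw u)

theorem no_two_short_walks [Fintype V] {v₀ : V} {C₀ : G.Walk v₀ v₀} {φ₀ : V → Bool}
    (hM : ExtendsBelow (graphSize G)) (hcex : IsCounterexample G C₀ φ₀)
    {pos : Option V → ℝ × ℝ} {Ed : Option V → Option V → Set (ℝ × ℝ)}
    (hdraw : IsWeakDrawing (addApex G {u | u ∈ C₀.support}) pos Ed) {z z' : V}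
    (hz : G.Adj (x 2) z) (hzS : z ∉ configSet m x)
    (hz' : G.Adj (x 2) z') (hzS' : z' ∉ configSet m x) (hne : z ≠ z')
    {P : G.Walk (y m) z} (hP : ∀ u ∈ P.support, u ∉ configSet m x) (hPl : P.length ≤ 5)
    {P' : G.Walk (y m) z'} (hP' : ∀ u ∈ P'.support, u ∉ configSet m x) (hPl' : P'.length ≤ 5) :
    False := by
  have h7 := h.seven_le
  obtain ⟨am1, a12, a21, a16⟩ := h.thetaAdj
  obtain ⟨w, a, b, T, q, q', ha, hb, hTq, hq'P, hTS, hqS, hq'S, ⟨K₁, hK₁, hK₁l, hK₁s'⟩,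
    ⟨K₂, hK₂, hK₂l, hK₂s'⟩⟩ := h.exists_fork hz hzS hz' hzS' hne hP hPl hP' hPl'
  have x6S : ∀ u, u ∉ configSet m x → x 6 ≠ u := fun u hu e =>
    hu (e ▸ mem_configSet x (by omega) (by omega))
  have xne : ∀ i j, 1 ≤ i → i ≤ m → 1 ≤ j → j ≤ m → i ≠ j → x i ≠ x j :=
    fun i j hi hi' hj hj' hij he => hij (h.eq_of_eq ⟨hi, hi'⟩ ⟨hj, hj'⟩ he)
  have xS : ∀ i, 1 ≤ i → i ≤ m → ∀ u, u ∉ configSet m x → u ≠ x i := fun i h1 hm u hu e =>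
    hu (e ▸ mem_configSet x h1 hm)
  have xNS : ∀ u, u ∉ configSet m x → ¬ (u = x m ∨ u = x 1 ∨ u = x 2) := by
    rintro u hu (e | e | e)
    exacts [xS m (by omega) le_rfl u hu e, xS 1 le_rfl (by omega) u hu e,
      xS 2 (by omega) (by omega) u hu e]
  have x6N : ¬ (x 6 = x m ∨ x 6 = x 1 ∨ x 6 = x 2) := by
    rintro (e | e | e)
    exacts [xne 6 m (by omega) (by omega) (by omega) (by omega) (by omega) e,
      xne 6 1 (by omega) (by omega) (by omega) (by omega) (by omega) e,
      xne 6 2 (by omega) (by omega) (by omega) (by omega) (by omega) e]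
  have x6T : x 6 ∉ T.support := fun hu => x6S _ (hTS _ hu) rfl
  have x6q : x 6 ∉ q.support := fun hu => x6S _ (hqS _ hu) rfl
  have x6q' : x 6 ∉ q'.support := fun hu => x6S _ (hq'S _ hu) rfl
  have e6 : G.Adj (x 6) (x 1) := (h.adj a16).symm
  set A := addApex G {u | u ∈ C₀.support} with hA
  set J : Set (Option V) := some '' {u | (u = x m ∨ u = x 1 ∨ u = x 2) ∨
    u ∈ T.support ∨ u ∈ q.support ∨ u ∈ q'.support} with hJ
  have h6J : some (x 6) ∉ J := by
    rintro ⟨u, hu, e⟩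
    obtain rfl := Option.some.inj e
    rcases hu with hu | hu | hu | hu
    exacts [x6N hu, x6T hu, x6q hu, x6q' hu]
  have hBq := exists_adj_of_reachable_delEdgesAt (J := J) (L := some '' {u | u ∈ q.support})
    (hM.reachable_addApex hcex hK₂ hK₂l (s := x 6) (t := z)
      (by rw [hK₂s']; tauto) (by
        rw [hK₂s']
        rintro (e | e | e)
        exacts [xNS z hzS e, hTq z e q.end_mem_support, (hq'P z e).2 q.end_mem_support])
      ⟨_, e6⟩ ⟨_, hz.symm⟩) h6J (by
        rintro _ ⟨u, hu, rfl⟩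
        rcases hu with hu | hu | hu | hu
        exacts [Or.inl ⟨u, (hK₂s' u).2 (Or.inl hu), rfl⟩,
          Or.inl ⟨u, (hK₂s' u).2 (Or.inr (Or.inl hu)), rfl⟩, Or.inr ⟨u, hu, rfl⟩,
          Or.inl ⟨u, (hK₂s' u).2 (Or.inr (Or.inr hu)), rfl⟩])
      ⟨z, Or.inr (Or.inr (Or.inl q.end_mem_support)), rfl⟩
  have hBq' := exists_adj_of_reachable_delEdgesAt (J := J) (L := some '' {u | u ∈ q'.support})
    (hM.reachable_addApex hcex hK₁ hK₁l (s := x 6) (t := z')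
      (by rw [hK₁s']; tauto) (by
        rw [hK₁s']
        rintro (e | e | e)
        exacts [xNS z' hzS' e, (hq'P z' q'.end_mem_support).1 e,
          (hq'P z' q'.end_mem_support).2 e])
      ⟨_, e6⟩ ⟨_, hz'.symm⟩) h6J (by
        rintro _ ⟨u, hu, rfl⟩
        rcases hu with hu | hu | hu | hu
        exacts [Or.inl ⟨u, (hK₁s' u).2 (Or.inl hu), rfl⟩,
          Or.inl ⟨u, (hK₁s' u).2 (Or.inr (Or.inl hu)), rfl⟩,
          Or.inl ⟨u, (hK₁s' u).2 (Or.inr (Or.inr hu)), rfl⟩, Or.inr ⟨u, hu, rfl⟩])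
      ⟨z', Or.inr (Or.inr (Or.inr q'.end_mem_support)), rfl⟩
  have lift : ∀ {u v : V}, G.Adj u v → A.Adj (some u) (some v) := fun huv => huv
  let f : G →g A := ⟨some, fun huv => huv⟩
  have hconn : ∀ {u v : V} (p : G.Walk u v), WalkConnected A (some '' {t | t ∈ p.support}) := by
    intro u v p
    have := walkConnected_support (p.map f)
    have he : {t | t ∈ (p.map f).support} = some '' {t | t ∈ p.support} := by
      ext t
      simp [Walk.support_map, f]
      rfl
    rwa [he] at this
  have hconn1 : WalkConnected A
      (some '' {t | t ∈ (Walk.cons (h.out_adj h.hasOut_last) T).support}) :=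
    hconn _
  have hB : ∀ u, (delEdgesAt A J).Reachable (some (x 6)) u → u ∉ J := fun u hu =>
    notMem_of_reachable_delEdgesAt hu h6J
  have h2T : x 2 ∉ T.support := fun e => hTS _ e (mem_configSet x (by omega) (by omega))
  have h2q : x 2 ∉ q.support := fun e => hqS _ e (mem_configSet x (by omega) (by omega))
  have h2q' : x 2 ∉ q'.support := fun e => hq'S _ e (mem_configSet x (by omega) (by omega))
  have h1T : x 1 ∉ T.support := fun e => hTS _ e (mem_configSet x (by omega) (by omega))
  have h1q : x 1 ∉ q.support := fun e => hqS _ e (mem_configSet x (by omega) (by omega))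
  have h1q' : x 1 ∉ q'.support := fun e => hq'S _ e (mem_configSet x (by omega) (by omega))
  have hmq : x m ∉ q.support := fun e => hqS _ e (mem_configSet x (by omega) (by omega))
  have hmq' : x m ∉ q'.support := fun e => hq'S _ e (mem_configSet x (by omega) (by omega))
  have n12 := xne 1 2 (by omega) (by omega) (by omega) (by omega) (by omega)
  have nm1 := xne m 1 (by omega) (by omega) (by omega) (by omega) (by omega)
  have nm2 := xne m 2 (by omega) (by omega) (by omega) (by omega) (by omega)
  have hA01 : Disjoint ({some (x 2)} : Set (Option V))
      (some '' {t | t ∈ (Walk.cons (h.out_adj h.hasOut_last) T).support}) := by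
    rw [Set.disjoint_singleton_left]
    rintro ⟨u, hu, e⟩
    obtain rfl := Option.some.inj e
    rw [Set.mem_ofPred_eq, Walk.support_cons, List.mem_cons] at hu
    exact hu.elim nm2.symm h2T
  have hA02 : Disjoint ({some (x 2)} : Set (Option V))
      {u | (delEdgesAt A J).Reachable (some (x 6)) u} := by
    rw [Set.disjoint_singleton_left]
    exact fun e => hB _ e ⟨_, Or.inl (Or.inr (Or.inr rfl)), rfl⟩
  have hA12 : Disjoint (some '' {t | t ∈ (Walk.cons (h.out_adj h.hasOut_last) T).support})
      {u | (delEdgesAt A J).Reachable (some (x 6)) u} := by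
    rw [Set.disjoint_left]
    rintro _ ⟨u, hu, rfl⟩ e
    rw [Set.mem_ofPred_eq, Walk.support_cons, List.mem_cons] at hu
    exact hB _ e ⟨u, hu.elim (fun e => Or.inl (Or.inl e)) (fun e => Or.inr (Or.inl e)), rfl⟩
  have hB01 : Disjoint (some '' {t | t ∈ q.support}) (some '' {t | t ∈ q'.support}) := by
    rw [Set.disjoint_left]
    rintro _ ⟨u, hu, rfl⟩ ⟨v, hv, e⟩
    obtain rfl := Option.some.inj e
    exact (hq'P _ hv).2 hu
  have hB02 : Disjoint (some '' {t | t ∈ q.support}) ({some (x 1)} : Set (Option V)) := by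
    rw [Set.disjoint_singleton_right]
    rintro ⟨u, hu, e⟩
    obtain rfl := Option.some.inj e
    exact h1q hu
  have hB12 : Disjoint (some '' {t | t ∈ q'.support}) ({some (x 1)} : Set (Option V)) := by
    rw [Set.disjoint_singleton_right]
    rintro ⟨u, hu, e⟩
    obtain rfl := Option.some.inj e
    exact h1q' hu
  have hdis : ∀ X : Set (Option V), (∀ u ∈ X, ∃ v, u = some v ∧ (v = x 1 ∨ v ∈ q.support ∨
      v ∈ q'.support)) → Disjoint {some (x 2)} X ∧
      Disjoint (some '' {t | t ∈ (Walk.cons (h.out_adj h.hasOut_last) T).support}) X ∧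
      Disjoint {u | (delEdgesAt A J).Reachable (some (x 6)) u} X := by
    intro X hX
    simp only [Set.disjoint_right]
    refine ⟨fun u hu e => ?_, fun u hu e => ?_, fun u hu e => ?_⟩
    · obtain ⟨v, rfl, hv⟩ := hX u hu
      obtain rfl := Option.some.inj e
      rcases hv with hv | hv | hv
      exacts [n12 hv.symm, h2q hv, h2q' hv]
    · obtain ⟨v, rfl, hv⟩ := hX u hu
      obtain ⟨t, ht, e⟩ := e
      obtain rfl := Option.some.inj e
      rw [Set.mem_ofPred_eq, Walk.support_cons, List.mem_cons] at ht
      rcases ht with rfl | ht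
      · rcases hv with hv | hv | hv
        exacts [nm1 hv, hmq hv, hmq' hv]
      · rcases hv with rfl | hv | hv
        exacts [h1T ht, hTq _ ht hv, (hq'P _ hv).1 ht]
    · obtain ⟨v, rfl, hv⟩ := hX u hu
      refine hB _ e ⟨v, ?_, rfl⟩
      rcases hv with hv | hv | hv
      exacts [Or.inl (Or.inr (Or.inl hv)), Or.inr (Or.inr (Or.inl hv)),
        Or.inr (Or.inr (Or.inr hv))]
  have hd0 := hdis (some '' {t | t ∈ q.support}) (by
    rintro _ ⟨u, hu, rfl⟩
    exact ⟨u, rfl, Or.inr (Or.inl hu)⟩)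
  have hd1 := hdis (some '' {t | t ∈ q'.support}) (by
    rintro _ ⟨u, hu, rfl⟩
    exact ⟨u, rfl, Or.inr (Or.inr hu)⟩)
  have hd2 := hdis {some (x 1)} (by
    rintro _ rfl
    exact ⟨_, rfl, Or.inl rfl⟩)
  have sing : ∀ u : Option V, WalkConnected A {u} := by
    rintro u _ rfl _ rfl
    exact ⟨.nil, by simp⟩
  refine hdraw.no_K33_minor
    ![{some (x 2)}, some '' {t | t ∈ (Walk.cons (h.out_adj h.hasOut_last) T).support},
      {u | (delEdgesAt A J).Reachable (some (x 6)) u}]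
    ![some '' {t | t ∈ q.support}, some '' {t | t ∈ q'.support}, {some (x 1)}]
    ?_ ?_ ?_ ?_ ?_ ?_
  · simp only [Fin.forall_fin_succ, IsEmpty.forall_iff, and_true]
    exact ⟨sing _, hconn1, walkConnected_reachable_delEdgesAt⟩
  · simp only [Fin.forall_fin_succ, IsEmpty.forall_iff, and_true]
    exact ⟨hconn q, hconn q', sing _⟩
  · intro i j hij
    fin_cases i <;> fin_cases j
    exacts [(hij rfl).elim, hA01, hA02, hA01.symm, (hij rfl).elim, hA12, hA02.symm, hA12.symm,
      (hij rfl).elim]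
  · intro i j hij
    fin_cases i <;> fin_cases j
    exacts [(hij rfl).elim, hB01, hB02, hB01.symm, (hij rfl).elim, hB12, hB02.symm, hB12.symm,
      (hij rfl).elim]
  · intro i j
    fin_cases i <;> fin_cases j
    exacts [hd0.1, hd1.1, hd2.1, hd0.2.1, hd1.2.1, hd2.2.1, hd0.2.2, hd1.2.2, hd2.2.2]
  · intro i j
    have hwT : some w ∈ some '' {t | t ∈ (Walk.cons (h.out_adj h.hasOut_last) T).support} :=
      ⟨w, by simp, rfl⟩
    fin_cases i <;> fin_cases j
    · exact ⟨_, rfl, some z, ⟨z, q.end_mem_support, rfl⟩, lift hz⟩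
    · exact ⟨_, rfl, some z', ⟨z', q'.end_mem_support, rfl⟩, lift hz'⟩
    · exact ⟨_, rfl, _, rfl, lift (h.adj a21)⟩
    · exact ⟨_, hwT, some a, ⟨a, q.start_mem_support, rfl⟩, lift ha⟩
    · exact ⟨_, hwT, some b, ⟨b, q'.start_mem_support, rfl⟩, lift hb⟩
    · exact ⟨some (x m), ⟨x m, by simp, rfl⟩, _, rfl, lift (h.adj am1)⟩
    · exact hBq
    · exact hBq'
    · exact ⟨_, Reachable.refl _, _, rfl, lift e6⟩

end OuterConfig

section

/-- Two vertices far from each other and not too close to short cycles, so that they can be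
identified. -/
structure Mergeable (H : SimpleGraph V) (a b : V) : Prop where
  far : ∀ p : H.Walk a b, 6 ≤ p.length
  left : ∀ {u v : V}, H.Adj u v → ∀ p : H.Walk u v, s(u, v) ∉ p.edges → p.length ≤ 4 →
    ∀ q : H.Walk u a, 2 ≤ q.length
  right : ∀ {u v : V}, H.Adj u v → ∀ p : H.Walk u v, s(u, v) ∉ p.edges → p.length ≤ 4 → u ≠ b

theorem Mergeable.ne {H : SimpleGraph V} {a b : V} (h : Mergeable H a b) : a ≠ b := by
  rintro rfl
  simpa using h.far .nil

theorem Mergeable.not_adj {H : SimpleGraph V} {a b : V} (h : Mergeable H a b) : ¬ H.Adj a b :=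
  fun hab => by simpa using h.far (.cons hab .nil)

/-- The graph obtained from `H` by identifying `a` with `b`. -/
def merge [DecidableEq V] (H : SimpleGraph V) (a b : V) : SimpleGraph V :=
  H.map (Function.update id a b)

variable [DecidableEq V] {H : SimpleGraph V} {a b : V}

theorem merge_adj_of_adj {u v : V} (huv : H.Adj u v) (hu : u ≠ a) (hv : v ≠ a) :
    (merge H a b).Adj u v :=
  (map_adj' _ _ _ _).2 ⟨huv.ne, u, v, huv, by simp [hu], by simp [hv]⟩

theorem merge_adj_of_left {v : V} (hv : H.Adj a v) (hb : v ≠ b) : (merge H a b).Adj b v :=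
  (map_adj' _ _ _ _).2 ⟨hb.symm, a, v, hv, by simp, by simp [hv.ne.symm]⟩

theorem adj_of_merge_adj {u v : V} (huv : (merge H a b).Adj u v) (hu : u ≠ b) (hv : v ≠ b) :
    H.Adj u v := by
  obtain ⟨-, u', v', h, rfl, rfl⟩ := (map_adj' _ _ _ _).1 huv
  have hu' : u' ≠ a := by
    rintro rfl
    simp at hu
  have hv' : v' ≠ a := by
    rintro rfl
    simp at hv
  simpa [hu', hv'] using h

theorem exists_adj_of_merge_adj {v : V} (hbv : (merge H a b).Adj b v) :
    H.Adj a v ∨ H.Adj b v := by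
  obtain ⟨hne, u', v', h, hu, rfl⟩ := (map_adj' _ _ _ _).1 hbv
  have hv' : v' ≠ a := by
    rintro rfl
    simp at hne
  by_cases hu' : u' = a
  · subst hu'
    exact Or.inl (by simpa [hv'] using h)
  · rw [Function.update_of_ne hu', id] at hu
    exact Or.inr (by simpa [hv', hu] using h)

theorem not_merge_adj_left (hab : a ≠ b) (v : V) : ¬ (merge H a b).Adj a v := by
  rintro hv
  obtain ⟨-, u', v', h, hu, rfl⟩ := (map_adj' _ _ _ _).1 hv
  by_cases hu' : u' = a
  · subst hu'
    exact hab (by simpa using hu.symm)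
  · rw [Function.update_of_ne hu', id] at hu
    exact hu' hu

theorem notMem_support_of_merge (hab : a ≠ b) {u v : V} (p : (merge H a b).Walk u v)
    (hu : u ≠ a) : a ∉ p.support := by
  induction p with
  | nil => simpa using hu.symm
  | cons huv p ih =>
    rw [Walk.support_cons, List.mem_cons, not_or]
    exact ⟨hu.symm, ih (by rintro rfl; exact not_merge_adj_left hab _ huv.symm)⟩

theorem exists_walk_of_merge {u v : V} (p : (merge H a b).Walk u v) (hp : b ∉ p.support) :
    ∃ q : H.Walk u v, q.length = p.length ∧ q.edges = p.edges ∧ q.support = p.support := by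
  refine ⟨p.transfer H fun e he => ?_, by simp, by simp, by simp⟩
  induction e with
  | _ s t =>
    exact adj_of_merge_adj (p.adj_of_mem_edges he)
      (fun e => hp (e ▸ p.fst_mem_support_of_mem_edges he))
      (fun e => hp (e ▸ p.snd_mem_support_of_mem_edges he))

theorem graphSize_merge_le [Fintype V] (H : SimpleGraph V) (a b : V) :
    graphSize (merge H a b) ≤ graphSize H := by
  unfold graphSize
  refine Nat.add_le_add_left ?_ _
  refine le_trans (Set.ncard_le_ncard (t := Sym2.map (Function.update id a b) '' H.edgeSet) ?_
    (Set.toFinite _)) (Set.ncard_image_le (Set.toFinite _))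
  intro e he
  induction e with
  | _ u v =>
    obtain ⟨-, u', v', h, rfl, rfl⟩ := (map_adj' _ _ _ _).1 he
    exact ⟨s(u', v'), h, rfl⟩

/-- Contracting a path to one of its ends. -/
theorem isPlanarGraph_merge [Finite V] {G : SimpleGraph V} (hG : IsPlanarGraph G) {u v w : V}
    (hbu : G.Adj b u) (huv : G.Adj u v) (hvw : G.Adj v w) (hwa : G.Adj w a) (hbv : b ≠ v)
    (hbw : b ≠ w) (hba : b ≠ a) (huw : u ≠ w) (hua : u ≠ a) (hva : v ≠ a) (hle : H ≤ G)
    (hu : ∀ t, ¬ H.Adj u t) (hv : ∀ t, ¬ H.Adj v t) (hw : ∀ t, ¬ H.Adj w t) :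
    IsPlanarGraph (merge H a b) := by
  have h1 := hG.contract hbu
  set G₁ := G.map (Function.update id u b)
  have e1 : ∀ s t, G.Adj s t → s ≠ u → t ≠ u → G₁.Adj s t := fun s t hst hs ht =>
    (map_adj' _ _ _ _).2 ⟨hst.ne, s, t, hst, by simp [hs], by simp [ht]⟩
  have b1 : G₁.Adj b v := (map_adj' _ _ _ _).2 ⟨hbv, u, v, huv, by simp, by simp [huv.ne.symm]⟩
  have h2 := h1.contract b1
  set G₂ := G₁.map (Function.update id v b)
  have e2 : ∀ s t, G₁.Adj s t → s ≠ v → t ≠ v → G₂.Adj s t := fun s t hst hs ht =>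
    (map_adj' _ _ _ _).2 ⟨hst.ne, s, t, hst, by simp [hs], by simp [ht]⟩
  have b2 : G₂.Adj b w := (map_adj' _ _ _ _).2
    ⟨hbw, v, w, e1 _ _ hvw huv.ne.symm huw.symm, by simp, by simp [hvw.ne.symm]⟩
  have h3 := h2.contract b2
  set G₃ := G₂.map (Function.update id w b)
  have e3 : ∀ s t, G₂.Adj s t → s ≠ w → t ≠ w → G₃.Adj s t := fun s t hst hs ht =>
    (map_adj' _ _ _ _).2 ⟨hst.ne, s, t, hst, by simp [hs], by simp [ht]⟩
  have b3 : G₃.Adj b a := (map_adj' _ _ _ _).2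
    ⟨hba, w, a, e2 _ _ (e1 _ _ hwa huw.symm hua.symm) hvw.ne.symm hva.symm, by simp,
      by simp [hwa.ne.symm]⟩
  refine (h3.contract b3).mono fun s t hst => ?_
  obtain ⟨hne, s', t', h, rfl, rfl⟩ := (map_adj' _ _ _ _).1 hst
  have ne : ∀ {s t}, H.Adj s t → s ≠ u ∧ s ≠ v ∧ s ≠ w := fun hst =>
    ⟨by rintro rfl; exact hu _ hst, by rintro rfl; exact hv _ hst, by rintro rfl; exact hw _ hst⟩
  obtain ⟨su, sv, sw⟩ := ne h
  obtain ⟨tu, tv, tw⟩ := ne h.symm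
  exact (map_adj' _ _ _ _).2 ⟨hne, s', t',
    e3 _ _ (e2 _ _ (e1 _ _ (hle h) su tu) sv tv) sw tw, rfl, rfl⟩

namespace Mergeable

variable (h : Mergeable H a b)

include h

/-- Cycles through the new vertex are long. -/
theorem six_le_of_isCycle {c : (merge H a b).Walk b b} (hc : c.IsCycle) : 6 ≤ c.length := by
  by_contra hl
  cases c with
  | nil => exact hc.not_nil .nil
  | @cons _ v _ hbv r =>
    rw [Walk.cons_isCycle_iff] at hc
    rw [Walk.length_cons] at hl
    obtain ⟨w, r₀, hwb, rfl⟩ : ∃ (w : V) (r₀ : (merge H a b).Walk v w)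
        (hwb : (merge H a b).Adj w b), r = r₀.concat hwb := by
      cases hr : r.reverse with
      | nil => exact absurd rfl hbv.ne
      | @cons _ w _ hbw q =>
        refine ⟨w, q.reverse, hbw.symm, ?_⟩
        rw [← Walk.reverse_reverse r, hr, Walk.reverse_cons]
        rfl
    obtain ⟨⟨hr₀, hbr⟩, he⟩ := And.imp_left (Walk.concat_isPath_iff _).1 hc
    obtain ⟨q, hql, hqe, hqs⟩ := exists_walk_of_merge r₀ hbr
    have har : a ∉ q.support := by
      rw [hqs]
      refine notMem_support_of_merge h.ne r₀ ?_
      rintro rfl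
      exact not_merge_adj_left h.ne b hbv.symm
    have hvw : v ≠ w := by
      rintro rfl
      refine he ?_
      rw [Walk.edges_concat]
      simp [Sym2.eq_swap]
    rw [Walk.length_concat] at hl
    have key : ∀ s, s ∉ q.support → H.Adj s v → H.Adj s w →
        ∃ p : H.Walk s v, s(s, v) ∉ p.edges ∧ p.length ≤ 4 := by
      intro s hs hsv hsw
      refine ⟨.cons hsw q.reverse, ?_, by simp; omega⟩
      rw [Walk.edges_cons, List.mem_cons]
      rintro (e | e)
      · exact hvw (Sym2.congr_right.1 e)
      · exact hs (by simpa using Walk.fst_mem_support_of_mem_edges _ e)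
    rcases exists_adj_of_merge_adj hbv with hv | hv <;>
      rcases exists_adj_of_merge_adj hwb.symm with hw | hw
    · obtain ⟨p, hp, hpl⟩ := key a har hv hw
      simpa using h.left hv p hp hpl .nil
    · have := h.far (.cons hv (q.concat hw.symm))
      simp at this
      omega
    · have := h.far (.cons hw (q.reverse.concat hv.symm))
      simp at this
      omega
    · obtain ⟨p, hp, hpl⟩ := key b (hqs ▸ hbr) hv hw
      exact h.right hv p hp hpl rfl

theorem notMem_of_isCycle {u : V} {c : (merge H a b).Walk u u} (hc : c.IsCycle)
    (hcl : c.length ≤ 5) : b ∉ c.support := fun hb => by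
  have := h.six_le_of_isCycle (hc.rotate hb)
  rw [Walk.length_rotate] at this
  omega

theorem not_adj_of_isCycle {u v : V} {c : H.Walk u u} (hc : c.IsCycle) (hcl : c.length ≤ 5)
    (hv : v ∈ c.support) : ¬ H.Adj v a := by
  intro ha
  have hr := hc.rotate hv
  have hl : (c.rotate v hv).length ≤ 5 := by rwa [Walk.length_rotate]
  generalize c.rotate v hv = d at hr hl
  cases d with
  | nil => exact hr.not_nil .nil
  | cons hvw r =>
    rw [Walk.cons_isCycle_iff] at hr
    rw [Walk.length_cons] at hl
    simpa using h.left hvw r.reverse (by simpa using hr.2) (by simp; omega) (.cons ha .nil)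

/-- Short cycles survive the identification unchanged. -/
theorem exists_lift_of_isCycle {u : V} {c : (merge H a b).Walk u u} (hc : c.IsCycle)
    (hcl : c.length ≤ 5) :
    ∃ d : H.Walk u u, d.IsCycle ∧ d.length ≤ 5 ∧ d.edges = c.edges ∧ d.support = c.support := by
  refine ⟨c.transfer H fun e he => ?_, hc.transfer _, by simpa, by simp, by simp⟩
  have hb := h.notMem_of_isCycle hc hcl
  induction e with
  | _ s t =>
    exact adj_of_merge_adj (c.adj_of_mem_edges he)
      (fun e => hb (e ▸ c.fst_mem_support_of_mem_edges he))
      (fun e => hb (e ▸ c.snd_mem_support_of_mem_edges he))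

theorem shortApart (hap : ShortApart H) : ShortApart (merge H a b) := by
  intro u v c₁ c₂ h₁ h₂ l₁ l₂ hne x hx y hy p
  have hb₁ := h.notMem_of_isCycle h₁ l₁
  have hb₂ := h.notMem_of_isCycle h₂ l₂
  obtain ⟨d₁, hd₁, dl₁, e₁, s₁⟩ := h.exists_lift_of_isCycle h₁ l₁
  obtain ⟨d₂, hd₂, dl₂, e₂, s₂⟩ := h.exists_lift_of_isCycle h₂ l₂
  have key : ∀ q : H.Walk x y, 3 ≤ q.length :=
    hap d₁ d₂ hd₁ hd₂ dl₁ dl₂ (by rwa [e₁, e₂]) x (s₁ ▸ hx) y (s₂ ▸ hy)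
  by_contra hlt
  by_cases hb : b ∈ p.support
  · have hxb : b ≠ x := fun e => hb₁ (e ▸ hx)
    have hyb : b ≠ y := fun e => hb₂ (e ▸ hy)
    cases p with
    | nil => exact hxb (by simpa using hb)
    | @cons _ w _ hxw p =>
    cases p with
    | nil => simp [hxb, hyb] at hb
    | cons hwy p =>
    cases p with
    | cons hz p =>
      simp only [Walk.length_cons] at hlt
      omega
    | nil =>
      obtain rfl : b = w := by simpa [hxb, hyb] using hb
      have h1 := (exists_adj_of_merge_adj hxw.symm).resolve_left
        (fun e => h.not_adj_of_isCycle hd₁ dl₁ (s₁ ▸ hx) e.symm)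
      have h2 := (exists_adj_of_merge_adj hwy).resolve_left
        (fun e => h.not_adj_of_isCycle hd₂ dl₂ (s₂ ▸ hy) e.symm)
      have := key (.cons h1.symm (.cons h2 .nil))
      simp at this
  · obtain ⟨q, hq, -⟩ := exists_walk_of_merge p hb
    exact hlt (hq ▸ key q)

/-- The identification creates no new edges on a short cycle. -/
theorem adj_of_mem {k : V} {C : H.Walk k k} (hC : C.IsCycle) (hl : C.length ≤ 9) {u v : V}
    (hu : u ∈ C.support) (hv : v ∈ C.support) (huv : (merge H a b).Adj u v) : H.Adj u v := by
  have key : ∀ v, b ∈ C.support → v ∈ C.support → (merge H a b).Adj b v → H.Adj b v := by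
    intro v hb hv hbv
    refine (exists_adj_of_merge_adj hbv).resolve_left fun hav => ?_
    obtain ⟨q, hq, -⟩ := exists_short_arc hC hv hb
    have := h.far (.cons hav q)
    rw [Walk.length_cons] at this
    omega
  by_cases hub : u = b
  · subst hub
    exact key v hu hv huv
  by_cases hvb : v = b
  · subst hvb
    exact (key u hv hu huv.symm).symm
  exact adj_of_merge_adj huv hub hvb

theorem ifColoringOn {k : V} {C : H.Walk k k} (hC : C.IsCycle) (hl : C.length ≤ 9)
    {c : V → Bool} (hc : IFColoringOn H {x | x ∈ C.support} c) :
    IFColoringOn (merge H a b) {x | x ∈ C.support} c := by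
  refine ⟨fun u v hu hv huv => hc.1 hu hv (h.adj_of_mem hC hl hu hv huv), fun v w hw hwS hF => ?_⟩
  have hwe : ∀ e ∈ w.edges, e ∈ H.edgeSet := by
    intro e he
    induction e with
    | _ s t =>
      exact h.adj_of_mem hC hl (hwS _ (w.fst_mem_support_of_mem_edges he))
        (hwS _ (w.snd_mem_support_of_mem_edges he)) (w.adj_of_mem_edges he)
  exact hc.2 v (w.transfer H hwe) (hw.transfer hwe) (by simpa using hwS) (by simpa using hF)

omit [DecidableEq V] in
theorem not_triangle {u v w : V} (huv : H.Adj u v) (huw : H.Adj u w) (hvw : H.Adj v w) :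
    u ≠ a ∧ u ≠ b ∧ ¬ H.Adj u a := by
  have he : s(u, v) ∉ (Walk.cons huw (.cons hvw.symm .nil)).edges := by
    simp only [Walk.edges_cons, Walk.edges_nil, List.mem_cons, List.not_mem_nil, or_false]
    rintro (e | e)
    · exact hvw.ne (Sym2.congr_right.1 e)
    · rcases Sym2.eq_iff.1 e with ⟨e, -⟩ | ⟨e, -⟩
      exacts [huw.ne e, huv.ne e]
  refine ⟨?_, h.right huv _ he (by simp), fun ha => ?_⟩
  · rintro rfl
    simpa using h.left huv _ he (by simp) .nil
  · simpa using h.left huv _ he (by simp) (.cons ha .nil)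

omit h [DecidableEq V] in
theorem _root_.IFPaper.adj_of_far_on_nine {k : V} {C : H.Walk k k} (hC : C.IsCycle)
    (h9 : C.length = 9) {l l' l'' : V} (hl : l ∈ C.support) (hl' : l' ∈ C.support)
    (hl'' : l'' ∈ C.support) (hne : l' ≠ l'') (h' : ∀ q : H.Walk l' l, 4 ≤ q.length)
    (h'' : ∀ q : H.Walk l'' l, 4 ≤ q.length) : H.Adj l' l'' := by
  obtain ⟨i, hi, rfl⟩ := exists_cyc_eq hC hl'
  obtain ⟨j, hj, rfl⟩ := exists_cyc_eq hC hl''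
  obtain ⟨t, ht, rfl⟩ := exists_cyc_eq hC hl
  rw [h9] at hi hj ht
  obtain ⟨p, hp, -⟩ := NearOnNine.exists_walk hC h9
    (nearOnNine_one_of ⟨i, hi⟩ ⟨j, hj⟩ ⟨t, ht⟩ (by rintro rfl; exact hne rfl)
      (fun hn => by
        obtain ⟨q, hq, -⟩ := NearOnNine.exists_walk hC h9 hn
        have := h' q
        omega)
      (fun hn => by
        obtain ⟨q, hq, -⟩ := NearOnNine.exists_walk hC h9 hn
        have := h'' q
        omega))
  dsimp only at p hp
  rcases Nat.eq_zero_or_pos p.length with h0 | h0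
  · exact absurd (Walk.eq_of_length_eq_zero h0) hne
  · exact Walk.adj_of_length_eq_one (by omega : p.length = 1)

omit [DecidableEq V] in
theorem not_split_claw {k : V} {C : H.Walk k k} (hC : C.IsCycle) (h9 : C.length = 9)
    {s t l l' l'' : V} (hst : ∀ p : H.Walk t s, 6 ≤ p.length) (ht : t = a ∨ t = b ∨ H.Adj t a)
    (hl : l ∈ C.support) (hl' : l' ∈ C.support) (hl'' : l'' ∈ C.support) (hne : l' ≠ l'')
    (sl : H.Adj s l) (tl' : H.Adj t l') (tl'' : H.Adj t l'') : False := by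
  have hfar : ∀ l', H.Adj t l' → ∀ q : H.Walk l' l, 4 ≤ q.length := fun l' tl' q => by
    have := hst (.cons tl' (q.concat sl.symm))
    simp at this
    omega
  obtain ⟨h1, h2, h3⟩ := h.not_triangle tl' tl''
    (adj_of_far_on_nine hC h9 hl hl' hl'' hne (hfar _ tl') (hfar _ tl''))
  rcases ht with ht | ht | ht
  exacts [h1 ht, h2 ht, h3 ht]

omit [DecidableEq V] in
theorem not_split_claw' {k : V} {C : H.Walk k k} (hC : C.IsCycle) (h9 : C.length = 9)
    {t l' l'' : V} (hl : b ∈ C.support) (hl' : l' ∈ C.support) (hl'' : l'' ∈ C.support)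
    (hne : l' ≠ l'') (ta : H.Adj t a) (tl' : H.Adj t l') (tl'' : H.Adj t l'') : False := by
  have hfar : ∀ l', H.Adj t l' → ∀ q : H.Walk l' b, 4 ≤ q.length := fun l' tl' q => by
    have := h.far (.cons ta.symm (.cons tl' q))
    simp at this
    omega
  exact (h.not_triangle tl' tl''
    (adj_of_far_on_nine hC h9 hl hl' hl'' hne (hfar _ tl') (hfar _ tl''))).2.2 ta

theorem not_hasClaw {k : V} {C : H.Walk k k} (hC : IsGoodCycle H C) (h9 : C.length = 9)
    (haC : a ∉ C.support) {x p₁ p₂ p₃ : V} (hx : x ∉ C.support)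
    (hp₁ : p₁ ∈ C.support) (hp₂ : p₂ ∈ C.support) (hp₃ : p₃ ∈ C.support)
    (h12 : p₁ ≠ p₂) (h13 : p₁ ≠ p₃) (h23 : p₂ ≠ p₃) (x1 : (merge H a b).Adj x p₁)
    (x2 : (merge H a b).Adj x p₂) (x3 : (merge H a b).Adj x p₃) : False := by
  have hgood : ∀ x ∉ C.support, H.Adj x p₁ → H.Adj x p₂ → H.Adj x p₃ → False :=
    fun x hx x1 x2 x3 => hC.2 ⟨hC.1, h9, Or.inl
      ⟨x, hx, p₁, p₂, p₃, hp₁, hp₂, hp₃, h12, h13, h23, x1, x2, x3⟩⟩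
  have far' : ∀ p : H.Walk b a, 6 ≤ p.length := fun p => by simpa using h.far p.reverse
  by_cases hxb : x = b
  · subst hxb
    rcases exists_adj_of_merge_adj x1 with e1 | e1 <;>
    rcases exists_adj_of_merge_adj x2 with e2 | e2 <;>
    rcases exists_adj_of_merge_adj x3 with e3 | e3
    · exact hgood a haC e1 e2 e3
    · exact h.not_split_claw hC.1 h9 h.far (.inl rfl) hp₃ hp₁ hp₂ h12 e3 e1 e2
    · exact h.not_split_claw hC.1 h9 h.far (.inl rfl) hp₂ hp₁ hp₃ h13 e2 e1 e3
    · exact h.not_split_claw hC.1 h9 far' (.inr (.inl rfl)) hp₁ hp₂ hp₃ h23 e1 e2 e3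
    · exact h.not_split_claw hC.1 h9 h.far (.inl rfl) hp₁ hp₂ hp₃ h23 e1 e2 e3
    · exact h.not_split_claw hC.1 h9 far' (.inr (.inl rfl)) hp₂ hp₁ hp₃ h13 e2 e1 e3
    · exact h.not_split_claw hC.1 h9 far' (.inr (.inl rfl)) hp₃ hp₁ hp₂ h12 e3 e1 e2
    · exact hgood x hx e1 e2 e3
  · have key : ∀ p, (merge H a b).Adj x p → H.Adj x p ∨ p = b ∧ H.Adj x a := by
      intro p hp
      by_cases hpb : p = b
      · subst hpb
        exact (exists_adj_of_merge_adj hp.symm).elim (fun e => .inr ⟨rfl, e.symm⟩)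
          fun e => .inl e.symm
      · exact .inl (adj_of_merge_adj hp hxb hpb)
    have key' : ∀ p, (merge H a b).Adj x p → p ≠ b → H.Adj x p :=
      fun p hp hpb => adj_of_merge_adj hp hxb hpb
    rcases key _ x1 with e1 | ⟨rfl, e1⟩
    · rcases key _ x2 with e2 | ⟨rfl, e2⟩
      · rcases key _ x3 with e3 | ⟨rfl, e3⟩
        · exact hgood x hx e1 e2 e3
        · exact h.not_split_claw' hC.1 h9 hp₃ hp₁ hp₂ h12 e3 e1 e2
      · exact h.not_split_claw' hC.1 h9 hp₂ hp₁ hp₃ h13 e2 e1 (key' _ x3 h23.symm)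
    · exact h.not_split_claw' hC.1 h9 hp₁ hp₂ hp₃ h23 e1 (key' _ x2 h12.symm)
        (key' _ x3 h13.symm)

omit h in
theorem edges_subset {k : V} {C : H.Walk k k} (haC : a ∉ C.support) :
    ∀ e ∈ C.edges, e ∈ (merge H a b).edgeSet := by
  intro e he
  induction e with
  | _ s t =>
    exact merge_adj_of_adj (C.adj_of_mem_edges he)
      (fun e => haC (e ▸ C.fst_mem_support_of_mem_edges he))
      (fun e => haC (e ▸ C.snd_mem_support_of_mem_edges he))

theorem isGoodCycle {k : V} {C : H.Walk k k} (hC : IsGoodCycle H C) (haC : a ∉ C.support) :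
    IsGoodCycle (merge H a b) (C.transfer _ (edges_subset haC)) := by
  refine ⟨hC.1.transfer _, fun hbad => ?_⟩
  obtain ⟨-, h9, hbad⟩ := hbad
  rw [Walk.length_transfer] at h9
  rcases hbad with ⟨x, hx, p₁, p₂, p₃, hp₁, hp₂, hp₃, h12, h13, h23, x1, x2, x3⟩ |
    ⟨x, y, z, hx, hy, hz, hxy, hyz, hxz, p₁, p₂, p₃, hp₁, hp₂, hp₃, h12, h13, h23, x1, x2, x3⟩
  all_goals rw [Walk.support_transfer] at *
  · exact h.not_hasClaw hC h9 haC hx hp₁ hp₂ hp₃ h12 h13 h23 x1 x2 x3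
  · have tri : ∀ {x y z : V}, (merge H a b).Adj x y → (merge H a b).Adj y z →
        (merge H a b).Adj x z → x ≠ b ∧ y ≠ b := by
      intro x y z hxy hyz hxz
      have hc : (Walk.cons hxy (.cons hyz (.cons hxz.symm .nil))).IsCycle := by
        simp [Walk.cons_isCycle_iff, hxy.ne, hyz.ne, hxz.ne.symm, hxy.ne.symm, hxz.ne]
      have := h.notMem_of_isCycle hc (by simp)
      simp only [Walk.support_cons, Walk.support_nil, List.mem_cons, not_or] at this
      exact ⟨this.1 ∘ Eq.symm, this.2.1 ∘ Eq.symm⟩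
    obtain ⟨xb, yb⟩ := tri hxy hyz hxz
    obtain ⟨-, zb⟩ := tri hyz hxz.symm hxy.symm
    have exy := adj_of_merge_adj hxy xb yb
    have eyz := adj_of_merge_adj hyz yb zb
    have exz := adj_of_merge_adj hxz xb zb
    have key : ∀ {x y z p : V}, H.Adj x y → H.Adj y z → H.Adj x z → x ≠ b →
        (merge H a b).Adj x p → H.Adj x p := by
      intro x y z p fxy fyz fxz hxb hxp
      by_cases hpb : p = b
      · subst hpb
        exact ((exists_adj_of_merge_adj hxp.symm).resolve_left
          fun e => (h.not_triangle fxy fxz fyz).2.2 e.symm).symm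
      · exact adj_of_merge_adj hxp hxb hpb
    exact hC.2 ⟨hC.1, h9, Or.inr ⟨x, y, z, hx, hy, hz, exy, eyz, exz, p₁, p₂, p₃, hp₁, hp₂, hp₃,
      h12, h13, h23, key exy eyz exz xb x1, key eyz exz.symm exy.symm yb x2,
      key exz.symm exy eyz.symm zb x3⟩⟩

end Mergeable

end

theorem exists_walk_off_of_delEdgesAt {G : SimpleGraph V} {X : Set V} {a b : V}
    (p : (delEdgesAt G X).Walk a b) (ha : a ∉ X) :
    ∃ q : G.Walk a b, q.length = p.length ∧ q.edges = p.edges ∧ ∀ u ∈ q.support, u ∉ X := by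
  induction p with
  | nil => exact ⟨.nil, rfl, rfl, by simpa using ha⟩
  | cons hadj p ih =>
    obtain ⟨q, hl, he, hs⟩ := ih hadj.2.2
    refine ⟨.cons hadj.1 q, by simp [hl], by simp [he], fun u hu => ?_⟩
    rcases List.mem_cons.1 (by simpa using hu) with rfl | hu
    exacts [ha, hs u hu]

namespace OuterConfig

variable {G : SimpleGraph V} {m : ℕ} {x y : ℕ → V} (h : OuterConfig G m x y)

include h

theorem far_of_delEdgesAt {u v : V} (huv : (delEdgesAt G (configSet m x)).Adj u v)
    (p : (delEdgesAt G (configSet m x)).Walk u v) (hp : s(u, v) ∉ p.edges) (hpl : p.length ≤ 4)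
    {i : ℕ} (hi : OnFace m i) (q : G.Walk u (x i)) : 3 ≤ q.length := by
  obtain ⟨p', hl, he, -⟩ := exists_walk_off_of_delEdgesAt p huv.2.1
  refine h.far huv.1 (fun j k hj _ _ hs => ?_) p' (he ▸ hp) (hl ▸ hpl) i hi q
  have hu : u = x j ∨ u = x k := by
    rcases Sym2.eq_iff.1 hs with h | h
    exacts [.inl h.1, .inr h.1]
  rcases hu with hu | hu
  · exact ne_of_notMem_configSet huv.2.1 hj h.seven_le hu
  · exact ne_of_notMem_configSet huv.2.1 ‹_› h.seven_le hu

theorem mergeable_of_far {z : V} (hz : G.Adj (x 2) z)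
    (hfar : ∀ p : (delEdgesAt G (configSet m x)).Walk (y m) z, 6 ≤ p.length) :
    Mergeable (delEdgesAt G (configSet m x)) (y m) z := by
  have hm : OnFace m m := .inr ⟨by have := h.seven_le; omega, le_rfl⟩
  refine ⟨hfar, fun huv p hp hpl q => ?_, fun huv p hp hpl hu => ?_⟩
  · have := h.far_of_delEdgesAt huv p hp hpl hm
      ((q.mapLe (delEdgesAt_le _ _)).concat (h.out_adj h.hasOut_last).symm)
    simpa using this
  · have := h.far_of_delEdgesAt huv p hp hpl (.inl rfl)
      ((Walk.cons hz.symm (.cons (h.adj h.thetaAdj.2.2.1) .nil)).copy hu.symm rfl)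
    simp at this

theorem exists_mergeable [Fintype V] {v₀ : V} {C₀ : G.Walk v₀ v₀} {φ₀ : V → Bool}
    (hM : ExtendsBelow (graphSize G)) (hcex : IsCounterexample G C₀ φ₀)
    {pos : Option V → ℝ × ℝ} {Ed : Option V → Option V → Set (ℝ × ℝ)}
    (hdraw : IsWeakDrawing (addApex G {u | u ∈ C₀.support}) pos Ed) {z z' : V}
    (hz : G.Adj (x 2) z) (hzS : z ∉ configSet m x)
    (hz' : G.Adj (x 2) z') (hzS' : z' ∉ configSet m x) (hne : z ≠ z') :
    Mergeable (delEdgesAt G (configSet m x)) (y m) z ∨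
      Mergeable (delEdgesAt G (configSet m x)) (y m) z' := by
  by_contra hcon
  push Not at hcon
  have key : ∀ t, G.Adj (x 2) t → ¬ Mergeable (delEdgesAt G (configSet m x)) (y m) t →
      ∃ q : G.Walk (y m) t, q.length ≤ 5 ∧ ∀ u ∈ q.support, u ∉ configSet m x := by
    intro t ht hnot
    by_contra hno
    push Not at hno
    refine hnot (h.mergeable_of_far ht fun p => ?_)
    obtain ⟨q, hl, -, hs⟩ := exists_walk_off_of_delEdgesAt p (h.out_notMem h.hasOut_last)
    by_contra hlt
    obtain ⟨u, hu, hu'⟩ := hno q (by omega)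
    exact hs u hu hu'
  obtain ⟨P, hPl, hP⟩ := key z hz hcon.1
  obtain ⟨P', hPl', hP'⟩ := key z' hz' hcon.2
  exact h.no_two_short_walks hM hcex hdraw hz hzS hz' hzS' hne hP hPl hP' hPl'

end OuterConfig

namespace Mergeable

variable [DecidableEq V] {H : SimpleGraph V} {a b : V} (h : Mergeable H a b)

include h

omit [DecidableEq V] in
theorem not_adj_both {v : V} (ha : H.Adj a v) (hb : H.Adj b v) : False := by
  simpa using h.far (.cons ha (.cons hb.symm .nil))

theorem linkGraph_merge_adj {Q : Set V}
    (hQ : ∀ u v, u ∈ Q → v ∈ Q → (merge H a b).Adj u v → H.Adj u v) {c : V → Bool}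
    (hc : c a = c b) {v : V} (hv : (linkGraph H Q c).Adj (some a) (some v)) :
    (linkGraph (merge H a b) Q c).Adj (some b) (some v) := by
  have hvb : v ≠ b := fun e => h.not_adj (e ▸ hv.1)
  have hbv := merge_adj_of_left hv.1 hvb
  exact ⟨hbv, hc ▸ hv.2.1, hv.2.2.1, fun hq => h.not_adj_both hv.1 (hQ _ _ hq.1 hq.2 hbv)⟩

/-- Replacing an acyclic set of edges hanging on the merged vertices by a single vertex. -/
theorem isAcyclic_of_linkGraph {Q : Set V} (hQ : ∀ u v, u ∈ Q → v ∈ Q → (merge H a b).Adj u v →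
    H.Adj u v) {c : V → Bool} (hc : c a = c b) (hac : (linkGraph (merge H a b) Q c).IsAcyclic)
    {T : Set V} (haT : a ∈ T) (hbT : b ∉ T) (hTQ : ∀ t ∈ T, t ∉ Q)
    (hT : ∀ t ∈ T, t ≠ a → ∀ v, ¬ H.Adj t v) {R : SimpleGraph (Option V)}
    (hR : ∀ s t, R.Adj s t → (linkGraph H Q c).Adj s t ∨
      (s ∈ some '' insert b T ∧ t ∈ some '' insert b T))
    (hK : ∀ K : SimpleGraph (Option V), (∀ s t, K.Adj s t → R.Adj s t ∧ s ∈ some '' insert b T ∧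
      t ∈ some '' insert b T) → K.IsAcyclic) : R.IsAcyclic := by
  classical
  have haQ := hTQ a haT
  set g : Option V → Option V := fun s => if s ∈ some '' T then some b else s with hg
  have gT : ∀ s, s ∈ some '' insert b T → g s = some b := by
    rintro _ ⟨v, hv | hv, rfl⟩
    · subst hv
      simp [hg]
    · have : (some v : Option V) ∈ some '' T := ⟨v, hv, rfl⟩
      simp only [hg, this, if_true]
  have gN : ∀ s, s ∉ some '' T → g s = s := fun s hs => if_neg hs
  have gb : ∀ s, g s = some b → s ∈ some '' insert b T := by
    intro s hs
    by_cases hsT : s ∈ some '' T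
    · obtain ⟨v, hv, rfl⟩ := hsT
      exact ⟨v, .inr hv, rfl⟩
    · rw [gN s hsT] at hs
      exact ⟨b, .inl rfl, hs.symm⟩
  have gI : ∀ s t, g s = g t → s = t ∨ g s = some b := by
    intro s t hst
    by_cases hs : s ∈ some '' T
    · exact .inr (if_pos hs)
    · by_cases ht : t ∈ some '' T
      · exact .inr (hst.trans (if_pos ht))
      · rw [gN s hs, gN t ht] at hst
        exact .inl hst
  have link : ∀ s t, R.Adj s t → g s ≠ g t → (linkGraph H Q c).Adj s t := by
    intro s t hst hne
    rcases hR s t hst with h | ⟨hs, ht⟩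
    · exact h
    · exact absurd ((gT s hs).trans (gT t ht).symm) hne
  have inT : ∀ s t, (linkGraph H Q c).Adj s t → s ∈ some '' T → s = some a := by
    rintro _ (- | v) hst ⟨u, hu, rfl⟩
    · exact absurd hst.1 (hTQ u hu)
    · by_contra hne
      exact hT u hu (fun e => hne (e ▸ rfl)) v hst.1
  have outT : ∀ s t, (linkGraph H Q c).Adj s t → s ≠ some a → g s = s :=
    fun s t hst hs => gN s fun hsT => hs (inT s t hst hsT)
  have ga : g (some a) = some b := gT _ ⟨a, .inr haT, rfl⟩
  have hadjL : ∀ t, (linkGraph H Q c).Adj (some a) t →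
      (linkGraph (merge H a b) Q c).Adj (some b) (g t) := by
    rintro (- | v) hv
    · exact absurd hv.1 haQ
    · rw [outT _ _ hv.symm fun e => hv.ne e.symm]
      exact h.linkGraph_merge_adj hQ hc hv
  have gbc : ∀ s t, (linkGraph H Q c).Adj s t → g s = some b → s = some a ∨ s = some b := by
    intro s t hst hs
    by_cases hsa : s = some a
    · exact .inl hsa
    · exact .inr ((outT s t hst hsa).symm.trans hs)
  have common : ∀ t t', (linkGraph H Q c).Adj (some a) t → (linkGraph H Q c).Adj (some b) t' →
      t = t' → False := by
    rintro (- | v) _ hv hv' rfl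
    · exact haQ hv.1
    · exact h.not_adj_both hv.1 hv'.1
  have first : ∀ u v u' v', (linkGraph H Q c).Adj u v → (linkGraph H Q c).Adj u' v' → g u ≠ g v →
      g u = g u' → g v = g v' → u = u' := by
    intro u v u' v' huv huv' hne h1 h2
    rcases gI u u' h1 with h | hub
    · exact h
    · have hv : v = v' := (gI v v' h2).resolve_right fun e => hne (hub.trans e.symm)
      rcases gbc u v huv hub with rfl | rfl <;>
        rcases gbc u' v' huv' (h1.symm.trans hub) with rfl | rfl
      · rfl
      · exact (common _ _ huv huv' hv).elim
      · exact (common _ _ huv' huv hv.symm).elim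
      · rfl
  let K : SimpleGraph (Option V) :=
    { Adj := fun s t => R.Adj s t ∧ s ∈ some '' insert b T ∧ t ∈ some '' insert b T
      symm := ⟨fun _ _ h => ⟨h.1.symm, h.2.2, h.2.1⟩⟩
      loopless := ⟨fun _ h => h.1.ne rfl⟩ }
  refine isAcyclic_of_quotient g hac (hK K fun s t h => h) ?_ ?_ ?_
  · intro s t hst hne
    have hl := link s t hst hne
    by_cases hs : s = some a
    · subst hs
      rw [ga]
      exact hadjL t hl
    · by_cases ht : t = some a
      · subst ht
        rw [ga]
        exact (hadjL s hl.symm).symm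
      · rw [outT s t hl hs, outT t s hl.symm ht]
        rcases s with - | u <;> rcases t with - | v
        · exact hl
        · exact hl
        · exact hl
        · exact ⟨merge_adj_of_adj hl.1 (fun e => hs (e ▸ rfl)) (fun e => ht (e ▸ rfl)), hl.2⟩
  · intro u v u' v' huv huv' hne h1 h2
    have l1 := link u v huv hne
    have l2 := link u' v' huv' (h1 ▸ h2 ▸ hne)
    exact ⟨first u v u' v' l1 l2 hne h1 h2,
      first v u v' u' l1.symm l2.symm hne.symm h2 h1⟩
  · intro u v huv he
    rcases hR u v huv with hl | hl
    · rcases gI u v he with e | hb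
      · exact absurd e huv.ne
      · exact ⟨huv, gb u hb, gb v (he.symm.trans hb)⟩
    · exact ⟨huv, hl⟩

end Mergeable

/-- Each entry of the list, when its turn comes, is attached to the remaining entries and to the
outside by at most one edge. -/
def peelable (m : ℕ) (att : ℕ → Bool) (k : List ℕ) : List ℕ → Bool
  | [] => true
  | i :: l => decide (((l ++ k).filter fun j => decide (ThetaAdj m i j)).length +
      (att i).toNat ≤ 1) && peelable m att k l

/-- The coloring of a configuration in which exactly the entries of `l` and `k` get color `F` is
compatible with the outside, and the entries of `l` can be peeled off in order. The vertex `x i`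
has an outer neighbor of color `F` (`I`) only if `att i` (`blk i`). -/
def IsScheme (m : ℕ) (att blk : ℕ → Bool) (k l : List ℕ) : Bool :=
  ((List.range (m + 1)).all fun i => (List.range (m + 1)).all fun j =>
    !decide (ThetaAdj m i j) || decide (i ∈ l ++ k) || decide (j ∈ l ++ k)) &&
  ((List.range (m + 1)).all fun i => decide (i = 0) || decide (i ∈ l ++ k) || !blk i) &&
  ((l ++ k).all fun i => decide (1 ≤ i) && decide (i ≤ m)) &&
  peelable m att k l

theorem peelable_append {m : ℕ} {att : ℕ → Bool} {k : List ℕ} : ∀ {l₁ : List ℕ} {i : ℕ}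
    {l₂ : List ℕ}, peelable m att k (l₁ ++ i :: l₂) = true →
    ((l₂ ++ k).filter fun j => decide (ThetaAdj m i j)).length + (att i).toNat ≤ 1
  | [], i, l₂, h => by
    simp only [List.nil_append, peelable, Bool.and_eq_true, decide_eq_true_eq] at h
    exact h.1
  | _ :: l₁, i, l₂, h => by
    simp only [List.cons_append, peelable, Bool.and_eq_true] at h
    exact peelable_append h.2

theorem peelable_eq {m : ℕ} {att : ℕ → Bool} {k l₁ l₂ : List ℕ} {i : ℕ}
    (h : peelable m att k (l₁ ++ i :: l₂) = true) {s t : ℕ} (hs : s ∈ l₂ ++ k)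
    (hs' : ThetaAdj m i s) (ht : t ∈ l₂ ++ k) (ht' : ThetaAdj m i t) : s = t := by
  have := peelable_append h
  have hs : s ∈ (l₂ ++ k).filter fun j => decide (ThetaAdj m i j) := by simp_all
  have ht : t ∈ (l₂ ++ k).filter fun j => decide (ThetaAdj m i j) := by simp_all
  generalize (l₂ ++ k).filter (fun j => decide (ThetaAdj m i j)) = L at *
  match L, hs, ht with
  | [a], hs, ht => rw [List.mem_singleton.1 hs, List.mem_singleton.1 ht]
  | a :: b :: L, hs, ht => simp at this; omega

theorem peelable_att {m : ℕ} {att : ℕ → Bool} {k l₁ l₂ : List ℕ} {i : ℕ}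
    (h : peelable m att k (l₁ ++ i :: l₂) = true) {s : ℕ} (hs : s ∈ l₂ ++ k)
    (hs' : ThetaAdj m i s) : att i = false := by
  have hle := peelable_append h
  have hs : s ∈ (l₂ ++ k).filter fun j => decide (ThetaAdj m i j) := by simp_all
  have := List.length_pos_of_mem hs
  cases ha : att i
  · rfl
  · rw [ha, Bool.toNat_true] at hle
    omega

open Classical in
/-- The coloring which agrees with `c` outside the configuration and has color `F` exactly on the
entries of `L` inside of it. -/
noncomputable def recolor (m : ℕ) (x : ℕ → V) (c : V → Bool) (L : List ℕ) : V → Bool := fun u =>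
  if u ∈ configSet m x then decide (∀ i ∈ L, u ≠ x i) else c u

theorem recolor_of_notMem {m : ℕ} {x : ℕ → V} {c : V → Bool} {L : List ℕ} {u : V}
    (hu : u ∉ configSet m x) : recolor m x c L u = c u := if_neg hu

theorem ThetaConfig.recolor_apply {G : SimpleGraph V} {m : ℕ} {x : ℕ → V}
    (h : ThetaConfig G m x) {c : V → Bool} {L : List ℕ} (hL : ∀ i ∈ L, 1 ≤ i ∧ i ≤ m) {i : ℕ}
    (h1 : 1 ≤ i) (hm : i ≤ m) : recolor m x c L (x i) = false ↔ i ∈ L := by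
  simp only [recolor, mem_configSet x h1 hm, if_true, decide_eq_false_iff_not]
  push Not
  constructor
  · rintro ⟨j, hj, he⟩
    exact h.eq_of_eq ⟨h1, hm⟩ (hL j hj) he ▸ hj
  · exact fun hi => ⟨i, hi, rfl⟩

namespace ThetaConfig

variable {G : SimpleGraph V} {m : ℕ} {x : ℕ → V} (h : ThetaConfig G m x)

include h

theorem superIFColoring_recolor {Q : Set V} (hQ : ∀ u ∈ Q, u ∉ configSet m x) {c c₀ : V → Bool}
    (hcI : ∀ u v, u ∉ configSet m x → v ∉ configSet m x → G.Adj u v → c u = true → c v = false)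
    (hcQ : IFColoringOn G Q c₀) (hcc : ∀ u ∈ Q, c u = c₀ u)
    {att blk : ℕ → Bool} {k l : List ℕ} (hs : IsScheme m att blk k l = true)
    (hatt : ∀ i ∈ l, ∀ u, u ∉ configSet m x → G.Adj (x i) u → c u = false → att i = true)
    (huniq : ∀ i ∈ l, ∀ u v, u ∉ configSet m x → G.Adj (x i) u → c u = false →
      v ∉ configSet m x → G.Adj (x i) v → c v = false → u = v)
    (hblk : ∀ i, 1 ≤ i → i ≤ m → ∀ u, u ∉ configSet m x → G.Adj (x i) u → c u = true →
      blk i = true)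
    (hrest : (delEdgesAt (linkGraph G Q (recolor m x c (l ++ k)))
      {s | s ∈ l.map fun i => some (x i)}).IsAcyclic) :
    SuperIFColoring G Q (recolor m x c (l ++ k)) := by
  simp only [IsScheme, Bool.and_eq_true, List.all_eq_true, Bool.or_eq_true, Bool.not_eq_true',
    decide_eq_true_eq, decide_eq_false_iff_not, List.mem_range] at hs
  obtain ⟨⟨⟨hind, hbl⟩, hL⟩, hpeel⟩ := hs
  have hcol : ∀ {i}, 1 ≤ i → i ≤ m → (recolor m x c (l ++ k) (x i) = false ↔ i ∈ l ++ k) :=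
    fun h1 hm => h.recolor_apply hL h1 hm
  have hbF : ∀ i u, 1 ≤ i → i ≤ m → u ∉ configSet m x → G.Adj (x i) u → c u = true →
      i ∈ l ++ k := by
    intro i u h1 hm hu hadj hcu
    have := hbl i (by omega)
    rw [hblk i h1 hm u hu hadj hcu] at this
    rcases this with (h | h) | h
    · omega
    · exact h
    · simp at h
  refine superIFColoring_of_isAcyclic ?_ ?_ ?_
  · intro u v huv hcu
    by_contra hcv
    rw [Bool.not_eq_false] at hcv
    by_cases hu : u ∈ configSet m x <;> by_cases hv : v ∈ configSet m x
    · obtain ⟨i, ⟨hi, him⟩, rfl⟩ := hu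
      obtain ⟨j, ⟨hj, hjm⟩, rfl⟩ := hv
      have ht := (h.adj_iff ⟨hi, him⟩ ⟨hj, hjm⟩).1 huv
      have := hind i (by omega) j (by omega)
      rcases this with (h | h) | h
      · exact h ht
      · rw [(hcol hi him).2 h] at hcu
        simp at hcu
      · rw [(hcol hj hjm).2 h] at hcv
        simp at hcv
    · obtain ⟨i, ⟨hi, him⟩, rfl⟩ := hu
      rw [recolor_of_notMem hv] at hcv
      rw [(hcol hi him).2 (hbF i v hi him hv huv hcv)] at hcu
      simp at hcu
    · obtain ⟨i, ⟨hi, him⟩, rfl⟩ := hv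
      rw [recolor_of_notMem hu] at hcu
      rw [(hcol hi him).2 (hbF i u hi him hu huv.symm hcu)] at hcv
      simp at hcv
    · rw [recolor_of_notMem hu] at hcu
      rw [recolor_of_notMem hv, hcI u v hu hv huv hcu] at hcv
      simp at hcv
  · have hr : ∀ u ∈ Q, recolor m x c (l ++ k) u = c₀ u :=
      fun u hu => (recolor_of_notMem (hQ u hu)).trans (hcc u hu)
    refine ⟨fun u v hu hv huv hcu => ?_, fun v w hw hwQ hwF => hcQ.2 v w hw hwQ fun u hu => ?_⟩
    · rw [hr v hv]
      exact hcQ.1 hu hv huv (hr u hu ▸ hcu)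
    · rw [← hr u (hwQ u hu)]
      exact hwF u hu
  · refine isAcyclic_of_peel _ ?_ hrest
    intro L₁ v L₂ hsplit s t hs hs' ht ht'
    obtain ⟨l₁, l', rfl, rfl, hl'⟩ := List.map_eq_append_iff.1 hsplit
    obtain ⟨i, l₂, rfl, rfl, rfl⟩ := List.map_eq_cons_iff.1 hl'
    have hi := hL i (by simp)
    have hiS := mem_configSet x hi.1 hi.2
    have nbr : ∀ r, (linkGraph G Q (recolor m x c (l₁ ++ i :: l₂ ++ k))).Adj (some (x i)) r →
        r ∉ l₁.map (fun i => some (x i)) →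
        (∃ j, j ∈ l₂ ++ k ∧ ThetaAdj m i j ∧ r = some (x j)) ∨
          ∃ u, u ∉ configSet m x ∧ G.Adj (x i) u ∧ c u = false ∧ r = some u := by
      rintro (- | u) hr hr'
      · exact absurd hiS (hQ _ hr.1)
      · by_cases hu : u ∈ configSet m x
        · obtain ⟨j, ⟨hj, hjm⟩, rfl⟩ := hu
          have hij := (h.adj_iff hi ⟨hj, hjm⟩).1 hr.1
          have hne : j ≠ i := fun e => hr.1.ne (e ▸ rfl)
          have hj' := (hcol hj hjm).1 hr.2.2.1
          have : j ∉ l₁ := fun h => hr' (List.mem_map.2 ⟨j, h, rfl⟩)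
          refine .inl ⟨j, ?_, hij, rfl⟩
          simp only [List.mem_append, List.mem_cons] at hj' ⊢
          rcases hj' with (hj' | hj' | hj') | hj'
          exacts [absurd hj' this, absurd hj' hne, .inl hj', .inr hj']
        · exact .inr ⟨u, hu, hr.1, (recolor_of_notMem hu).symm.trans hr.2.2.1, rfl⟩
    have hil : i ∈ l₁ ++ i :: l₂ := by simp
    rcases nbr s hs hs' with ⟨j, hj, hij, rfl⟩ | ⟨u, hu, hiu, hcu, rfl⟩ <;>
      rcases nbr t ht ht' with ⟨j', hj', hij', rfl⟩ | ⟨u', hu', hiu', hcu', rfl⟩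
    · rw [peelable_eq hpeel hj hij hj' hij']
    · have := peelable_att hpeel hj hij
      rw [hatt i hil u' hu' hiu' hcu'] at this
      simp at this
    · have := peelable_att hpeel hj' hij'
      rw [hatt i hil u hu hiu hcu] at this
      simp at this
    · rw [huniq i hil u u' hu hiu hcu hu' hiu' hcu']

end ThetaConfig

/-- Sufficiently many peeling orders to treat every coloring of the outer neighbors. -/
def schemes : ℕ → List (List ℕ)
  | 7 => [[1, 3, 5, 7], [2, 4, 6, 7], [2, 4, 5, 6, 7], [4, 3, 2, 6, 7], [7, 6, 5, 4, 3, 2],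
      [2, 3, 4, 6, 7], [2, 3, 5, 6, 7], [2, 3, 4, 5, 6, 7], [3, 5, 7, 1, 2], [1, 5, 4, 3, 7],
      [1, 4, 3, 6], [2, 7, 6, 5, 4]]
  | 8 => [[1, 3, 5, 7], [3, 2, 6, 5, 8], [2, 6, 5, 4, 8], [3, 5, 7, 8, 1, 2], [2, 8, 7, 6, 5, 4],
      [6, 5, 4, 3, 2, 8], [8, 7, 6, 5, 4, 3, 2], [1, 3, 2, 5, 7], [1, 5, 4, 3, 7],
      [1, 4, 3, 6, 7], [1, 5, 4, 3, 2, 7], [4, 3, 2, 6, 7, 8], [4, 3, 2, 6, 8], [2, 4, 6, 7, 8],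
      [2, 4, 6, 8], [1, 2, 5, 4, 7]]
  | _ => [[1, 3, 5, 7, 9], [2, 4, 6, 7, 9], [1, 3, 5, 8, 7], [2, 4, 5, 6, 7, 9], [3, 2, 6, 5, 8, 9],
      [4, 3, 2, 6, 7, 9], [1, 3, 2, 5, 7, 8], [3, 5, 7, 9, 1, 2], [2, 6, 5, 4, 8, 9],
      [3, 5, 7, 8, 9, 1, 2], [2, 9, 8, 7, 6, 5, 4], [6, 5, 4, 3, 2, 8, 9], [2, 3, 5, 6, 7, 9],
      [1, 5, 4, 3, 2, 7, 8], [5, 4, 3, 7, 9, 1, 2], [9, 8, 7, 6, 5, 4, 3, 2], [1, 5, 4, 3, 7, 8],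
      [1, 6, 5, 4, 3, 8], [1, 4, 3, 6, 7, 8], [1, 4, 3, 6, 8], [1, 2, 5, 4, 7, 8],
      [5, 4, 7, 9, 1, 2], [2, 3, 4, 5, 6, 7, 9], [4, 3, 2, 6, 7, 8, 9], [2, 3, 4, 6, 7, 9],
      [4, 3, 2, 6, 8, 9], [2, 4, 6, 7, 8, 9], [2, 4, 6, 8, 9]]

/-- Peeling orders which leave the path `x 2, x 1, x m`. -/
def keptSchemes : ℕ → List (List ℕ)
  | 7 => [[5, 4, 3], [3, 5], [5, 4]]
  | 9 => [[3, 5, 7], [5, 4, 3, 7], [5, 4, 7]]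
  | _ => []

/-- The attachments of color `F`, given those of `x 2` and those of the vertices of degree `3`. -/
def attach (m : ℕ) (p : ℕ → Bool) (s : Bool) (i : ℕ) : Bool :=
  if i = 2 then s else decide (HasOut m i) && p i

/-- A function with given values at `3, 4, 5, 7, 8, 9`. -/
def bits (b₃ b₄ b₅ b₇ b₈ b₉ : Bool) : ℕ → Bool
  | 3 => b₃
  | 4 => b₄
  | 5 => b₅
  | 7 => b₇
  | 8 => b₈
  | 9 => b₉
  | _ => false

theorem bits_apply {m i : ℕ} (hi : HasOut m i) (hm : m ≤ 9) (p : ℕ → Bool) :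
    bits (p 3) (p 4) (p 5) (p 7) (p 8) (p 9) i = p i := by
  unfold HasOut at hi
  obtain ⟨h3, hi, h6⟩ := hi
  have : i ≤ 9 := hi.trans hm
  interval_cases i <;> first | rfl | exact absurd rfl h6

/-- The list `l` is a scheme for attachments described by `p`, `s` and `t`. -/
def Works (m : ℕ) (p : ℕ → Bool) (s t : Bool) (k l : List ℕ) : Bool :=
  IsScheme m (attach m p s) (attach m (fun i => !p i) t) k l

/-- The possible attachments, together with the lists which treat them. -/
def tableRow (m : ℕ) (p : ℕ → Bool) : Bool :=
  ((schemes m).any fun l => Works m p true false [] l) &&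
  ((schemes m).any fun l => Works m p false true [] l) &&
  (!p m || (schemes m).any fun l => !decide (2 ∈ l) && Works m p false false [] l) &&
  (((schemes m).any fun l => Works m p true true [] l) ||
    p m && (keptSchemes m).any fun l => Works m p true true [1, 2, m] l)

theorem tableRow_seven : ∀ b₃ b₄ b₅ b₇ b₈ b₉, tableRow 7 (bits b₃ b₄ b₅ b₇ b₈ b₉) = true := by
  decide +kernel

theorem tableRow_eight : ∀ b₃ b₄ b₅ b₇ b₈ b₉, tableRow 8 (bits b₃ b₄ b₅ b₇ b₈ b₉) = true := by
  decide +kernel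

theorem tableRow_nine : ∀ b₃ b₄ b₅ b₇ b₈ b₉, tableRow 9 (bits b₃ b₄ b₅ b₇ b₈ b₉) = true := by
  decide +kernel

theorem tableRow_bits {m : ℕ} (h7 : 7 ≤ m) (h9 : m ≤ 9) (b₃ b₄ b₅ b₇ b₈ b₉ : Bool) :
    tableRow m (bits b₃ b₄ b₅ b₇ b₈ b₉) = true := by
  interval_cases m
  exacts [tableRow_seven .., tableRow_eight .., tableRow_nine ..]

theorem rest_adj {G : SimpleGraph V} {m : ℕ} {x : ℕ → V} {Q : Set V}
    (hQ : ∀ u ∈ Q, u ∉ configSet m x) {c : V → Bool} {k l : List ℕ} {s t : Option V}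
    (hst : (delEdgesAt (linkGraph G Q (recolor m x c (l ++ k)))
      {s | s ∈ l.map fun i => some (x i)}).Adj s t) (hs : ∀ i ∈ k, s ≠ some (x i))
    (ht : ∀ i ∈ k, t ≠ some (x i)) : (linkGraph (delEdgesAt G (configSet m x)) Q c).Adj s t := by
  classical
  have key : ∀ u, recolor m x c (l ++ k) u = false → some u ∉ l.map (fun i => some (x i)) →
      (∀ i ∈ k, some u ≠ some (x i)) → u ∉ configSet m x := by
    intro u hu hul huk huS
    simp only [recolor, huS, if_true, decide_eq_false_iff_not] at hu
    push Not at hu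
    obtain ⟨i, hi, rfl⟩ := hu
    rcases List.mem_append.1 hi with hi | hi
    exacts [hul (List.mem_map.2 ⟨i, hi, rfl⟩), huk i hi rfl]
  obtain ⟨hadj, hsl, htl⟩ := hst
  rcases s with - | u <;> rcases t with - | v
  · exact hadj
  · exact ⟨hadj.1, (recolor_of_notMem (hQ _ hadj.1)).symm.trans hadj.2⟩
  · exact ⟨hadj.1, (recolor_of_notMem (hQ _ hadj.1)).symm.trans hadj.2⟩
  · have hu := key u hadj.2.1 hsl hs
    have hv := key v hadj.2.2.1 htl ht
    exact ⟨⟨hadj.1, hu, hv⟩, (recolor_of_notMem hu).symm.trans hadj.2.1,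
      (recolor_of_notMem hv).symm.trans hadj.2.2.1, hadj.2.2.2⟩

namespace OuterConfig

variable {G : SimpleGraph V} {m : ℕ} {x y : ℕ → V} (h : OuterConfig G m x y)

include h

theorem out_of_adj {i : ℕ} (h1 : 1 ≤ i) (hm : i ≤ m) (h2 : i ≠ 2) {u : V}
    (hu : u ∉ configSet m x) (hadj : G.Adj (x i) u) : HasOut m i ∧ u = y i := by
  rcases h.nbr h1 hm h2 hadj with ⟨j, hj, rfl⟩ | h
  · exact absurd (mem_configSet x hj.1.2.2.1 hj.1.2.2.2) hu
  · exact h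

theorem superIFColoring_of_works {Q : Set V} (hQ : ∀ u ∈ Q, u ∉ configSet m x) {c c₀ : V → Bool}
    (hcI : ∀ u v, u ∉ configSet m x → v ∉ configSet m x → G.Adj u v → c u = true → c v = false)
    (hcQ : IFColoringOn G Q c₀) (hcc : ∀ u ∈ Q, c u = c₀ u) {p : ℕ → Bool}
    (hp : ∀ i, HasOut m i → p i = !c (y i)) {s t : Bool} {k l : List ℕ}
    (hw : Works m p s t k l = true)
    (hs : 2 ∈ l → ∀ u, u ∉ configSet m x → G.Adj (x 2) u → c u = false → s = true)
    (huniq : 2 ∈ l → ∀ u v, u ∉ configSet m x → G.Adj (x 2) u → c u = false →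
      v ∉ configSet m x → G.Adj (x 2) v → c v = false → u = v)
    (ht : ∀ u, u ∉ configSet m x → G.Adj (x 2) u → c u = true → t = true)
    (hrest : (delEdgesAt (linkGraph G Q (recolor m x c (l ++ k)))
      {s | s ∈ l.map fun i => some (x i)}).IsAcyclic) :
    ∃ c, SuperIFColoring G Q c ∧ ∀ u ∈ Q, c u = c₀ u := by
  have hl : ∀ i ∈ l, 1 ≤ i ∧ i ≤ m := by
    simp only [Works, IsScheme, Bool.and_eq_true, List.all_eq_true, decide_eq_true_eq] at hw
    exact fun i hi => hw.1.2 i (List.mem_append.2 (.inl hi))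
  refine ⟨_, h.superIFColoring_recolor hQ hcI hcQ hcc hw ?_ ?_ ?_ hrest,
    fun u hu => (recolor_of_notMem (hQ u hu)).trans (hcc u hu)⟩
  · intro i hi u hu hadj hcu
    unfold attach
    split_ifs with h2
    · subst h2
      exact hs hi u hu hadj hcu
    · obtain ⟨ho, rfl⟩ := h.out_of_adj (hl i hi).1 (hl i hi).2 h2 hu hadj
      simp [ho, hp i ho, hcu]
  · intro i hi u v hu hadj hcu hv hadj' hcv
    by_cases h2 : i = 2
    · subst h2
      exact huniq hi u v hu hadj hcu hv hadj' hcv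
    · rw [(h.out_of_adj (hl i hi).1 (hl i hi).2 h2 hu hadj).2,
        (h.out_of_adj (hl i hi).1 (hl i hi).2 h2 hv hadj').2]
  · intro i h1 hm u hu hadj hcu
    unfold attach
    split_ifs with h2
    · subst h2
      exact ht u hu hadj hcu
    · obtain ⟨ho, rfl⟩ := h.out_of_adj h1 hm h2 hu hadj
      simp [ho, hp i ho, hcu]

omit h in
theorem rest_isAcyclic {Q : Set V} (hQ : ∀ u ∈ Q, u ∉ configSet m x) {c : V → Bool} {l : List ℕ}
    (hac : (linkGraph (delEdgesAt G (configSet m x)) Q c).IsAcyclic) :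
    (delEdgesAt (linkGraph G Q (recolor m x c (l ++ [])))
      {s | s ∈ l.map fun i => some (x i)}).IsAcyclic :=
  hac.anti fun _ _ hst => rest_adj hQ hst (by simp) (by simp)

theorem rest_adj_kept {Q : Set V} (hQ : ∀ u ∈ Q, u ∉ configSet m x) {c : V → Bool} {l : List ℕ}
    {i : ℕ} (h1 : 1 ≤ i) (hm : i ≤ m) {t : Option V}
    (ht : (delEdgesAt (linkGraph G Q (recolor m x c (l ++ [1, 2, m])))
      {s | s ∈ l.map fun i => some (x i)}).Adj (some (x i)) t) :
    (∃ j, (j = 1 ∨ j = 2 ∨ j = m) ∧ ThetaAdj m i j ∧ t = some (x j)) ∨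
      ∃ u, u ∉ configSet m x ∧ G.Adj (x i) u ∧ c u = false ∧ t = some u := by
  obtain ⟨hadj, -, htl⟩ := ht
  rcases t with - | u
  · exact absurd (mem_configSet x h1 hm) (hQ _ hadj.1)
  · by_cases hu : u ∈ configSet m x
    · have hF := hadj.2.2.1
      simp only [recolor, hu, if_true, decide_eq_false_iff_not] at hF
      push Not at hF
      obtain ⟨j, hj, rfl⟩ := hF
      have hj' : j = 1 ∨ j = 2 ∨ j = m := by
        rcases List.mem_append.1 hj with hj | hj
        · exact (htl (List.mem_map.2 ⟨j, hj, rfl⟩)).elim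
        · simpa using hj
      have h7 := h.seven_le
      refine .inl ⟨j, hj', (h.adj_iff ⟨h1, hm⟩ (by omega)).1 hadj.1, rfl⟩
    · exact .inr ⟨u, hu, hadj.1, (recolor_of_notMem hu).symm.trans hadj.2.2.1, rfl⟩

theorem rest_isAcyclic_of_path [DecidableEq V] {z : V} (hzS : z ∉ configSet m x)
    (hmerge : Mergeable (delEdgesAt G (configSet m x)) (y m) z) {Q : Set V}
    (hQ : ∀ u ∈ Q, u ∉ configSet m x) (hyQ : y m ∉ Q)
    (hQM : ∀ u v, u ∈ Q → v ∈ Q → (merge (delEdgesAt G (configSet m x)) (y m) z).Adj u v →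
      (delEdgesAt G (configSet m x)).Adj u v) {c : V → Bool}
    (hac : (linkGraph (merge (delEdgesAt G (configSet m x)) (y m) z) Q c).IsAcyclic)
    (hc : c (y m) = c z)
    (hone : ∀ u, u ∉ configSet m x → G.Adj (x 2) u → c u = false → u = z) {l : List ℕ} :
    (delEdgesAt (linkGraph G Q (recolor m x c (l ++ [1, 2, m])))
      {s | s ∈ l.map fun i => some (x i)}).IsAcyclic := by
  have h7 := h.seven_le
  have hx1 := mem_configSet x (m := m) (i := 1) le_rfl (by omega)
  have hx2 := mem_configSet x (m := m) (i := 2) (by omega) (by omega)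
  have hxm := mem_configSet x (m := m) (i := m) (by omega) le_rfl
  have hyS := h.out_notMem h.hasOut_last
  set R := delEdgesAt (linkGraph G Q (recolor m x c (l ++ [1, 2, m])))
    {s | s ∈ l.map fun i => some (x i)} with hR
  have n1 : ∀ t, R.Adj (some (x 1)) t → t = some (x 2) ∨ t = some (x m) := by
    intro t ht
    rcases h.rest_adj_kept hQ le_rfl (by omega) ht with ⟨j, hj, hij, rfl⟩ | ⟨u, hu, hadj, -, rfl⟩
    · rcases hj with rfl | rfl | rfl
      · unfold ThetaAdj at hij
        omega
      · exact .inl rfl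
      · exact .inr rfl
    · have := (h.out_of_adj le_rfl (by omega) (by omega) hu hadj).1
      unfold HasOut at this
      omega
  have n2 : ∀ t, R.Adj (some (x 2)) t → t = some (x 1) ∨ t = some z := by
    intro t ht
    rcases h.rest_adj_kept hQ (by omega) (by omega) ht with
      ⟨j, hj, hij, rfl⟩ | ⟨u, hu, hadj, hcu, rfl⟩
    · have : j = 1 := by
        unfold ThetaAdj at hij
        omega
      exact .inl (this ▸ rfl)
    · exact .inr (hone u hu hadj hcu ▸ rfl)
  have nm : ∀ t, R.Adj (some (x m)) t → t = some (x 1) ∨ t = some (y m) := by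
    intro t ht
    rcases h.rest_adj_kept hQ (by omega) le_rfl ht with
      ⟨j, hj, hij, rfl⟩ | ⟨u, hu, hadj, hcu, rfl⟩
    · have : j = 1 := by
        unfold ThetaAdj at hij
        omega
      exact .inl (this ▸ rfl)
    · exact .inr ((h.out_of_adj (by omega) le_rfl (by omega) hu hadj).2 ▸ rfl)
  have hRR : ∀ s t, R.Adj s t → (∀ i ∈ [1, 2, m], s ≠ some (x i)) →
      (∀ i ∈ [1, 2, m], t ≠ some (x i)) →
      (linkGraph (delEdgesAt G (configSet m x)) Q c).Adj s t :=
    fun s t hst hs ht => rest_adj hQ hst hs ht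
  have notS : ∀ u, u ∉ configSet m x → ∀ i ∈ [1, 2, m], (some u : Option V) ≠ some (x i) := by
    rintro u hu i hi he
    obtain rfl := Option.some.inj he
    simp only [List.mem_cons, List.not_mem_nil, or_false] at hi
    rcases hi with rfl | rfl | rfl <;> exact hu ‹_›
  set T : Set V := {y m, x 1, x 2, x m} with hT
  have hkept : ∀ s t, R.Adj s t → (∃ i ∈ [1, 2, m], s = some (x i)) →
      s ∈ some '' insert z T ∧ t ∈ some '' insert z T := by
    rintro s t hst ⟨i, hi, rfl⟩
    simp only [List.mem_cons, List.not_mem_nil, or_false] at hi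
    rcases hi with rfl | rfl | rfl
    · rcases n1 t hst with rfl | rfl <;> simp [hT]
    · rcases n2 t hst with rfl | rfl <;> simp [hT]
    · rcases nm t hst with rfl | rfl <;> simp [hT]
  refine hmerge.isAcyclic_of_linkGraph hQM hc hac (T := T) (by simp [hT]) ?_ ?_ ?_
    (fun s t hst => ?_) fun K hK => ?_
  · rintro (e | e | e | e)
    · exact hmerge.ne e.symm
    all_goals exact hzS (e ▸ ‹_›)
  · rintro t (rfl | rfl | rfl | rfl) htQ
    · exact hyQ htQ
    all_goals exact hQ _ htQ ‹_›
  · rintro t (rfl | rfl | rfl | rfl) hne v hadj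
    · exact hne rfl
    all_goals exact hadj.2.1 ‹_›
  · by_cases hs : ∃ i ∈ [1, 2, m], s = some (x i)
    · exact .inr (hkept s t hst hs)
    · by_cases ht : ∃ i ∈ [1, 2, m], t = some (x i)
      · exact .inr (hkept t s hst.symm ht).symm
      · push Not at hs ht
        exact .inl (hRR s t hst hs ht)
  · have memT : ∀ s t, K.Adj s t → t = some z ∨ t = some (y m) ∨ t = some (x 1) ∨
        t = some (x 2) ∨ t = some (x m) := by
      intro s t hst
      obtain ⟨-, -, ⟨v, hv, rfl⟩⟩ := hK s t hst
      rcases hv with rfl | rfl | rfl | rfl | rfl <;> simp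
    have ny : ∀ t, K.Adj (some (y m)) t → t = some (x m) := by
      intro t ht
      have hR' := (hK _ _ ht).1
      rcases memT _ t ht with rfl | rfl | rfl | rfl | rfl
      · exact absurd (hRR _ _ hR' (notS _ hyS) (notS _ hzS)).1 hmerge.not_adj
      · exact absurd rfl ht.ne
      · rcases n1 _ hR'.symm with e | e <;> rw [Option.some.inj e] at hyS
        exacts [absurd hx2 hyS, absurd hxm hyS]
      · rcases n2 _ hR'.symm with e | e
        · rw [Option.some.inj e] at hyS
          exact absurd hx1 hyS
        · exact absurd (Option.some.inj e) hmerge.ne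
      · rfl
    refine isAcyclic_of_del_leaf (some (y m)) (fun a b ha hb => (ny a ha).trans (ny b hb).symm) ?_
    refine isAcyclic_of_del_leaf (some (x m)) (fun a b ha hb => ?_) ?_
    · have aux : ∀ a, (delEdgesAt K {some (y m)}).Adj (some (x m)) a → a = some (x 1) := fun a ha =>
        (nm a (hK _ _ ha.1).1).resolve_right ha.2.2
      rw [aux a ha, aux b hb]
    refine isAcyclic_of_del_leaf (some (x 1)) (fun a b ha hb => ?_) ?_
    · have aux : ∀ a, (delEdgesAt (delEdgesAt K {some (y m)}) {some (x m)}).Adj (some (x 1)) a →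
          a = some (x 2) := fun a ha => (n1 a (hK _ _ ha.1.1).1).resolve_right ha.2.2
      rw [aux a ha, aux b hb]
    refine isAcyclic_of_del_leaf (some (x 2)) (fun a b ha hb => ?_) ?_
    · have aux : ∀ a, (delEdgesAt (delEdgesAt (delEdgesAt K {some (y m)}) {some (x m)})
          {some (x 1)}).Adj (some (x 2)) a → a = some z :=
        fun a ha => (n2 a (hK _ _ ha.1.1.1).1).resolve_left ha.2.2
      rw [aux a ha, aux b hb]
    refine isAcyclic_bot.anti fun s t hst => ?_
    have only : ∀ s t, (delEdgesAt (delEdgesAt (delEdgesAt (delEdgesAt K {some (y m)}) {some (x m)})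
        {some (x 1)}) {some (x 2)}).Adj s t → t = some z := by
      intro s t hst
      rcases memT s t hst.1.1.1.1 with e | e | e | e | e
      exacts [e, absurd e hst.1.1.1.2.2, absurd e hst.1.2.2, absurd e hst.2.2,
        absurd e hst.1.1.2.2]
    exact (hst.ne ((only _ _ hst.symm).trans (only _ _ hst).symm)).elim

theorem exists_works (p : ℕ → Bool) : ∃ q : ℕ → Bool, (∀ i, HasOut m i → q i = p i) ∧
    (∃ l, Works m q true false [] l = true) ∧ (∃ l, Works m q false true [] l = true) ∧
    (p m = true → ∃ l, 2 ∉ l ∧ Works m q false false [] l = true) ∧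
    ((∃ l, Works m q true true [] l = true) ∨
      p m = true ∧ ∃ l, Works m q true true [1, 2, m] l = true) := by
  have hrow := tableRow_bits h.seven_le h.le_nine (p 3) (p 4) (p 5) (p 7) (p 8) (p 9)
  have hq := fun i hi => bits_apply (i := i) hi h.le_nine p
  refine ⟨_, hq, ?_⟩
  simp only [tableRow, Bool.and_eq_true, Bool.or_eq_true, List.any_eq_true, Bool.not_eq_true',
    decide_eq_false_iff_not, hq m h.hasOut_last] at hrow
  obtain ⟨⟨⟨⟨l₁, -, h₁⟩, ⟨l₂, -, h₂⟩⟩, h₃⟩, h₄⟩ := hrow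
  refine ⟨⟨l₁, h₁⟩, ⟨l₂, h₂⟩, fun hp => ?_, ?_⟩
  · rcases h₃ with h₃ | ⟨l, -, h₃⟩
    · rw [hp] at h₃
      simp at h₃
    · exact ⟨l, h₃⟩
  · rcases h₄ with ⟨l, -, h₄⟩ | ⟨hp, l, -, h₄⟩
    exacts [.inl ⟨l, h₄⟩, .inr ⟨hp, l, h₄⟩]

theorem exists_super_of_subsingleton {Q : Set V} (hQ : ∀ u ∈ Q, u ∉ configSet m x)
    {c c₀ : V → Bool}
    (hcI : ∀ u v, u ∉ configSet m x → v ∉ configSet m x → G.Adj u v → c u = true → c v = false)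
    (hcQ : IFColoringOn G Q c₀) (hcc : ∀ u ∈ Q, c u = c₀ u)
    (hac : (linkGraph (delEdgesAt G (configSet m x)) Q c).IsAcyclic)
    (hone : ∀ u v, u ∉ configSet m x → G.Adj (x 2) u → v ∉ configSet m x → G.Adj (x 2) v →
      u = v) : ∃ c, SuperIFColoring G Q c ∧ ∀ u ∈ Q, c u = c₀ u := by
  obtain ⟨q, hq, ⟨l₁, h₁⟩, ⟨l₂, h₂⟩, -, -⟩ := h.exists_works fun i => !c (y i)
  by_cases hz : ∃ z, z ∉ configSet m x ∧ G.Adj (x 2) z ∧ c z = false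
  · obtain ⟨z, hzS, hz, hcz⟩ := hz
    refine h.superIFColoring_of_works hQ hcI hcQ hcc hq h₁ (fun _ _ _ _ _ => rfl)
      (fun _ u v hu hu' _ hv hv' _ => hone u v hu hu' hv hv') (fun u hu hu' hcu => ?_)
      (rest_isAcyclic hQ hac)
    rw [hone u z hu hu' hzS hz, hcz] at hcu
    exact hcu
  · exact h.superIFColoring_of_works hQ hcI hcQ hcc hq h₂
      (fun _ u hu hu' hcu => absurd ⟨u, hu, hu', hcu⟩ hz)
      (fun _ u v hu hu' _ hv hv' _ => hone u v hu hu' hv hv') (fun _ _ _ _ => rfl)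
      (rest_isAcyclic hQ hac)

theorem exists_super_of_mergeable [DecidableEq V] {z z' : V}
    (hz : G.Adj (x 2) z) (hzS : z ∉ configSet m x)
    (hmerge : Mergeable (delEdgesAt G (configSet m x)) (y m) z) {Q : Set V}
    (hQ : ∀ u ∈ Q, u ∉ configSet m x) (hyQ : y m ∉ Q)
    (hQM : ∀ u v, u ∈ Q → v ∈ Q → (merge (delEdgesAt G (configSet m x)) (y m) z).Adj u v →
      (delEdgesAt G (configSet m x)).Adj u v) {c c₀ : V → Bool}
    (hcI : ∀ u v, u ∉ configSet m x → v ∉ configSet m x → G.Adj u v → c u = true → c v = false)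
    (hcQ : IFColoringOn G Q c₀) (hcc : ∀ u ∈ Q, c u = c₀ u)
    (hac : (linkGraph (merge (delEdgesAt G (configSet m x)) (y m) z) Q c).IsAcyclic)
    (hc : c (y m) = c z)
    (htwo : ∀ u, u ∉ configSet m x → G.Adj (x 2) u → u = z ∨ u = z') :
    ∃ c, SuperIFColoring G Q c ∧ ∀ u ∈ Q, c u = c₀ u := by
  have hbase : (linkGraph (delEdgesAt G (configSet m x)) Q c).IsAcyclic := by
    refine hmerge.isAcyclic_of_linkGraph hQM hc hac (T := {y m}) rfl (fun e => hmerge.ne e.symm)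
      (by rintro _ rfl; exact hyQ) (by rintro _ rfl hne; exact absurd rfl hne)
      (fun s t hst => .inl hst) fun K hK => ?_
    have : K = ⊥ := by
      ext s t
      refine iff_of_false (fun hst => ?_) (by simp)
      obtain ⟨hadj, ⟨u, hu, rfl⟩, ⟨v, hv, rfl⟩⟩ := hK s t hst
      rcases hu with rfl | rfl <;> rcases hv with rfl | rfl
      exacts [hadj.ne rfl, hmerge.not_adj hadj.1.symm, hmerge.not_adj hadj.1, hadj.ne rfl]
    exact this ▸ isAcyclic_bot
  obtain ⟨q, hq, -, ⟨l₂, h₂⟩, h₃, h₄⟩ := h.exists_works fun i => !c (y i)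
  by_cases hzz : ∀ u v, u ∉ configSet m x → G.Adj (x 2) u → v ∉ configSet m x → G.Adj (x 2) v →
      c u = c v
  · cases hcz : c z
    · obtain ⟨l, h2l, hl⟩ := h₃ (by simp [hc, hcz])
      refine h.superIFColoring_of_works hQ hcI hcQ hcc hq hl (fun h2 => absurd h2 h2l)
        (fun h2 => absurd h2 h2l) (fun u hu hu' hcu => ?_) (rest_isAcyclic hQ hbase)
      rw [hzz u z hu hu' hzS hz, hcz] at hcu
      exact hcu
    · refine h.superIFColoring_of_works hQ hcI hcQ hcc hq h₂ (fun _ u hu hu' hcu => ?_)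
        (fun _ u v hu hu' hcu _ _ _ => ?_) (fun _ _ _ _ => rfl) (rest_isAcyclic hQ hbase) <;>
      · rw [hzz u z hu hu' hzS hz, hcz] at hcu
        simp at hcu
  · push Not at hzz
    have huniq : ∀ u v, u ∉ configSet m x → G.Adj (x 2) u → c u = false → v ∉ configSet m x →
        G.Adj (x 2) v → c v = false → u = v := by
      obtain ⟨u₀, v₀, hu₀, hu₀', hv₀, hv₀', hne⟩ := hzz
      have hzz' : c z ≠ c z' := by
        intro e
        rcases htwo u₀ hu₀ hu₀' with rfl | rfl <;> rcases htwo v₀ hv₀ hv₀' with rfl | rfl <;>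
          simp_all
      intro u v hu hu' hcu hv hv' hcv
      rcases htwo u hu hu' with rfl | rfl <;> rcases htwo v hv hv' with rfl | rfl <;> simp_all
    rcases h₄ with ⟨l, hl⟩ | ⟨hm, l, hl⟩
    · exact h.superIFColoring_of_works hQ hcI hcQ hcc hq hl (fun _ _ _ _ _ => rfl)
        (fun _ => huniq) (fun _ _ _ _ => rfl) (rest_isAcyclic hQ hbase)
    · have hcz : c z = false := by simpa [hc] using hm
      refine h.superIFColoring_of_works hQ hcI hcQ hcc hq hl (fun _ _ _ _ _ => rfl)
        (fun _ => huniq) (fun _ _ _ _ => rfl) ?_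
      exact h.rest_isAcyclic_of_path hzS hmerge hQ hyQ hQM hac hc fun u hu hu' hcu =>
        huniq u z hu hu' hcu hzS hz hcz

end OuterConfig

theorem linkGraph_congr_le {G : SimpleGraph V} {Q : Set V} {c c' : V → Bool} {a : V}
    (ha : ∀ v, ¬ G.Adj a v) (haQ : a ∉ Q) (hc : ∀ u, u ≠ a → c u = c' u) :
    linkGraph G Q c ≤ linkGraph G Q c' := by
  have hne : ∀ {u v}, G.Adj u v → u ≠ a ∧ v ≠ a := fun h =>
    ⟨fun e => ha _ (e ▸ h), fun e => ha _ (e ▸ h.symm)⟩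
  intro s t hst
  rcases s with - | u <;> rcases t with - | v
  · exact hst
  · exact ⟨hst.1, (hc v fun e => haQ (e ▸ hst.1)).symm.trans hst.2⟩
  · exact ⟨hst.1, (hc u fun e => haQ (e ▸ hst.1)).symm.trans hst.2⟩
  · obtain ⟨h1, h2, h3, h4⟩ := hst
    exact ⟨h1, (hc u (hne h1).1).symm.trans h2, (hc v (hne h1).2).symm.trans h3, h4⟩

namespace OuterConfig

variable {G : SimpleGraph V} {m : ℕ} {x y : ℕ → V} (h : OuterConfig G m x y)

include h

theorem graphSize_delEdgesAt_lt [Fintype V] :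
    graphSize (delEdgesAt G (configSet m x)) < graphSize G :=
  graphSize_lt_of_le (delEdgesAt_le _ _) (h.adj h.thetaAdj.2.1)
    fun e => e.2.1 (mem_configSet x le_rfl (by have := h.seven_le; omega))

theorem exists_super_of_two [Fintype V] [DecidableEq V] {v₀ : V} {C₀ : G.Walk v₀ v₀}
    {φ₀ : V → Bool} (hM : ExtendsBelow (graphSize G)) (hcex : IsCounterexample G C₀ φ₀)
    (hS : ∀ u ∈ C₀.support, u ∉ configSet m x) (hy : y m ∉ C₀.support) {z z' : V}
    (hz : G.Adj (x 2) z) (hzS : z ∉ configSet m x)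
    (hmerge : Mergeable (delEdgesAt G (configSet m x)) (y m) z)
    (htwo : ∀ u, u ∉ configSet m x → G.Adj (x 2) u → u = z ∨ u = z') :
    ExtendsToSuper G C₀ φ₀ := by
  obtain ⟨hpl, hap, hgood, hlen, hφ, -⟩ := hcex
  have h7 := h.seven_le
  have hle := delEdgesAt_le G (configSet m x)
  have hyS := h.out_notMem h.hasOut_last
  have hym : G.Adj (x m) (y m) := h.out_adj h.hasOut_last
  have hoff : ∀ i, 1 ≤ i → i ≤ m → ∀ t, ¬ (delEdgesAt G (configSet m x)).Adj (x i) t :=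
    fun i hi hi' t e => e.2.1 (mem_configSet x hi hi')
  have hx : ∀ {i}, 1 ≤ i → i ≤ m → ∀ {u}, u ∉ configSet m x → u ≠ x i := by
    rintro i hi hi' _ hu rfl
    exact hu (mem_configSet x hi hi')
  set C₁ := C₀.transfer _ (walk_edges_delEdgesAt C₀ hS) with hC₁
  have hs₁ : C₁.support = C₀.support := Walk.support_transfer ..
  have hl₁ : C₁.length ≤ 9 := by rwa [hC₁, Walk.length_transfer]
  have hg₁ : IsGoodCycle _ C₁ := hgood.transfer hle _
  have hy₁ : y m ∉ C₁.support := hs₁ ▸ hy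
  have hφ₁ : IFColoringOn (delEdgesAt G (configSet m x)) {u | u ∈ C₁.support} φ₀ := by
    rw [hs₁]
    exact hφ.anti hle
  set C₂ := C₁.transfer _ (Mergeable.edges_subset (b := z) hy₁) with hC₂
  have hs₂ : C₂.support = C₁.support := Walk.support_transfer ..
  obtain ⟨c, hc, hcc⟩ := hM.extendsToSuper _ le_rfl
    (isPlanarGraph_merge hpl (u := x 2) (v := x 1) (w := x m) hz.symm (h.adj h.thetaAdj.2.2.1)
      (h.adj h.thetaAdj.1.symm) hym (hx le_rfl (by omega) hzS) (hx (by omega) le_rfl hzS)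
      hmerge.ne.symm (fun e => by have := h.eq_of_eq (by omega) (by omega) e; omega)
      (hx (by omega) (by omega) hyS).symm (hx le_rfl (by omega) hyS).symm hle
      (hoff 2 (by omega) (by omega)) (hoff 1 le_rfl (by omega)) (hoff m (by omega) le_rfl))
    (hmerge.shortApart (h.apart.mono hle)) (hmerge.isGoodCycle hg₁ hy₁)
    (by rwa [Walk.length_transfer])
    (c₀ := φ₀) (by rw [Walk.support_transfer]; exact hmerge.ifColoringOn hg₁.1 hl₁ hφ₁)
    ((graphSize_merge_le _ _ _).trans_lt h.graphSize_delEdgesAt_lt)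
  rw [Walk.support_transfer, hs₁] at hc hcc
  refine h.exists_super_of_mergeable hz hzS hmerge hS hy (c := Function.update c (y m) (c z))
    (fun u v hu hv huv => hmerge.adj_of_mem hg₁.1 hl₁ (hs₁ ▸ hu) (hs₁ ▸ hv) huv) ?_ hφ ?_ ?_ ?_ htwo
  · intro u v hu hv huv
    have huv' : (delEdgesAt G (configSet m x)).Adj u v := ⟨huv, hu, hv⟩
    by_cases hua : u = y m
    · subst hua
      rw [Function.update_self, Function.update_of_ne huv.ne.symm]
      exact hc.1.1 (merge_adj_of_left huv' fun e => hmerge.not_adj (e ▸ huv'))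
    by_cases hva : v = y m
    · subst hva
      rw [Function.update_self, Function.update_of_ne huv.ne]
      exact hc.1.1 (merge_adj_of_left huv'.symm fun e : u = z =>
        hmerge.not_adj (e ▸ huv'.symm)).symm
    rw [Function.update_of_ne hua, Function.update_of_ne hva]
    exact hc.1.1 (merge_adj_of_adj huv' hua hva)
  · intro u hu
    rw [Function.update_of_ne fun e : u = y m => hy (e ▸ hu)]
    exact hcc u hu
  · exact hc.isAcyclic_linkGraph.anti (linkGraph_congr_le (not_merge_adj_left hmerge.ne) hy
      fun u hu => Function.update_of_ne hu _ _)
  · rw [Function.update_self, Function.update_of_ne hmerge.ne.symm]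

theorem exists_super_of_one [Fintype V] {v₀ : V} {C₀ : G.Walk v₀ v₀}
    {φ₀ : V → Bool} (hM : ExtendsBelow (graphSize G)) (hcex : IsCounterexample G C₀ φ₀)
    (hS : ∀ u ∈ C₀.support, u ∉ configSet m x)
    (hone : ∀ u v, u ∉ configSet m x → G.Adj (x 2) u → v ∉ configSet m x → G.Adj (x 2) v →
      u = v) : ExtendsToSuper G C₀ φ₀ := by
  obtain ⟨hpl, hap, hgood, hlen, hφ, -⟩ := hcex
  have hle := delEdgesAt_le G (configSet m x)
  obtain ⟨c, hc, hcc⟩ := hM.extendsToSuper _ le_rfl (hpl.mono hle) (h.apart.mono hle)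
    (hgood.transfer hle (walk_edges_delEdgesAt C₀ hS)) (by rwa [Walk.length_transfer])
    (c₀ := φ₀) (by rw [Walk.support_transfer]; exact hφ.anti hle) h.graphSize_delEdgesAt_lt
  rw [Walk.support_transfer] at hc hcc
  exact h.exists_super_of_subsingleton hS (fun u v hu hv huv => hc.1.1 ⟨huv, hu, hv⟩) hφ hcc
    hc.isAcyclic_linkGraph hone

/-- In a counterexample avoiding the configuration, whose smaller instances extend, the vertex
`x 2` has at least three outer neighbors. -/
theorem two_lt_card_outer [Fintype V] {v₀ : V} {C₀ : G.Walk v₀ v₀}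
    {φ₀ : V → Bool} (hM : ExtendsBelow (graphSize G)) (hcex : IsCounterexample G C₀ φ₀)
    {pos : Option V → ℝ × ℝ} {Ed : Option V → Option V → Set (ℝ × ℝ)}
    (hdraw : IsWeakDrawing (addApex G {u | u ∈ C₀.support}) pos Ed)
    (hS : ∀ u ∈ C₀.support, u ∉ configSet m x) (hy : y m ∉ C₀.support) (s : Finset V)
    (hs : ∀ u, u ∉ configSet m x → G.Adj (x 2) u → u ∈ s) : 2 < s.card := by
  classical
  by_contra hcard
  refine hcex.2.2.2.2.2 ?_
  by_cases hone : ∀ u v, u ∉ configSet m x → G.Adj (x 2) u → v ∉ configSet m x → G.Adj (x 2) v →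
      u = v
  · exact h.exists_super_of_one hM hcex hS hone
  push Not at hone
  obtain ⟨z, z', hzS, hz, hzS', hz', hne⟩ := hone
  have htwo : ∀ u, u ∉ configSet m x → G.Adj (x 2) u → u = z ∨ u = z' := by
    intro u hu hu'
    have hsub : ({z, z'} : Finset V) ⊆ s := by
      simp only [Finset.insert_subset_iff, Finset.singleton_subset_iff]
      exact ⟨hs z hzS hz, hs z' hzS' hz'⟩
    have he := Finset.eq_of_subset_of_card_le hsub (by rw [Finset.card_pair hne]; omega)
    simpa [← he] using hs u hu hu'
  rcases h.exists_mergeable hM hcex hdraw hz hzS hz' hzS' hne with hm | hm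
  · exact h.exists_super_of_two hM hcex hS hy hz hzS hm htwo
  · exact h.exists_super_of_two hM hcex hS hy hz' hzS' hm fun u hu hu' => (htwo u hu hu').symm

end OuterConfig

theorem exists_third_neighbor [Fintype V] [DecidableEq V] {G : SimpleGraph V} [DecidableRel G.Adj]
    {v a b : V} (hv : G.degree v = 3) (ha : G.Adj v a) (hb : G.Adj v b) (hab : a ≠ b) :
    ∃ c, G.Adj v c ∧ c ≠ a ∧ c ≠ b ∧ ∀ u, G.Adj v u → u = a ∨ u = b ∨ u = c := by
  have hsub : ({a, b} : Finset V) ⊆ G.neighborFinset v := by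
    simp [Finset.insert_subset_iff, ha, hb]
  have hcard : (G.neighborFinset v \ {a, b}).card = 1 := by
    rw [Finset.card_sdiff_of_subset hsub, card_neighborFinset_eq_degree, hv,
      Finset.card_pair hab]
  obtain ⟨c, hc⟩ := Finset.card_eq_one.1 hcard
  have hmem : ∀ u, (G.Adj v u ∧ ¬ (u = a ∨ u = b)) ↔ u = c := fun u => by
    simpa using Finset.ext_iff.1 hc u
  obtain ⟨h1, h2⟩ := (hmem c).2 rfl
  refine ⟨c, h1, fun e => h2 (.inl e), fun e => h2 (.inr e), fun u hu => ?_⟩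
  by_cases h : u = a ∨ u = b
  · exact h.elim .inl fun h => .inr (.inl h)
  · exact .inr (.inr ((hmem u).1 ⟨hu, h⟩))

theorem ThetaConfig.exists_outerConfig [Fintype V] [DecidableEq V] {G : SimpleGraph V}
    [DecidableRel G.Adj] {m : ℕ} {x : ℕ → V} (h : ThetaConfig G m x)
    (hdeg : ∀ i, 1 ≤ i → i ≤ m → i ≠ 2 → G.degree (x i) = 3) : ∃ y, OuterConfig G m x y := by
  have h7 := h.seven_le
  have hne : ∀ {i j}, 1 ≤ i ∧ i ≤ m → 1 ≤ j ∧ j ≤ m → i ≠ j → x i ≠ x j :=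
    fun hi hj hij e => hij (h.eq_of_eq hi hj e)
  have key : ∀ i, ∃ c, 1 ≤ i → i ≤ m → i ≠ 2 →
      ((HasOut m i → G.Adj (x i) c ∧ ∀ j, 1 ≤ j → j ≤ m → c ≠ x j) ∧
      ∀ u, G.Adj (x i) u → (∃ j, ThetaAdj m i j ∧ u = x j) ∨ (HasOut m i ∧ u = c)) := by
    intro i
    by_cases hi : 1 ≤ i ∧ i ≤ m ∧ i ≠ 2
    swap
    · exact ⟨x 1, fun h1 h2 h3 => absurd ⟨h1, h2, h3⟩ hi⟩
    obtain ⟨h1, hm, h2⟩ := hi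
    obtain ⟨j, k, hij, hik, hjk, hrest⟩ : ∃ j k, ThetaAdj m i j ∧ ThetaAdj m i k ∧ j ≠ k ∧
        ((HasOut m i ∧ ∀ l, ThetaAdj m i l → l = j ∨ l = k) ∨
          (¬ HasOut m i ∧ ∃ l, ThetaAdj m i l ∧ l ≠ j ∧ l ≠ k)) := by
      unfold ThetaAdj HasOut
      by_cases hi1 : i = 1
      · exact ⟨2, 6, by omega, by omega, by omega, .inr ⟨by omega, m, by omega⟩⟩
      by_cases hi6 : i = 6
      · exact ⟨5, 7, by omega, by omega, by omega, .inr ⟨by omega, 1, by omega⟩⟩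
      by_cases him : i = m
      · exact ⟨1, m - 1, by omega, by omega, by omega, .inl ⟨by omega, by omega⟩⟩
      · exact ⟨i - 1, i + 1, by omega, by omega, by omega, .inl ⟨by omega, by omega⟩⟩
    obtain ⟨c, hc, hca, hcb, hall⟩ := exists_third_neighbor (hdeg i h1 hm h2) (h.adj hij)
      (h.adj hik) (hne hij.1.2.2 hik.1.2.2 hjk)
    refine ⟨c, fun _ _ _ => ⟨fun ho => ⟨hc, ?_⟩, fun u hu => ?_⟩⟩
    · rintro l hl hl' rfl
      rcases hrest with ⟨-, hrest⟩ | ⟨hno, -⟩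
      · rcases hrest l ((h.adj_iff ⟨h1, hm⟩ ⟨hl, hl'⟩).1 hc) with rfl | rfl
        exacts [hca rfl, hcb rfl]
      · exact hno ho
    · rcases hall u hu with rfl | rfl | rfl
      · exact .inl ⟨j, hij, rfl⟩
      · exact .inl ⟨k, hik, rfl⟩
      · rcases hrest with ⟨ho, -⟩ | ⟨-, l, hil, hlj, hlk⟩
        · exact .inr ⟨ho, rfl⟩
        · rcases hall _ (h.adj hil) with e | e | e
          · exact absurd e (hne hil.1.2.2 hij.1.2.2 hlj)
          · exact absurd e (hne hil.1.2.2 hik.1.2.2 hlk)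
          · exact .inl ⟨l, hil, e.symm⟩
  choose y hy using key
  have hout : ∀ {i}, HasOut m i → 1 ≤ i ∧ i ≤ m ∧ i ≠ 2 := by
    unfold HasOut
    omega
  exact ⟨y, { h with
    nbr := fun h1 hm h2 hu => (hy _ h1 hm h2).2 _ hu
    out_adj := fun ho => ((hy _ (hout ho).1 (hout ho).2.1 (hout ho).2.2).1 ho).1
    out_ne := fun ho => ((hy _ (hout ho).1 (hout ho).2.1 (hout ho).2.2).1 ho).2 _ }⟩

theorem vertexOnFace_of_mem_support {G : SimpleGraph V} {vtx : V → ℝ × ℝ}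
    {arc : V → V → ℝ → ℝ × ℝ} (hemb : IsPlaneEmbedding G vtx arc) {D : Set (ℝ × ℝ)} {a : V}
    {C : G.Walk a a} (hC : ¬ C.Nil) (hD : frontier D = WalkDrawing G arc C) {u : V}
    (hu : u ∈ C.support) : VertexOnFace vtx D u := by
  obtain ⟨v, hv⟩ : ∃ v, s(u, v) ∈ C.edges := by
    obtain ⟨e, he, hue⟩ := (Walk.mem_support_iff_exists_mem_edges_of_not_nil hC).1 hu
    obtain ⟨v, rfl⟩ := Sym2.mem_iff_exists.1 hue
    exact ⟨v, he⟩
  have huv := C.adj_of_mem_edges hv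
  rw [VertexOnFace, hD]
  simp only [WalkDrawing, Set.mem_iUnion]
  exact ⟨u, v, huv, hv, 0, by simp, hemb.arc_start huv⟩

theorem thetaConfig_of_cycles {G : SimpleGraph V} (hap : ShortApart G) {m : ℕ} (hm7 : 7 ≤ m)
    (hm9 : m ≤ 9) {x : ℕ → V} (hx : Set.InjOn x (Set.Icc 1 m)) {w₁ w₂ : G.Walk (x 1) (x 1)}
    (hw₁ : w₁.IsCycle)
    (he₁ : ∀ e : Sym2 V, e ∈ w₁.edges ↔
      (e = s(x 1, x 6) ∨ (∃ i : ℕ, 6 ≤ i ∧ i < m ∧ e = s(x i, x (i + 1))) ∨ e = s(x m, x 1)))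
    (he₂ : ∀ e : Sym2 V, e ∈ w₂.edges ↔
      ((∃ i : ℕ, 1 ≤ i ∧ i < 6 ∧ e = s(x i, x (i + 1))) ∨ e = s(x 6, x 1))) :
    ThetaConfig G m x ∧ ∀ i, OnFace m i → x i ∈ w₁.support := by
  classical
  have hlen : w₁.length ≤ 5 := by
    have hsub : w₁.edges.toFinset ⊆ insert s(x 1, x 6) (insert s(x m, x 1)
        ((Finset.Ico 6 m).image fun i => s(x i, x (i + 1)))) := by
      intro e he
      rcases (he₁ e).1 (List.mem_toFinset.1 he) with rfl | ⟨i, h6, hm, rfl⟩ | rfl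
      · simp
      · simp only [Finset.mem_insert, Finset.mem_image, Finset.mem_Ico]
        exact .inr (.inr ⟨i, ⟨h6, hm⟩, rfl⟩)
      · simp
    have hc := Finset.card_le_card hsub
    rw [List.toFinset_card_of_nodup hw₁.isTrail.edges_nodup, Walk.length_edges] at hc
    have h1 := Finset.card_insert_le s(x 1, x 6) (insert s(x m, x 1)
      ((Finset.Ico 6 m).image fun i => s(x i, x (i + 1))))
    have h2 := Finset.card_insert_le s(x m, x 1)
      ((Finset.Ico 6 m).image fun i => s(x i, x (i + 1)))
    have h3 : ((Finset.Ico 6 m).image fun i => s(x i, x (i + 1))).card ≤ m - 6 := by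
      simpa using Finset.card_image_le (s := Finset.Ico 6 m) (f := fun i => s(x i, x (i + 1)))
    omega
  have hsupp : ∀ i, OnFace m i → x i ∈ w₁.support := by
    rintro i (rfl | ⟨h6, hm⟩)
    · exact w₁.start_mem_support
    · rcases hm.eq_or_lt with rfl | hm
      · exact w₁.fst_mem_support_of_mem_edges ((he₁ _).2 (.inr (.inr rfl)))
      · exact w₁.fst_mem_support_of_mem_edges ((he₁ _).2 (.inr (.inl ⟨i, h6, hm, rfl⟩)))
  have hsucc : ∀ i, 1 ≤ i → i < m → G.Adj (x i) (x (i + 1)) := by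
    intro i h1 hm
    by_cases h6 : i < 6
    · exact w₂.adj_of_mem_edges ((he₂ _).2 (.inl ⟨i, h1, h6, rfl⟩))
    · exact w₁.adj_of_mem_edges ((he₁ _).2 (.inr (.inl ⟨i, by omega, hm, rfl⟩)))
  have h16 : G.Adj (x 1) (x 6) := w₁.adj_of_mem_edges ((he₁ _).2 (.inl rfl))
  have hm1 : G.Adj (x m) (x 1) := w₁.adj_of_mem_edges ((he₁ _).2 (.inr (.inr rfl)))
  refine ⟨⟨hm7, hm9, hx, ?_, hap, ?_⟩, hsupp⟩
  · rintro i j ⟨⟨hi, hi', hj, hj'⟩, rfl | rfl | ⟨rfl, rfl⟩ | ⟨rfl, rfl⟩ | ⟨rfl, rfl⟩ | ⟨rfl, rfl⟩⟩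
    exacts [hsucc i hi hj', (hsucc j hj hi').symm, h16, h16.symm, hm1.symm, hm1]
  · intro u v huv hne p hp hpl i hi q
    refine hap.three_le_of_cycle hw₁ hlen huv (fun he => ?_) hp hpl (hsupp i hi) q
    rcases (he₁ _).1 he with e | ⟨i, h6, hm, e⟩ | e
    · exact hne 1 6 (.inl rfl) (.inr (by omega)) (by unfold ThetaAdj; omega) e
    · exact hne i (i + 1) (.inr (by omega)) (.inr (by omega)) (by unfold ThetaAdj; omega) e
    · exact hne m 1 (.inr (by omega)) (.inl rfl) (by unfold ThetaAdj; omega) e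

/-- In a minimal counterexample `(G, C0, φ0)` to the extension
theorem, embedded in the plane so that the chordless cycle `C0` bounds the
outer face `D`: let `[x1 x6 x7 … xm]` (with `7 ≤ m ≤ 9`) be an internal face
and let `[x1 x2 x3 x4 x5 x6]` be an internal `6`-face sharing the edge
`x1 x6`, and let `xx` be the third neighbor of `xm` (besides `x (m-1)` and
`x1`).  If every `x i` with `i ≠ 2` is a `3`-vertex and `xx` is an internal
vertex, then `x2` has degree at least `5`. -/
theorem degree_five_vertex {V : Type} [Fintype V] [DecidableEq V]
    (G : SimpleGraph V) [DecidableRel G.Adj]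
    {v0 : V} (C0 : G.Walk v0 v0) (φ0 : V → Bool)
    (hmin : IsMinimalCounterexample G C0 φ0)
    (vtx : V → ℝ × ℝ) (arc : V → V → ℝ → ℝ × ℝ)
    (hemb : IsPlaneEmbedding G vtx arc)
    (hchordless : Chordless G C0)
    (D : Set (ℝ × ℝ)) (hD : IsOuterFace G vtx arc D)
    (hbound : frontier D = WalkDrawing G arc C0)
    (m : ℕ) (hm7 : 7 ≤ m) (hm9 : m ≤ 9)
    (x : ℕ → V) (hx_inj : Set.InjOn x (Set.Icc 1 m))
    -- `f1` is the internal face `[x1 x6 x7 … xm]`, with boundary cycle `w1`: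
    (w1 : G.Walk (x 1) (x 1)) (f1 : Set (ℝ × ℝ))
    (hw1 : w1.IsCycle)
    (hedges1 : ∀ e : Sym2 V, e ∈ w1.edges ↔
      (e = s(x 1, x 6) ∨ (∃ i : ℕ, 6 ≤ i ∧ i < m ∧ e = s(x i, x (i + 1))) ∨
        e = s(x m, x 1)))
    (hf1 : FaceBoundedBy G vtx arc f1 w1)
    (hint1 : ∀ z ∈ w1.support, ¬ VertexOnFace vtx D z)
    -- `f2` is the internal `6`-face `[x1 x2 x3 x4 x5 x6]`, with boundary
    -- cycle `w2`, sharing the edge `x1 x6`: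
    (w2 : G.Walk (x 1) (x 1)) (f2 : Set (ℝ × ℝ))
    (hw2 : w2.IsCycle) (hl2 : w2.length = 6)
    (hedges2 : ∀ e : Sym2 V, e ∈ w2.edges ↔
      ((∃ i : ℕ, 1 ≤ i ∧ i < 6 ∧ e = s(x i, x (i + 1))) ∨ e = s(x 6, x 1)))
    (hf2 : FaceBoundedBy G vtx arc f2 w2)
    (hint2 : ∀ z ∈ w2.support, ¬ VertexOnFace vtx D z)
    -- `xx` is the third neighbor of `x m`:
    (xx : V) (hxx : G.Adj (x m) xx) (hxx1 : xx ≠ x (m - 1)) (hxx2 : xx ≠ x 1)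
    -- every `x i` with `i ≠ 2` is a `3`-vertex:
    (hdeg : ∀ i : ℕ, 1 ≤ i → i ≤ m → i ≠ 2 → G.degree (x i) = 3)
    -- `xx` is an internal vertex:
    (hxxint : ¬ VertexOnFace vtx D xx) :
    5 ≤ G.degree (x 2) := by
  obtain ⟨hcex, hleast⟩ := hmin
  obtain ⟨hθ, hface⟩ := thetaConfig_of_cycles hcex.2.1.shortApart hm7 hm9 hx_inj hw1 hedges1 hedges2
  obtain ⟨y, h⟩ := hθ.exists_outerConfig hdeg
  have hnil : ¬ C0.Nil := hcex.2.2.1.1.not_nil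
  have hC0 : ∀ u ∈ C0.support, VertexOnFace vtx D u :=
    fun u => vertexOnFace_of_mem_support hemb hnil hbound
  have hS : ∀ u ∈ C0.support, u ∉ configSet m x := by
    rintro _ hu ⟨i, ⟨h1, hm⟩, rfl⟩
    by_cases hi : OnFace m i
    · exact hint1 _ (hface i hi) (hC0 _ hu)
    · have hi6 : i < 6 := by
        unfold OnFace at hi
        omega
      exact hint2 _ (w2.fst_mem_support_of_mem_edges ((hedges2 _).2 (.inl ⟨i, h1, hi6, rfl⟩)))
        (hC0 _ hu)
  have hy : y m = xx := by
    rcases h.nbr (by omega) le_rfl (by omega) hxx with ⟨j, hj, rfl⟩ | ⟨-, e⟩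
    · have : j = m - 1 ∨ j = 1 := by
        unfold ThetaAdj at hj
        omega
      rcases this with rfl | rfl
      exacts [absurd rfl hxx1, absurd rfl hxx2]
    · exact e.symm
  obtain ⟨pos, Ed, hdraw⟩ := exists_weakDrawing_addApex hemb hD.1 C0 hnil hbound
  have hsub : ({x 1, x 3} : Finset V) ⊆ G.neighborFinset (x 2) := by
    have h1 : G.Adj (x 2) (x 1) := h.adj h.thetaAdj.2.2.1
    have h3 : G.Adj (x 2) (x 3) := h.adj (by unfold ThetaAdj; omega)
    simp [Finset.insert_subset_iff, h1, h3]
  have h13 : x 1 ≠ x 3 := fun e => by simpa using h.eq_of_eq (by omega) (by omega) e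
  have hcard := h.two_lt_card_outer hleast hcex hdraw hS (fun hu => hxxint (hC0 _ (hy ▸ hu)))
    (G.neighborFinset (x 2) \ {x 1, x 3}) fun u hu hu' => by
      have hne : ∀ i, 1 ≤ i → i ≤ m → u ≠ x i := by
        rintro i h1 hm rfl
        exact hu (mem_configSet x h1 hm)
      simp [hu', hne 1 le_rfl (by omega), hne 3 (by omega) (by omega)]
  rw [Finset.card_sdiff_of_subset hsub, card_neighborFinset_eq_degree,
      Finset.card_pair h13] at hcard
  omega

end IFPaper
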